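/- arXiv:1306.5469 — 4 statements merged into one kernel-verified Lean document; each statement's English description precedes it below -/
import Mathlib

section
/- Let 𝒥 ⊆ ℝ² be a self-similar set satisfying the Open Set Condition whose generating maps are homotheties with equal contraction ratios, T_i(x) = (1/s)x + z_i for i = 1,…,s, with the translation centers z_i not all collinear, and with diam(𝒥) comparable to 1. Let 𝒥₀ be the convex hull of 𝒥 and 𝒥_{n+1} := ⋃_{i=1}^s T_i(𝒥_n). Then for every point a ∈ ℝ² ∖ 𝒥 there exist constants C₁, C₂ > 0 (depending on a and 𝒥) such that for all integers n ≥ 2, vis(a; 𝒥_n) ≤ C₁ · √(Fav(𝒥_{⌈C₂ log n⌉})). -/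
open MeasureTheory Metric Set

/-- The radial projection from the vantage point `a`: `P_a(x) = (x - a)/|x - a|`. -/
noncomputable def radialProj (a x : ℂ) : ℂ := ‖x - a‖⁻¹ • (x - a)

/-- The visibility of `S` from `a`: the normalized arc-length of the radial
projection of `S` from `a` to the unit circle centered at `a`. -/
noncomputable def vis (a : ℂ) (S : Set ℂ) : ℝ :=
  (μH[1] (radialProj a '' (S \ {a}))).toReal / (2 * Real.pi)

/-- The linear projection `π_θ(x,y) = x cos θ + y sin θ`. -/
noncomputable def linproj (θ : ℝ) (z : ℂ) : ℝ := z.re * Real.cos θ + z.im * Real.sin θ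

/-- The Favard length of a planar set. -/
noncomputable def Fav (S : Set ℂ) : ℝ :=
  (1 / Real.pi) * ∫ θ in (0:ℝ)..Real.pi, (volume (linproj θ '' S)).toReal


lemma pieces_aux (s : ℕ) (z : Fin s → ℂ) (ρ : ℝ) (m : ℕ) :
    ∃ F : Finset ℂ, F.card ≤ s ^ m ∧ ∀ K : ℕ → Set ℂ,
      (∀ n, K (n + 1) = ⋃ i, (fun x : ℂ => ρ • x + z i) '' K n) →
      ∀ k, K (m + k) = ⋃ c ∈ F, (fun x : ℂ => ρ ^ m • x + c) '' K k := by
  classical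
  induction m with
  | zero => exact ⟨{0}, by simp, fun K hK k => by simp⟩
  | succ m ih =>
    obtain ⟨F, hF, h⟩ := ih
    refine ⟨(Finset.univ ×ˢ F).image (fun p : Fin s × ℂ => ρ • p.2 + z p.1), ?_, ?_⟩
    · refine Finset.card_image_le.trans ?_
      rw [Finset.card_product, Finset.card_univ, Fintype.card_fin, pow_succ, mul_comm]
      exact Nat.mul_le_mul_right _ hF
    · intro K hK k
      have e : m + 1 + k = (m + k) + 1 := by ring
      rw [e, hK, h K hK]
      ext y
      simp only [mem_iUnion, mem_image, Finset.mem_image, Finset.mem_product, Finset.mem_univ,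
        true_and, Prod.exists, exists_prop]
      constructor
      · rintro ⟨i, _, ⟨c, hc, x, hx, rfl⟩, rfl⟩
        refine ⟨_, ⟨i, c, hc, rfl⟩, x, hx, ?_⟩
        rw [smul_add, smul_smul, pow_succ']
        ring
      · rintro ⟨_, ⟨i, c, hc, rfl⟩, x, hx, rfl⟩
        refine ⟨i, _, ⟨c, hc, x, hx, rfl⟩, ?_⟩
        rw [smul_add, smul_smul, pow_succ']
        ring

lemma linproj_eq (θ : ℝ) (x : ℂ) :
    linproj θ x = (x * Complex.exp (-(θ * Complex.I))).re := by
  rw [← neg_mul, ← Complex.ofReal_neg, Complex.mul_re, Complex.exp_ofReal_mul_I_re,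
    Complex.exp_ofReal_mul_I_im]
  simp [linproj]

lemma linproj_affine (θ t : ℝ) (x c : ℂ) :
    linproj θ (t • x + c) = t * linproj θ x + linproj θ c := by
  simp [linproj]; ring

lemma linproj_sub (θ : ℝ) (x y : ℂ) :
    linproj θ x - linproj θ y = linproj θ (x - y) := by
  simp [linproj]; ring

lemma abs_linproj_le (θ : ℝ) (x : ℂ) : |linproj θ x| ≤ ‖x‖ := by
  rw [linproj_eq]
  refine (Complex.abs_re_le_norm _).trans ?_
  rw [norm_mul, ← neg_mul, ← Complex.ofReal_neg, Complex.norm_exp_ofReal_mul_I, mul_one]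

lemma continuous_linproj (θ : ℝ) : Continuous (linproj θ) := by
  unfold linproj; fun_prop

lemma vol_linproj_le {S : Set ℂ} {R : ℝ} (hR : S ⊆ closedBall 0 R) (θ : ℝ) :
    volume (linproj θ '' S) ≤ ENNReal.ofReal (2 * R) := by
  have : linproj θ '' S ⊆ Icc (-R) R := by
    rintro _ ⟨x, hx, rfl⟩
    have := hR hx
    rw [mem_closedBall_zero_iff] at this
    exact abs_le.1 ((abs_linproj_le θ x).trans this)
  refine (measure_mono this).trans ?_
  rw [Real.volume_Icc]
  apply le_of_eq; congr 1; ring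

lemma vol_linproj_lt_top {S : Set ℂ} (hS : IsCompact S) (θ : ℝ) :
    volume (linproj θ '' S) ≠ ⊤ :=
  (hS.image (continuous_linproj θ)).measure_lt_top.ne

lemma integrable_linproj {S : Set ℂ} (hS : IsCompact S) :
    Integrable (fun θ => (volume (linproj θ '' S)).toReal)
      (volume.restrict (Ioc 0 Real.pi)) := by
  obtain ⟨R, hR⟩ := hS.isBounded.subset_closedBall 0
  set E : Set (ℝ × ℝ) := (fun p : ℝ × ℂ => (p.1, linproj p.1 p.2)) '' (Icc 0 Real.pi ×ˢ S)
  have hE : IsCompact E := by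
    apply (isCompact_Icc.prod hS).image
    unfold linproj; fun_prop
  have hm := measurable_measure_prodMk_left (ν := (volume : Measure ℝ)) hE.isClosed.measurableSet
  have heq : ∀ θ ∈ Ioc 0 Real.pi, Prod.mk θ ⁻¹' E = linproj θ '' S := by
    intro θ hθ
    ext t
    simp only [E, mem_preimage, mem_image, mem_prod, Prod.exists, Prod.mk.injEq]
    constructor
    · rintro ⟨θ', x, ⟨h1, h2⟩, rfl, rfl⟩
      exact ⟨x, h2, rfl⟩
    · rintro ⟨x, h2, rfl⟩
      exact ⟨θ, x, ⟨⟨hθ.1.le, hθ.2⟩, h2⟩, rfl, rfl⟩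
  have hae : (fun θ => (volume (Prod.mk θ ⁻¹' E)).toReal) =ᵐ[volume.restrict (Ioc 0 Real.pi)]
      (fun θ => (volume (linproj θ '' S)).toReal) := by
    filter_upwards [ae_restrict_mem measurableSet_Ioc] with θ hθ
    rw [heq θ hθ]
  refine Integrable.mono' (g := fun _ => (ENNReal.ofReal (2 * R)).toReal) (integrable_const _)
    (hm.ennreal_toReal.aestronglyMeasurable.congr hae) (Filter.Eventually.of_forall fun θ => ?_)
  rw [Real.norm_eq_abs, abs_of_nonneg ENNReal.toReal_nonneg]
  exact ENNReal.toReal_mono ENNReal.ofReal_ne_top (vol_linproj_le hR θ)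

lemma fav_eq (S : Set ℂ) :
    Real.pi * Fav S = ∫ θ in Ioc 0 Real.pi, (volume (linproj θ '' S)).toReal := by
  rw [Fav, intervalIntegral.integral_of_le Real.pi_pos.le, ← mul_assoc,
    mul_one_div_cancel Real.pi_ne_zero, one_mul]

lemma fav_mono {S S' : Set ℂ} (hS' : IsCompact S') (hS : IsCompact S) (h : S ⊆ S') :
    Fav S ≤ Fav S' := by
  have : Real.pi * Fav S ≤ Real.pi * Fav S' := by
    rw [fav_eq, fav_eq]
    apply integral_mono (integrable_linproj hS) (integrable_linproj hS')
    intro θ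
    exact ENNReal.toReal_mono (vol_linproj_lt_top hS' θ) (measure_mono (image_mono h))
  exact le_of_mul_le_mul_left this Real.pi_pos

lemma fav_cheb {S : Set ℂ} (hS : IsCompact S) (hpos : 0 < Fav S) :
    volume ({θ | Real.sqrt (Fav S) ≤ (volume (linproj θ '' S)).toReal} ∩ Ioc 0 Real.pi)
      ≤ ENNReal.ofReal (Real.pi * Real.sqrt (Fav S)) := by
  have h := mul_meas_ge_le_integral_of_nonneg
    (Filter.Eventually.of_forall fun θ => ENNReal.toReal_nonneg) (integrable_linproj hS)
    (Real.sqrt (Fav S))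
  rw [← fav_eq, measureReal_def, Measure.restrict_apply' measurableSet_Ioc] at h
  have hq : 0 < Real.sqrt (Fav S) := Real.sqrt_pos.2 hpos
  have hsq := Real.mul_self_sqrt hpos.le
  apply (ENNReal.le_ofReal_iff_toReal_le ?_ (by positivity)).2
  · apply le_of_mul_le_mul_left _ hq
    refine h.trans (le_of_eq ?_)
    conv_lhs => rw [← hsq]
    ring
  · exact (measure_mono inter_subset_right |>.trans_lt (by simp)).ne

lemma vol_linproj_ball {S : Set ℂ} {x₀ : ℂ} {r : ℝ} (h : closedBall x₀ r ⊆ S) (θ : ℝ) :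
    ENNReal.ofReal (2 * r) ≤ volume (linproj θ '' S) := by
  have : Icc (linproj θ x₀ - r) (linproj θ x₀ + r) ⊆ linproj θ '' S := by
    intro t ht
    refine ⟨(t - linproj θ x₀) • Complex.exp (θ * Complex.I) + x₀, h ?_, ?_⟩
    · rw [mem_closedBall, dist_eq_norm, add_sub_cancel_right, norm_smul,
        Complex.norm_exp_ofReal_mul_I, mul_one, Real.norm_eq_abs, abs_le]
      constructor <;> linarith [ht.1, ht.2]
    · rw [linproj_affine]
      have : linproj θ (Complex.exp (θ * Complex.I)) = 1 := by
        rw [linproj, Complex.exp_ofReal_mul_I_re, Complex.exp_ofReal_mul_I_im]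
        nlinarith [Real.sin_sq_add_cos_sq θ]
      rw [this]; ring
  refine le_trans ?_ (measure_mono this)
  rw [Real.volume_Icc]
  apply le_of_eq; congr 1; ring

lemma fav_pos {S : Set ℂ} (hS : IsCompact S) {x₀ : ℂ} {r : ℝ} (hr : 0 < r)
    (h : closedBall x₀ r ⊆ S) : 0 < Fav S := by
  have : Real.pi * (2 * r) ≤ Real.pi * Fav S := by
    rw [fav_eq]
    have : Real.pi * (2 * r) = ∫ θ in Ioc 0 Real.pi, (2 * r) := by
      simp [Real.pi_pos.le]
    rw [this]
    apply integral_mono (integrable_const _) (integrable_linproj hS)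
    intro θ
    have := ENNReal.toReal_mono (vol_linproj_lt_top hS θ) (vol_linproj_ball h θ)
    rwa [ENNReal.toReal_ofReal (by positivity)] at this
  have := le_of_mul_le_mul_left this Real.pi_pos
  linarith

lemma hausdorff_exp (ω : ℂ) (hω : ‖ω‖ = 1) (B : Set ℝ) :
    μH[1] ((fun θ : ℝ => ω * Complex.exp (θ * Complex.I)) '' B) ≤ volume B := by
  have hL : LipschitzWith 1 (fun θ : ℝ => ω * Complex.exp (θ * Complex.I)) := by
    apply LipschitzWith.of_dist_le_mul
    intro x y
    rw [dist_eq_norm, ← mul_sub, norm_mul, hω, one_mul]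
    have : Complex.exp (x * Complex.I) - Complex.exp (y * Complex.I)
       = Complex.exp (y * Complex.I) * (Complex.exp (Complex.I * (x - y : ℝ)) - 1) := by
      rw [mul_sub, ← Complex.exp_add]; push_cast; ring_nf
    rw [this, norm_mul, Complex.norm_exp_ofReal_mul_I, one_mul]
    simpa [Real.dist_eq] using Real.norm_exp_I_mul_ofReal_sub_one_le (x := x - y)
  have := hL.hausdorffMeasure_image_le (d := 1) zero_le_one B
  simpa [hausdorffMeasure_real] using this

lemma compact_hull {J : Set ℂ} (hJ : IsCompact J) : IsCompact (convexHull ℝ J) := by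
  rcases J.eq_empty_or_nonempty with rfl | ⟨x₀, hx₀⟩
  · simp
  have hc : IsCompact ((fun p : (Fin 3 → ℝ) × (Fin 3 → ℂ) => ∑ i, p.1 i • p.2 i) ''
      (stdSimplex ℝ (Fin 3) ×ˢ (Set.univ.pi fun _ => J))) := by
    apply ((isCompact_stdSimplex ℝ (Fin 3)).prod (isCompact_univ_pi fun _ => hJ)).image
    fun_prop
  convert hc using 1
  apply Subset.antisymm
  · intro x hx
    obtain ⟨ι, _, z, w, hz, hai, hw, hw1, hx⟩ := eq_pos_convex_span_of_mem_convexHull hx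
    have hcard : Fintype.card ι ≤ Fintype.card (Fin 3) := by
      have h1 := hai.card_le_finrank_succ
      have h2 := Submodule.finrank_le (vectorSpan ℝ (Set.range z))
      rw [Complex.finrank_real_complex] at h2
      rw [Fintype.card_fin]; omega
    obtain ⟨e⟩ := Function.Embedding.nonempty_of_card_le hcard
    have hw' : ∀ j ∉ Set.range e, Function.extend e w 0 j = 0 := fun j hj =>
      Function.extend_apply' _ _ _ (by simpa using hj)
    refine ⟨(Function.extend e w 0, Function.extend e z (fun _ => x₀)), ⟨⟨?_, ?_⟩, ?_⟩, ?_⟩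
    · intro j
      by_cases hj : j ∈ Set.range e
      · obtain ⟨i, rfl⟩ := hj
        simp only [e.injective.extend_apply]
        exact (hw i).le
      · exact (hw' j hj).ge
    · rw [← hw1]
      exact (Fintype.sum_of_injective e e.injective _ _ hw'
        fun i => (e.injective.extend_apply _ _ _).symm).symm
    · intro j _
      by_cases hj : j ∈ Set.range e
      · obtain ⟨i, rfl⟩ := hj
        simp only [e.injective.extend_apply]
        exact hz ⟨i, rfl⟩
      · simp only
        rw [Function.extend_apply' _ _ _ (by simpa using hj)]
        exact hx₀
    · rw [← hx]
      refine (Fintype.sum_of_injective e e.injective _ _ ?_ ?_).symm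
      · intro j hj
        simp only [hw' j hj, zero_smul]
      · intro i
        simp only [e.injective.extend_apply]
  · rintro _ ⟨⟨w, z⟩, ⟨⟨hw, hw1⟩, hz⟩, rfl⟩
    exact (convex_convexHull ℝ J).sum_mem (fun i _ => hw i) hw1
      fun i _ => subset_convexHull ℝ J (hz i (mem_univ i))

lemma exists_max_disjoint {ι : Type*} [DecidableEq ι] (I : ι → Set ℝ) (hI : ∀ i, (I i).Nonempty)
    (F : Finset ι) :
    ∃ U ⊆ F, (U : Set ι).PairwiseDisjoint I ∧ ∀ i ∈ F, ∃ j ∈ U, ¬ Disjoint (I i) (I j) := by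
  induction F using Finset.induction_on with
  | empty => exact ⟨∅, by simp, by simp, by simp⟩
  | insert i F hi ih =>
    obtain ⟨U, hU, hd, hc⟩ := ih
    by_cases h : ∃ j ∈ U, ¬ Disjoint (I i) (I j)
    · refine ⟨U, hU.trans (Finset.subset_insert _ _), hd, ?_⟩
      intro l hl
      rcases Finset.mem_insert.1 hl with rfl | hl
      · exact h
      · exact hc l hl
    · push Not at h
      refine ⟨insert i U, Finset.insert_subset_insert _ hU, ?_, ?_⟩
      · rw [Finset.coe_insert]
        exact hd.insert fun j hj _ => h j hj
      · intro l hl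
        rcases Finset.mem_insert.1 hl with rfl | hl
        · refine ⟨l, Finset.mem_insert_self _ _, ?_⟩
          rw [disjoint_self]
          exact (hI l).ne_empty
        · obtain ⟨j, hj, hj'⟩ := hc l hl
          exact ⟨j, Finset.mem_insert_of_mem hj, hj'⟩

lemma normalize_lip :
    LipschitzWith 2 (fun t : ℝ => ‖(1 + t * Complex.I : ℂ)‖⁻¹ • (1 + t * Complex.I : ℂ)) := by
  apply LipschitzWith.of_dist_le_mul
  intro x y
  set u : ℂ := 1 + x * Complex.I with hu
  set v : ℂ := 1 + y * Complex.I with hv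
  have h1 : 1 ≤ ‖u‖ := by
    have := Complex.abs_re_le_norm u
    simpa [hu] using this
  have h2 : 1 ≤ ‖v‖ := by
    have := Complex.abs_re_le_norm v
    simpa [hv] using this
  have huv : ‖u - v‖ = dist x y := by
    have : u - v = ((x - y : ℝ) : ℂ) * Complex.I := by rw [hu, hv]; push_cast; ring
    rw [this, norm_mul, Complex.norm_real, Complex.norm_I, mul_one, Real.dist_eq, Real.norm_eq_abs]
  have hu0 : 0 < ‖u‖ := by linarith
  have hv0 : 0 < ‖v‖ := by linarith
  rw [dist_eq_norm, ← huv]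
  have e : ‖u‖⁻¹ • u - ‖v‖⁻¹ • v = ‖u‖⁻¹ • (u - v) + (‖u‖⁻¹ * (‖v‖ - ‖u‖) * ‖v‖⁻¹) • v := by
    have : ‖u‖⁻¹ * (‖v‖ - ‖u‖) * ‖v‖⁻¹ = ‖u‖⁻¹ - ‖v‖⁻¹ := by field_simp
    rw [this, sub_smul, smul_sub]; abel
  rw [e]
  refine (norm_add_le _ _).trans ?_
  rw [norm_smul, norm_smul, norm_mul, norm_mul, norm_inv, norm_norm, norm_inv, norm_norm]
  have h3 : ‖‖v‖ - ‖u‖‖ ≤ ‖u - v‖ := by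
    rw [norm_sub_rev]; exact abs_norm_sub_norm_le v u |>.trans_eq (norm_sub_rev _ _) |> fun h => by
      rwa [Real.norm_eq_abs, abs_sub_comm]
  have h4 : ‖u‖⁻¹ ≤ 1 := inv_le_one_of_one_le₀ h1
  rw [mul_assoc _ ‖v‖⁻¹, inv_mul_cancel₀ hv0.ne', mul_one]
  have := inv_nonneg.2 hu0.le
  have h5 := norm_nonneg (u - v)
  have h6 := norm_nonneg (‖v‖ - ‖u‖)
  push_cast
  nlinarith

lemma normalize_scale (ω w : ℂ) {q : ℝ} (hq : 0 < q) :
    (q * ‖w‖)⁻¹ • (ω * (q * w)) = ω * (‖w‖⁻¹ • w) := by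
  have hne : (q : ℂ) ≠ 0 := by exact_mod_cast hq.ne'
  have : (q : ℂ)⁻¹ * q = 1 := inv_mul_cancel₀ hne
  simp only [Complex.real_smul]
  push_cast
  rw [mul_inv]
  linear_combination (ω * (‖w‖ : ℂ)⁻¹ * w) * this

lemma cone_measure (a ω : ℂ) (hω : ‖ω‖ = 1) (G : Set ℂ) (A : ℝ)
    (hq : ∀ y ∈ G, 0 < ((y - a) * star ω).re)
    (hA : ∀ y ∈ G, ∀ y' ∈ G, |((y - a) * star ω).im / ((y - a) * star ω).re
      - ((y' - a) * star ω).im / ((y' - a) * star ω).re| ≤ A) :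
    μH[1] (radialProj a '' G) ≤ ENNReal.ofReal (2 * A) := by
  set t : ℂ → ℝ := fun y => ((y - a) * star ω).im / ((y - a) * star ω).re with ht
  set h : ℝ → ℂ := fun t : ℝ => ω * (‖(1 + t * Complex.I : ℂ)‖⁻¹ • (1 + t * Complex.I : ℂ)) with hh
  have hL : LipschitzWith 2 h := by
    apply LipschitzWith.of_dist_le_mul
    intro x y
    rw [hh, dist_eq_norm]
    simp only
    rw [← mul_sub, norm_mul, hω, one_mul, ← dist_eq_norm]
    exact normalize_lip.dist_le_mul x y
  have hωω : star ω * ω = 1 := by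
    have := Complex.conj_mul' ω
    simpa [hω] using this
  have hsub : radialProj a '' G ⊆ h '' (t '' G) := by
    rw [image_image]
    rintro _ ⟨y, hy, rfl⟩
    refine ⟨y, hy, ?_⟩
    have hq' := hq y hy
    set u := (y - a) * star ω with hu
    have hyu : y - a = ω * u := by
      rw [hu]; linear_combination (-(y - a)) * hωω
    have hnorm : ‖y - a‖ = ‖u‖ := by rw [hyu, norm_mul, hω, one_mul]
    have hfac : u = ((u.re : ℝ) : ℂ) * (1 + (t y : ℝ) * Complex.I) := by
      have : u.re * t y = u.im := by
        rw [ht]; simp only [← hu]; field_simp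
      apply Complex.ext
      · simp
      · simp [this]
    have hn2 : ‖u‖ = u.re * ‖(1 + (t y : ℝ) * Complex.I : ℂ)‖ := by
      conv_lhs => rw [hfac]
      rw [norm_mul, Complex.norm_real, Real.norm_eq_abs, abs_of_pos hq']
    have hrw : ω * u = ω * (((u.re : ℝ) : ℂ) * (1 + (t y : ℝ) * Complex.I)) := by rw [← hfac]
    rw [radialProj, hnorm, hyu, hn2, hrw]
    exact (normalize_scale ω _ hq').symm
  refine (measure_mono hsub).trans ?_
  have h1 := hL.hausdorffMeasure_image_le (d := 1) zero_le_one (t '' G)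
  refine h1.trans ?_
  rw [hausdorffMeasure_real]
  have h2 : volume (t '' G) ≤ ENNReal.ofReal A := by
    refine (Real.volume_le_diam _).trans ?_
    refine ediam_le ?_
    rintro _ ⟨y, hy, rfl⟩ _ ⟨y', hy', rfl⟩
    rw [edist_dist, Real.dist_eq]
    exact ENNReal.ofReal_le_ofReal (hA y hy y' hy')
  rw [ENNReal.ofReal_mul zero_le_two]
  simpa using mul_le_mul_right h2 (2 : ENNReal)

open scoped Pointwise in
lemma vol_affine_image (R : ℝ) (hR : 0 < R) (b : ℝ) (S : Set ℝ) :
    volume ((fun t => R * t + b) '' S) = ENNReal.ofReal R * volume S := by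
  have : (fun t => R * t + b) '' S = (· + b) '' (R • S) := by
    rw [← image_smul, image_image]; rfl
  rw [this, image_add_right, measure_preimage_add_right, Measure.addHaar_smul]
  simp [abs_of_pos hR]

lemma tan_bound {p q p' q' d ε η : ℝ} (hd : 0 < d) (hq : d / 2 ≤ q) (hq' : d / 2 ≤ q')
    (hp : |p - p'| ≤ η) (hp' : |p'| ≤ ε) (hqq : |q - q'| ≤ ε) :
    |p / q - p' / q'| ≤ 2 * η / d + 4 * ε ^ 2 / d ^ 2 := by
  have hq0 : 0 < q := by linarith
  have hq0' : 0 < q' := by linarith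
  have e : p / q - p' / q' = (p - p') / q - p' * (q - q') / (q * q') := by
    field_simp; ring
  have hη : 0 ≤ η := (abs_nonneg _).trans hp
  have hε : 0 ≤ ε := (abs_nonneg _).trans hp'
  rw [e]
  refine (abs_sub _ _).trans (add_le_add ?_ ?_)
  · rw [abs_div, abs_of_pos hq0]
    calc |p - p'| / q ≤ η / (d / 2) := by gcongr
      _ = _ := by field_simp
  · rw [abs_div, abs_mul, abs_of_pos (mul_pos hq0 hq0')]
    calc |p'| * |q - q'| / (q * q') ≤ ε * ε / (d / 2 * (d / 2)) := by gcongr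
      _ = _ := by field_simp; norm_num

lemma local_bound (R D L d : ℝ) (hR : 0 < R) (hL : 0 < L) (hd : 0 < d)
    (J0 K : Set ℂ) (hJ0 : IsCompact J0) (hne : J0.Nonempty)
    (hD : ∀ x ∈ J0, ∀ y ∈ J0, ‖x - y‖ ≤ D) (F : Finset ℂ)
    (hK : K = ⋃ c ∈ F, (fun x : ℂ => R • x + c) '' J0) (hKJ : K ⊆ J0)
    (θ : ℝ) (hLθ : ENNReal.ofReal L ≤ volume (linproj θ '' J0))
    (hε : D * R ≤ d / 4) (a ω c x₀ : ℂ) (r : ℝ) (hω : ‖ω‖ = 1)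
    (hωθ : ∀ v : ℂ, |(v * star ω).im| = |linproj θ v|)
    (hx₀ : x₀ ∈ (fun x : ℂ => R • x + c) '' K) (hxr : x₀ - a = r * ω) (hr : 3 * d / 4 ≤ r) :
    μH[1] (radialProj a '' ((fun x : ℂ => R • x + c) '' K)) ≤
      ENNReal.ofReal (2 * (6 * D / d + 4 * D ^ 2 / d ^ 2) / L * R *
        (volume (linproj θ '' K)).toReal) := by
  classical
  have hD0 : 0 ≤ D := by
    obtain ⟨x, hx⟩ := hne
    exact (norm_nonneg _).trans (hD x hx x hx)
  set A := 6 * D / d + 4 * D ^ 2 / d ^ 2 with hA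
  have hA0 : 0 ≤ A := by positivity
  have hωω : ω * star ω = 1 := by
    have := Complex.mul_conj' ω
    simpa [hω] using this
  set piece : ℂ → Set ℂ := fun c' => (fun x : ℂ => R • x + c') '' J0 with hpiece
  have hpc : ∀ c', IsCompact (piece c') := fun c' => hJ0.image (by fun_prop)
  have hKc : IsCompact K := by
    rw [hK]; exact F.isCompact_biUnion fun c' _ => hpc c'
  obtain ⟨U, hUF, hUd, hUc⟩ := exists_max_disjoint (fun c' => linproj θ '' piece c')
    (fun c' => (hne.image _).image _) F
  have hpv : ∀ c', ENNReal.ofReal (R * L) ≤ volume (linproj θ '' piece c') := by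
    intro c'
    have : linproj θ '' piece c' = (fun t => R * t + linproj θ c') '' (linproj θ '' J0) := by
      rw [hpiece, image_image, image_image]
      simp only [linproj_affine]
    rw [this, vol_affine_image R hR, ENNReal.ofReal_mul hR.le]
    gcongr
  have hcount : (U.card : ℝ) * (R * L) ≤ (volume (linproj θ '' K)).toReal := by
    have h1 : (U.card : ENNReal) * ENNReal.ofReal (R * L) ≤ volume (linproj θ '' K) := by
      calc (U.card : ENNReal) * ENNReal.ofReal (R * L) = ∑ c' ∈ U, ENNReal.ofReal (R * L) := by
            simp
        _ ≤ ∑ c' ∈ U, volume (linproj θ '' piece c') := Finset.sum_le_sum fun c' _ => hpv c'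
        _ = volume (⋃ c' ∈ U, linproj θ '' piece c') := by
            rw [measure_biUnion_finset hUd]
            intro c' _
            exact ((hpc c').image (continuous_linproj θ)).measurableSet
        _ ≤ volume (linproj θ '' K) := by
            apply measure_mono
            apply iUnion₂_subset
            intro c' hc'
            apply image_mono
            rw [hK]
            exact subset_biUnion_of_mem (u := piece) (hUF hc')
    have := ENNReal.toReal_mono (vol_linproj_lt_top hKc θ) h1
    rwa [ENNReal.toReal_mul, ENNReal.toReal_natCast, ENNReal.toReal_ofReal (by positivity)] at this
  set G : ℂ → Set ℂ := fun c' => (fun x : ℂ => R • x + c) ''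
    (⋃ c'' ∈ F.filter (fun c'' => ¬ Disjoint (linproj θ '' piece c'') (linproj θ '' piece c')),
      piece c'') with hG
  have hpp : ∀ c', ∀ x ∈ piece c', ∀ y ∈ piece c', |linproj θ x - linproj θ y| ≤ D * R := by
    rintro c' _ ⟨x, hx, rfl⟩ _ ⟨y, hy, rfl⟩
    rw [linproj_sub]
    refine (abs_linproj_le _ _).trans ?_
    have : R • x + c' - (R • y + c') = R • (x - y) := by rw [smul_sub]; abel
    simp only [this]
    rw [norm_smul, Real.norm_eq_abs, abs_of_pos hR, mul_comm]
    exact mul_le_mul_of_nonneg_right (hD x hx y hy) hR.le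
  have hGK : ∀ c', G c' ⊆ (fun x : ℂ => R • x + c) '' K := by
    intro c'
    apply image_mono
    rw [hK]
    apply iUnion₂_subset
    intro c'' hc''
    exact subset_biUnion_of_mem (u := piece) (Finset.mem_filter.1 hc'').1
  have hYd : ∀ y ∈ (fun x : ℂ => R • x + c) '' K, ∀ y' ∈ (fun x : ℂ => R • x + c) '' K,
      ‖y - y'‖ ≤ D * R := by
    rintro _ ⟨x, hx, rfl⟩ _ ⟨y, hy, rfl⟩
    have : R • x + c - (R • y + c) = R • (x - y) := by rw [smul_sub]; abel
    simp only [this]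
    rw [norm_smul, Real.norm_eq_abs, abs_of_pos hR, mul_comm]
    exact mul_le_mul_of_nonneg_right (hD x (hKJ hx) y (hKJ hy)) hR.le
  have hns : ∀ v : ℂ, ‖v * star ω‖ = ‖v‖ := fun v => by
    rw [norm_mul, norm_star, hω, mul_one]
  have hre : ∀ y ∈ (fun x : ℂ => R • x + c) '' K, d / 2 ≤ ((y - a) * star ω).re := by
    intro y hy
    have e : (y - a) * star ω = (y - x₀) * star ω + r := by
      have : y - a = (y - x₀) + r * ω := by rw [← hxr]; ring
      rw [this]; linear_combination r * hωω
    rw [e, Complex.add_re, Complex.ofReal_re]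
    have h1 := (Complex.abs_re_le_norm ((y - x₀) * star ω))
    rw [hns] at h1
    have h2 := hYd y hy x₀ hx₀
    have h3 := (abs_le.1 (h1.trans h2)).1
    linarith
  have him : ∀ y ∈ (fun x : ℂ => R • x + c) '' K, |((y - a) * star ω).im| ≤ D * R := by
    intro y hy
    have e : (y - a) * star ω = (y - x₀) * star ω + r := by
      have : y - a = (y - x₀) + r * ω := by rw [← hxr]; ring
      rw [this]; linear_combination r * hωω
    rw [e, Complex.add_im, Complex.ofReal_im, add_zero]
    have h1 := (Complex.abs_im_le_norm ((y - x₀) * star ω))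
    rw [hns] at h1
    exact h1.trans (hYd y hy x₀ hx₀)
  have hGm : ∀ c' ∈ U, μH[1] (radialProj a '' G c') ≤ ENNReal.ofReal (2 * (A * R ^ 2)) := by
    intro c' _
    apply cone_measure a ω hω
    · intro y hy
      have := hre y (hGK c' hy)
      linarith
    · intro y hy y' hy'
      have hb : |((y - a) * star ω).im - ((y' - a) * star ω).im| ≤ R * (3 * (D * R)) := by
        have e : ((y - a) * star ω).im - ((y' - a) * star ω).im = ((y - y') * star ω).im := by
          rw [← Complex.sub_im]; congr 1; ring
        rw [e, hωθ]
        obtain ⟨x, hx, rfl⟩ := hy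
        obtain ⟨x', hx', rfl⟩ := hy'
        have e2 : R • x + c - (R • x' + c) = R • (x - x') + 0 := by rw [smul_sub]; abel
        simp only [e2]
        rw [linproj_affine, ← linproj_sub]
        have : linproj θ 0 = 0 := by simp [linproj]
        rw [this, add_zero, abs_mul, abs_of_pos hR]
        apply mul_le_mul_of_nonneg_left _ hR.le
        simp only [mem_iUnion, Finset.mem_filter, exists_prop] at hx hx'
        obtain ⟨c1, ⟨_, hc1⟩, hx⟩ := hx
        obtain ⟨c2, ⟨_, hc2⟩, hx'⟩ := hx'
        rw [not_disjoint_iff] at hc1 hc2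
        obtain ⟨_, ⟨u1, hu1, rfl⟩, ⟨v1, hv1, e1⟩⟩ := hc1
        obtain ⟨_, ⟨u2, hu2, rfl⟩, ⟨v2, hv2, e2⟩⟩ := hc2
        have b1 := hpp c1 x hx u1 hu1
        have b2 := hpp c' v1 hv1 v2 hv2
        have b3 := hpp c2 u2 hu2 x' hx'
        rw [abs_le] at *
        constructor <;> linarith [b1.1, b1.2, b2.1, b2.2, b3.1, b3.2]
      have hqq : |((y - a) * star ω).re - ((y' - a) * star ω).re| ≤ D * R := by
        rw [← Complex.sub_re]
        refine (Complex.abs_re_le_norm _).trans ?_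
        rw [← sub_mul, hns, sub_sub_sub_cancel_right]
        exact hYd y (hGK c' hy) y' (hGK c' hy')
      refine (tan_bound hd (hre y (hGK c' hy)) (hre y' (hGK c' hy')) hb
        (him y' (hGK c' hy')) hqq).trans (le_of_eq ?_)
      rw [hA]; field_simp
      ring
  have hcov : radialProj a '' ((fun x : ℂ => R • x + c) '' K) ⊆ ⋃ c' ∈ U, radialProj a '' G c' := by
    rintro _ ⟨_, ⟨x, hx, rfl⟩, rfl⟩
    rw [hK] at hx
    simp only [mem_iUnion, exists_prop] at hx
    obtain ⟨c'', hc'', hx⟩ := hx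
    obtain ⟨c', hc', hdis⟩ := hUc c'' hc''
    simp only [mem_iUnion, exists_prop]
    refine ⟨c', hc', _, ⟨x, ?_, rfl⟩, rfl⟩
    simp only [mem_iUnion, exists_prop, Finset.mem_filter]
    exact ⟨c'', ⟨hc'', hdis⟩, hx⟩
  calc μH[1] (radialProj a '' ((fun x : ℂ => R • x + c) '' K))
      ≤ μH[1] (⋃ c' ∈ U, radialProj a '' G c') := measure_mono hcov
    _ ≤ ∑ c' ∈ U, μH[1] (radialProj a '' G c') := measure_biUnion_finset_le _ _
    _ ≤ ∑ c' ∈ U, ENNReal.ofReal (2 * (A * R ^ 2)) := Finset.sum_le_sum hGm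
    _ = ENNReal.ofReal (U.card * (2 * (A * R ^ 2))) := by
        rw [Finset.sum_const, nsmul_eq_mul, ENNReal.ofReal_mul (Nat.cast_nonneg U.card),
          ENNReal.ofReal_natCast]
    _ ≤ _ := by
        apply ENNReal.ofReal_le_ofReal
        have := mul_le_mul_of_nonneg_left hcount (show 0 ≤ 2 * A / L * R by positivity)
        refine le_trans (le_of_eq ?_) this
        field_simp

lemma exists_dir (v : ℂ) : ∃ θ ∈ Ioc 0 Real.pi, ∃ σ : ℂ, (σ = Complex.I ∨ σ = -Complex.I) ∧
    v = ‖v‖ * (σ * Complex.exp (θ * Complex.I)) := by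
  have hI : v = Complex.I * (v * -Complex.I) := by
    linear_combination v * Complex.I_mul_I
  have hn : ‖v * -Complex.I‖ = ‖v‖ := by simp
  have h := Complex.norm_mul_exp_arg_mul_I (v * -Complex.I)
  rw [hn] at h
  have h1 := Complex.neg_pi_lt_arg (v * -Complex.I)
  have h2 := Complex.arg_le_pi (v * -Complex.I)
  set φ := Complex.arg (v * -Complex.I)
  by_cases hφ : 0 < φ
  · refine ⟨φ, ⟨hφ, h2⟩, Complex.I, Or.inl rfl, ?_⟩
    linear_combination hI - Complex.I * h
  · refine ⟨φ + Real.pi, ⟨by linarith, by linarith⟩, -Complex.I, Or.inr rfl, ?_⟩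
    have : Complex.exp (((φ + Real.pi : ℝ) : ℂ) * Complex.I) = - Complex.exp (φ * Complex.I) := by
      push_cast
      rw [add_mul, Complex.exp_add, Complex.exp_pi_mul_I]; ring
    rw [this]
    linear_combination hI - Complex.I * h

lemma norm_dir (σ : ℂ) (hσ : σ = Complex.I ∨ σ = -Complex.I) (θ : ℝ) :
    ‖σ * Complex.exp (θ * Complex.I)‖ = 1 := by
  rw [norm_mul, Complex.norm_exp_ofReal_mul_I, mul_one]
  rcases hσ with rfl | rfl <;> simp

lemma im_dir (σ : ℂ) (hσ : σ = Complex.I ∨ σ = -Complex.I) (θ : ℝ) (v : ℂ) :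
    |(v * star (σ * Complex.exp (θ * Complex.I))).im| = |linproj θ v| := by
  rcases hσ with rfl | rfl
  · rw [← abs_neg]
    congr 1
    simp [linproj, Complex.exp_ofReal_mul_I_re, Complex.exp_ofReal_mul_I_im]
  · congr 1
    simp [linproj, Complex.exp_ofReal_mul_I_re, Complex.exp_ofReal_mul_I_im]

lemma radialProj_dir {a x w : ℂ} (hx : x ≠ a) (h : x - a = ‖x - a‖ * w) :
    radialProj a x = w := by
  have : (‖x - a‖ : ℂ) ≠ 0 := by
    exact_mod_cast (norm_pos_iff.2 (sub_ne_zero.2 hx)).ne'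
  rw [radialProj]
  conv_lhs => rw [h]
  have e : ‖(‖x - a‖ : ℂ) * w‖ = ‖x - a‖ := by rw [← h]
  rw [e, Complex.real_smul, Complex.ofReal_inv, inv_mul_cancel_left₀ this]

lemma vis_le_one (a : ℂ) (S : Set ℂ) : vis a S ≤ 1 := by
  have hsub : radialProj a '' (S \ {a}) ⊆
      (fun θ : ℝ => Complex.I * Complex.exp (θ * Complex.I)) '' Ioc 0 Real.pi ∪
      (fun θ : ℝ => -Complex.I * Complex.exp (θ * Complex.I)) '' Ioc 0 Real.pi := by
    rintro _ ⟨x, ⟨_, hxa⟩, rfl⟩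
    obtain ⟨θ, hθ, σ, hσ, h⟩ := exists_dir (x - a)
    rw [radialProj_dir hxa h]
    rcases hσ with rfl | rfl
    · exact Or.inl ⟨θ, hθ, rfl⟩
    · exact Or.inr ⟨θ, hθ, rfl⟩
  have hm : μH[1] (radialProj a '' (S \ {a})) ≤ ENNReal.ofReal (2 * Real.pi) := by
    refine (measure_mono hsub).trans ((measure_union_le _ _).trans ?_)
    refine (add_le_add (hausdorff_exp _ (by simp) _) (hausdorff_exp _ (by simp) _)).trans ?_
    rw [Real.volume_Ioc, ← ENNReal.ofReal_add (by simp [Real.pi_pos.le]) (by simp [Real.pi_pos.le])]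
    apply le_of_eq; congr 1; ring
  have hp := Real.pi_pos
  rw [vis, div_le_one (by positivity)]
  exact ENNReal.toReal_le_of_le_ofReal (by positivity) hm

lemma main_bound (R D L d : ℝ) (hR : 0 < R) (hL : 0 < L) (hd : 0 < d)
    (J0 K : Set ℂ) (hJ0 : IsCompact J0) (hne : J0.Nonempty)
    (hD : ∀ x ∈ J0, ∀ y ∈ J0, ‖x - y‖ ≤ D) (F : Finset ℂ) (hF : (F.card : ℝ) * R ≤ 1)
    (hK : K = ⋃ c ∈ F, (fun x : ℂ => R • x + c) '' J0) (hKJ : K ⊆ J0)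
    (hLθ : ∀ θ, ENNReal.ofReal L ≤ volume (linproj θ '' J0))
    (hε : D * R ≤ d / 4) (a : ℂ) (J2 : Set ℂ)
    (hJ2 : J2 = ⋃ c ∈ F, (fun x : ℂ => R • x + c) '' K)
    (hdist : ∀ x ∈ J2, 3 * d / 4 ≤ ‖x - a‖) (hpos : 0 < Fav K) :
    μH[1] (radialProj a '' (J2 \ {a})) ≤ ENNReal.ofReal
      ((2 * Real.pi + 2 * (6 * D / d + 4 * D ^ 2 / d ^ 2) / L) * Real.sqrt (Fav K)) := by
  classical
  have hD0 : 0 ≤ D := by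
    obtain ⟨x, hx⟩ := hne
    exact (norm_nonneg _).trans (hD x hx x hx)
  have hKc : IsCompact K := by
    rw [hK]; exact F.isCompact_biUnion fun c' _ => hJ0.image (by fun_prop)
  set M := 2 * (6 * D / d + 4 * D ^ 2 / d ^ 2) / L with hM
  have hM0 : 0 ≤ M := by positivity
  set q := Real.sqrt (Fav K) with hq
  have hq0 : 0 ≤ q := Real.sqrt_nonneg _
  set B := {θ | q ≤ (volume (linproj θ '' K)).toReal} ∩ Ioc 0 Real.pi with hB
  have hBv : volume B ≤ ENNReal.ofReal (Real.pi * q) := fav_cheb hKc hpos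
  set F' := F.filter (fun c => μH[1] (radialProj a '' ((fun x : ℂ => R • x + c) '' K)) ≤
    ENNReal.ofReal (M * R * q)) with hF'
  have hsub : radialProj a '' (J2 \ {a}) ⊆
      ((fun θ : ℝ => Complex.I * Complex.exp (θ * Complex.I)) '' B ∪
      (fun θ : ℝ => -Complex.I * Complex.exp (θ * Complex.I)) '' B) ∪
      ⋃ c ∈ F', radialProj a '' ((fun x : ℂ => R • x + c) '' K) := by
    rintro _ ⟨x, ⟨hx2, hxa⟩, rfl⟩
    obtain ⟨θ, hθ, σ, hσ, h⟩ := exists_dir (x - a)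
    by_cases hθB : q ≤ (volume (linproj θ '' K)).toReal
    · left
      rw [radialProj_dir hxa h]
      rcases hσ with rfl | rfl
      · exact Or.inl ⟨θ, ⟨hθB, hθ⟩, rfl⟩
      · exact Or.inr ⟨θ, ⟨hθB, hθ⟩, rfl⟩
    · right
      push Not at hθB
      have hx3 := hx2
      rw [hJ2] at hx3
      simp only [mem_iUnion, exists_prop] at hx3 ⊢
      obtain ⟨c, hc, hxc⟩ := hx3
      refine ⟨c, Finset.mem_filter.2 ⟨hc, ?_⟩, x, hxc, rfl⟩
      refine (local_bound R D L d hR hL hd J0 K hJ0 hne hD F hK hKJ θ (hLθ θ) hε a _ c x _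
        (norm_dir σ hσ θ) (im_dir σ hσ θ) hxc h (hdist x hx2)).trans ?_
      apply ENNReal.ofReal_le_ofReal
      exact mul_le_mul_of_nonneg_left hθB.le (by positivity)
  refine (measure_mono hsub).trans ((measure_union_le _ _).trans ?_)
  have h1 : μH[1] ((fun θ : ℝ => Complex.I * Complex.exp (θ * Complex.I)) '' B ∪
      (fun θ : ℝ => -Complex.I * Complex.exp (θ * Complex.I)) '' B) ≤
      ENNReal.ofReal (2 * Real.pi * q) := by
    refine (measure_union_le _ _).trans ?_
    refine (add_le_add (hausdorff_exp _ (by simp) _) (hausdorff_exp _ (by simp) _)).trans ?_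
    refine (add_le_add hBv hBv).trans ?_
    have := Real.pi_pos
    rw [← ENNReal.ofReal_add (by positivity) (by positivity)]
    apply le_of_eq; congr 1; ring
  have h2 : μH[1] (⋃ c ∈ F', radialProj a '' ((fun x : ℂ => R • x + c) '' K)) ≤
      ENNReal.ofReal (M * q) := by
    refine (measure_biUnion_finset_le _ _).trans ?_
    refine (Finset.sum_le_sum fun c hc => (Finset.mem_filter.1 hc).2).trans ?_
    rw [Finset.sum_const, nsmul_eq_mul, ← ENNReal.ofReal_natCast,
      ← ENNReal.ofReal_mul (Nat.cast_nonneg _)]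
    apply ENNReal.ofReal_le_ofReal
    have hc : (F'.card : ℝ) ≤ F.card := by
      exact_mod_cast Finset.card_le_card (Finset.filter_subset _ _)
    have : (F'.card : ℝ) * R ≤ 1 := (mul_le_mul_of_nonneg_right hc hR.le).trans hF
    have h3 := mul_le_mul_of_nonneg_right this (mul_nonneg hM0 hq0)
    nlinarith
  refine (add_le_add h1 h2).trans ?_
  have := Real.pi_pos
  rw [← ENNReal.ofReal_add (by positivity) (by positivity)]
  apply le_of_eq; congr 1; ring

lemma not_collinear_interior {J : Set ℂ} (h : ¬ Collinear ℝ J) :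
    (interior (convexHull ℝ J)).Nonempty := by
  rw [interior_convexHull_nonempty_iff_affineSpan_eq_top]
  have hne : J.Nonempty := by
    by_contra hh
    rw [not_nonempty_iff_eq_empty] at hh
    exact h (hh ▸ collinear_empty ℝ ℂ)
  rw [AffineSubspace.affineSpan_eq_top_iff_vectorSpan_eq_top_of_nonempty ℝ ℂ ℂ hne]
  rw [collinear_iff_finrank_le_one] at h
  apply Submodule.eq_top_of_finrank_eq
  have := Submodule.finrank_le (vectorSpan ℝ J)
  rw [Complex.finrank_real_complex] at this ⊢
  omega

/-- Quantitative upper bound on the visibility of the partially constructed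
self-similar set `𝒥_n` in terms of the Favard length of `𝒥_{⌈C₂ log n⌉}`. -/
theorem stmt0 (s : ℕ) (hs : 2 ≤ s) (z : Fin s → ℂ)
    (hz : ¬ Collinear ℝ (Set.range z))
    (T : Fin s → ℂ → ℂ) (hT : ∀ i x, T i x = (s : ℂ)⁻¹ * x + z i)
    (J : Set ℂ) (hJc : IsCompact J) (hJne : J.Nonempty)
    (hself : J = ⋃ i, T i '' J)
    (hOSC : ∃ O : Set ℂ, IsOpen O ∧ O.Nonempty ∧ (⋃ i, T i '' O) ⊆ O ∧
      ∀ i j, i ≠ j → Disjoint (T i '' O) (T j '' O))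
    (Jn : ℕ → Set ℂ) (hJ0 : Jn 0 = convexHull ℝ J)
    (hJsucc : ∀ n, Jn (n + 1) = ⋃ i, T i '' Jn n)
    (a : ℂ) (ha : a ∉ J) :
    ∃ C₁ C₂ : ℝ, 0 < C₁ ∧ 0 < C₂ ∧ ∀ n : ℕ, 2 ≤ n →
      vis a (Jn n) ≤ C₁ * Real.sqrt (Fav (Jn ⌈C₂ * Real.log n⌉₊)) := by
  have hs0 : (0 : ℝ) < s := by exact_mod_cast (by omega : 0 < s)
  set ρ : ℝ := (s : ℝ)⁻¹ with hρ
  have hρ0 : 0 < ρ := inv_pos.2 hs0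
  have hρ1 : ρ < 1 := inv_lt_one_of_one_lt₀ (by exact_mod_cast (by omega : 1 < s))
  have hTf : ∀ i, T i = fun x : ℂ => ρ • x + z i := by
    intro i; funext x
    rw [hT, Complex.real_smul, hρ]; push_cast; rfl
  simp only [hTf] at hself hJsucc
  clear hOSC hT hTf
  -- compactness
  have hcomp : ∀ n, IsCompact (Jn n) := by
    intro n
    induction n with
    | zero => rw [hJ0]; exact compact_hull hJc
    | succ n ih => rw [hJsucc]; exact isCompact_iUnion fun i => ih.image (by fun_prop)
  have hstep : ∀ n, Jn (n + 1) ⊆ Jn n := by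
    intro n
    induction n with
    | zero =>
      rw [hJsucc, hJ0]
      apply iUnion_subset
      intro i
      rw [image_subset_iff]
      apply convexHull_min
      · intro x hx
        apply subset_convexHull
        rw [hself]
        exact mem_iUnion.2 ⟨i, x, hx, rfl⟩
      · intro x hx y hy α β hα hβ hab
        have := convex_convexHull ℝ J hx hy hα hβ hab
        rw [mem_preimage]
        convert this using 1
        have e : α • (ρ • x + z i) + β • (ρ • y + z i) =
          ρ • (α • x + β • y) + (α + β) • z i := by module
        simp only [e, hab, one_smul]
    | succ n ih =>
      have := iUnion_mono fun i => image_mono (f := fun x : ℂ => ρ • x + z i) ih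
      rwa [← hJsucc, ← hJsucc] at this
  have hanti : Antitone Jn := antitone_nat_of_succ_le hstep
  have hJ0ne : (Jn 0).Nonempty := by rw [hJ0]; exact hJne.mono (subset_convexHull ℝ J)
  have hnc : ¬ Collinear ℝ J := by
    intro hc
    obtain ⟨x, hx⟩ := hJne
    rw [collinear_iff_exists_forall_eq_smul_vadd] at hc
    obtain ⟨p₀, v, hv⟩ := hc
    apply hz
    rw [collinear_iff_exists_forall_eq_smul_vadd]
    refine ⟨p₀ - ρ • x, v, ?_⟩
    rintro _ ⟨i, rfl⟩
    obtain ⟨r, hr⟩ := hv (ρ • x + z i) (by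
      rw [hself]; exact mem_iUnion.2 ⟨i, x, hx, rfl⟩)
    refine ⟨r, ?_⟩
    rw [vadd_eq_add] at hr ⊢
    linear_combination hr
  have hball : ∀ n, ∃ x r, 0 < r ∧ closedBall x r ⊆ Jn n := by
    intro n
    induction n with
    | zero =>
      obtain ⟨x, hx⟩ := not_collinear_interior hnc
      rw [← hJ0, mem_interior_iff_mem_nhds, Metric.nhds_basis_closedBall.mem_iff] at hx
      obtain ⟨r, hr, h⟩ := hx
      exact ⟨x, r, hr, h⟩
    | succ n ih =>
      obtain ⟨x, r, hr, h⟩ := ih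
      refine ⟨ρ • x + z ⟨0, by omega⟩, ρ * r, by positivity, ?_⟩
      intro y hy
      rw [hJsucc]
      refine mem_iUnion.2 ⟨⟨0, by omega⟩, x + ρ⁻¹ • (y - (ρ • x + z ⟨0, by omega⟩)), h ?_, ?_⟩
      · rw [mem_closedBall, dist_eq_norm] at hy ⊢
        rw [add_sub_cancel_left, norm_smul, norm_inv, Real.norm_eq_abs, abs_of_pos hρ0]
        rwa [inv_mul_le_iff₀ hρ0]
      · simp only
        rw [smul_add, smul_smul, mul_inv_cancel₀ hρ0.ne', one_smul]
        ring
  have hfavpos : ∀ n, 0 < Fav (Jn n) := by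
    intro n
    obtain ⟨x, r, hr, h⟩ := hball n
    exact fav_pos (hcomp n) hr h
  obtain ⟨xL, rL, hrL, hL⟩ := hball 0
  -- constants
  set d := infDist a J with hd
  have hd0 : 0 < d := (hJc.isClosed.notMem_iff_infDist_pos hJne).1 ha
  set D := diam (Jn 0) with hDdef
  have hD : ∀ x ∈ Jn 0, ∀ y ∈ Jn 0, ‖x - y‖ ≤ D := by
    intro x hx y hy
    rw [← dist_eq_norm]
    exact dist_le_diam_of_mem (hcomp 0).isBounded hx hy
  have hD0 : 0 ≤ D := diam_nonneg
  obtain ⟨k₀, hk₀⟩ := exists_pow_lt_of_lt_one (show 0 < d / 4 / (D + 1) by positivity) hρ1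
  have hsmall : ∀ k, k₀ ≤ k → D * ρ ^ k ≤ d / 4 := by
    intro k hk
    have h1 : ρ ^ k ≤ ρ ^ k₀ := pow_le_pow_of_le_one hρ0.le hρ1.le hk
    rw [lt_div_iff₀ (by positivity)] at hk₀
    have h2 : 0 < ρ ^ k₀ := by positivity
    nlinarith
  set M := 2 * Real.pi + 2 * (6 * D / d + 4 * D ^ 2 / d ^ 2) / (2 * rL) with hM
  have hpi := Real.pi_pos
  have hM0 : 0 < M := by positivity
  have hsq0 : 0 < Real.sqrt (Fav (Jn k₀)) := Real.sqrt_pos.2 (hfavpos k₀)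
  -- the bound for large k
  have hlarge : ∀ k, k₀ ≤ k → ∀ n, k + k ≤ n →
      vis a (Jn n) ≤ M / (2 * Real.pi) * Real.sqrt (Fav (Jn k)) := by
    intro k hk n hn
    obtain ⟨F, hFc, hF⟩ := pieces_aux s z ρ k
    have hFJ := hF (fun _ => J) (fun _ => hself) 0
    have hFn := hF Jn hJsucc
    have hdist : ∀ x ∈ Jn (k + k), 3 * d / 4 ≤ ‖x - a‖ := by
      intro x hx
      rw [hFn k] at hx
      simp only [mem_iUnion, exists_prop] at hx
      obtain ⟨c, hc, y, hy, rfl⟩ := hx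
      obtain ⟨w, hw⟩ := hJne
      have hwJ : ρ ^ k • w + c ∈ J := by
        have : ρ ^ k • w + c ∈ ⋃ c ∈ F, (fun x : ℂ => ρ ^ k • x + c) '' J := by
          simp only [mem_iUnion, exists_prop]
          exact ⟨c, hc, w, hw, rfl⟩
        rw [← hFJ] at this
        exact this
      have h1 : d ≤ dist a (ρ ^ k • w + c) := infDist_le_dist_of_mem hwJ
      have h2 : dist (ρ ^ k • y + c) (ρ ^ k • w + c) ≤ d / 4 := by
        rw [dist_add_right, dist_smul₀, Real.norm_eq_abs, abs_of_pos (by positivity), dist_eq_norm]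
        have h3 := hD y (hanti (Nat.zero_le k) hy) w (by rw [hJ0]; exact subset_convexHull ℝ J hw)
        have h4 := hsmall k hk
        have h5 : 0 < ρ ^ k := by positivity
        nlinarith
      have h6 := dist_triangle a (ρ ^ k • y + c) (ρ ^ k • w + c)
      rw [dist_comm a (ρ ^ k • y + c)] at h6
      rw [← dist_eq_norm]
      linarith
    have hcard : (F.card : ℝ) * ρ ^ k ≤ 1 := by
      have h1 : (F.card : ℝ) ≤ (s : ℝ) ^ k := by exact_mod_cast hFc
      calc (F.card : ℝ) * ρ ^ k ≤ (s : ℝ) ^ k * ρ ^ k := by gcongr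
        _ = 1 := by rw [← mul_pow, hρ, mul_inv_cancel₀ hs0.ne', one_pow]
    have hb := main_bound (ρ ^ k) D (2 * rL) d (by positivity) (by positivity) hd0 (Jn 0) (Jn k)
      (hcomp 0) hJ0ne hD F hcard (hFn 0) (hanti (Nat.zero_le k))
      (fun θ => vol_linproj_ball hL θ) (hsmall k hk) a (Jn (k + k)) (hFn k) hdist (hfavpos k)
    have hb2 : μH[1] (radialProj a '' (Jn n \ {a})) ≤ ENNReal.ofReal (M * Real.sqrt (Fav (Jn k))) :=
      (measure_mono (image_mono (sdiff_subset_sdiff_left (hanti hn)))).trans hb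
    have := ENNReal.toReal_le_of_le_ofReal (by positivity) hb2
    rw [vis, div_mul_eq_mul_div]
    gcongr
  refine ⟨M / (2 * Real.pi) + 1 / Real.sqrt (Fav (Jn k₀)), 1 / 4, by positivity, by norm_num, ?_⟩
  intro n hn
  set k := ⌈1 / 4 * Real.log n⌉₊ with hk
  have hn0 : (0 : ℝ) < n := by exact_mod_cast (by omega : 0 < n)
  have hlog0 : 0 ≤ Real.log n := Real.log_natCast_nonneg n
  have hkn : k + k ≤ n := by
    have h1 : (k : ℝ) < 1 / 4 * Real.log n + 1 := Nat.ceil_lt_add_one (by positivity)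
    have h2 := Real.log_le_sub_one_of_pos hn0
    have h3 : 4 * (k : ℝ) < n + 3 := by linarith
    have h4 : 4 * k < n + 3 := by exact_mod_cast h3
    omega
  have hsk := Real.sqrt_nonneg (Fav (Jn k))
  rw [add_mul]
  rcases le_total k₀ k with h | h
  · have := hlarge k h n hkn
    have h2 : 0 ≤ 1 / Real.sqrt (Fav (Jn k₀)) * Real.sqrt (Fav (Jn k)) := by positivity
    linarith
  · have h1 := vis_le_one a (Jn n)
    have h2 : Real.sqrt (Fav (Jn k₀)) ≤ Real.sqrt (Fav (Jn k)) :=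
      Real.sqrt_le_sqrt (fav_mono (hcomp k) (hcomp k₀) (hanti h))
    have h3 : 1 ≤ 1 / Real.sqrt (Fav (Jn k₀)) * Real.sqrt (Fav (Jn k)) := by
      rw [one_div_mul_eq_div, one_le_div hsq0]
      exact h2
    have h4 : 0 ≤ M / (2 * Real.pi) * Real.sqrt (Fav (Jn k)) := by positivity
    linarith
end

section
/- Let 0 < α ≤ 1, let U ⊆ ℝ² be a compact set, and let 𝒜 ⊆ [0,1]² be an (α,C₀,δ)-set that is unconcentrated on lines. Then there exist constants C₁, C₂ > 0 depending only on U, α, and C₀ (not on λ or δ) such that for every λ ∈ (0,1], the two-dimensional Lebesgue measure satisfies |{a ∈ U : vis(a;𝒜) < λ}| ≤ C₁ |log δ|^{C₂} δ^{−2+2α} λ². -/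
open MeasureTheory Metric Set

/-- A line in the plane. -/
def IsLine (ℓ : Set ℂ) : Prop := ∃ p v : ℂ, v ≠ 0 ∧ ℓ = {w : ℂ | ∃ t : ℝ, w = p + t • v}

/-- The closed unit square `[0,1]²`. -/
def unitSq : Set ℂ := {w : ℂ | w.re ∈ Icc (0:ℝ) 1 ∧ w.im ∈ Icc (0:ℝ) 1}

/-- An `(α, C, δ)`-set that is unconcentrated on lines. -/
def UnconcSet (α C δ : ℝ) (A : Set ℂ) : Prop :=
  (∃ P : Set ℂ, P.Nonempty ∧ A = (⋃ x ∈ P, closedBall x δ) ∧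
      ∀ y : ℂ, {x ∈ P | y ∈ closedBall x δ}.Finite ∧
        (({x ∈ P | y ∈ closedBall x δ}).ncard : ℝ) ≤ C) ∧
  C⁻¹ * δ ^ (2 - α) ≤ (volume A).toReal ∧
  (volume A).toReal ≤ C * δ ^ (2 - α) ∧
  (∀ (x : ℂ) (r : ℝ), 0 < r →
      (volume (A ∩ closedBall x r)).toReal ≤ C * r ^ α * (volume A).toReal) ∧
  (∀ ℓ : Set ℂ, IsLine ℓ →
      (volume (A ∩ cthickening C⁻¹ ℓ)).toReal ≤ (volume A).toReal / 10)


/-- cross product -/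
def cr (u v : ℂ) : ℝ := u.re * v.im - u.im * v.re

lemma cr_eq (u v : ℂ) : cr u v = (starRingEnd ℂ u * v).im := by
  simp [cr]; ring

lemma abs_cr_le (u v : ℂ) : |cr u v| ≤ ‖u‖ * ‖v‖ := by
  rw [cr_eq]
  refine (Complex.abs_im_le_norm _).trans ?_
  simp

lemma cr_sub_left (u v w : ℂ) : cr (u - v) w = cr u w - cr v w := by
  simp [cr]; ring
lemma cr_sub_right (u v w : ℂ) : cr u (v - w) = cr u v - cr u w := by
  simp [cr]; ring
lemma cr_smul_left (s : ℝ) (u v : ℂ) : cr (s • u) v = s * cr u v := by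
  simp [cr]; ring
lemma cr_smul_right (s : ℝ) (u v : ℂ) : cr u (s • v) = s * cr u v := by
  simp [cr]; ring
lemma cr_self (u : ℂ) : cr u u = 0 := by
  simp [cr]; ring

/-- direction net -/
noncomputable def dir (h : ℝ) (p : Bool × ℤ) : ℂ := if p.1 then ⟨1, p.2 * h⟩ else ⟨p.2 * h, 1⟩

/-- index set of the net -/
noncomputable def idx (h : ℝ) : Finset (Bool × ℤ) :=
  Finset.univ ×ˢ Finset.Icc (-(⌊1/h⌋ + 1)) (⌊1/h⌋ + 1)

lemma idx_bound {h : ℝ} (h0 : 0 < h) (h1 : h ≤ 1) {p : Bool × ℤ} (hp : p ∈ idx h) :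
    |(p.2 : ℝ) * h| ≤ 2 := by
  simp only [idx, Finset.mem_product, Finset.mem_univ, true_and, Finset.mem_Icc] at hp
  have a1 : (p.2 : ℝ) ≤ 1/h + 1 := by
    have : (p.2 : ℝ) ≤ (⌊1/h⌋ : ℝ) + 1 := by exact_mod_cast hp.2
    linarith [Int.floor_le (1/h)]
  have a2 : -(1/h + 1) ≤ (p.2 : ℝ) := by
    have : -((⌊1/h⌋ : ℝ) + 1) ≤ (p.2 : ℝ) := by exact_mod_cast hp.1
    linarith [Int.floor_le (1/h)]
  have e : (1/h + 1) * h = 1 + h := by field_simp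
  rw [abs_le]; constructor <;> nlinarith

lemma norm_le_parts (u : ℂ) : ‖u‖ ≤ |u.re| + |u.im| := Complex.norm_le_abs_re_add_abs_im u

lemma dir_norm {h : ℝ} (h0 : 0 < h) (h1 : h ≤ 1) {p : Bool × ℤ} (hp : p ∈ idx h) :
    ‖dir h p‖ ≤ 3 := by
  have := idx_bound h0 h1 hp
  refine (norm_le_parts _).trans ?_
  unfold dir; split_ifs <;> simp only [abs_one] <;> linarith

lemma floor_mem {h t : ℝ} (h0 : 0 < h) (ht : |t| ≤ 1) :
    ⌊t/h⌋ ∈ Finset.Icc (-(⌊1/h⌋ + 1)) (⌊1/h⌋ + 1) := by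
  rw [abs_le] at ht
  rw [Finset.mem_Icc]
  constructor
  · rw [Int.le_floor]
    push_cast
    have : -(1/h) ≤ t/h := by rw [← neg_div]; gcongr; exact ht.1
    linarith [Int.lt_floor_add_one (1/h)]
  · have : ⌊t/h⌋ ≤ ⌊1/h⌋ := Int.floor_mono (by gcongr; exact ht.2)
    omega

lemma floor_near {h t : ℝ} (h0 : 0 < h) : |(⌊t/h⌋ : ℝ) * h - t| ≤ h := by
  have a := Int.floor_le (t/h)
  have b := Int.lt_floor_add_one (t/h)
  rw [le_div_iff₀ h0] at a
  rw [div_lt_iff₀ h0] at b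
  rw [abs_le]; constructor <;> nlinarith

lemma approx_dir {h : ℝ} (h0 : 0 < h) {w : ℂ} (hw : w ≠ 0) :
    ∃ p ∈ idx h, ∃ s : ℝ, ‖dir h p - s • w‖ ≤ h ∧ 1 ≤ ‖s • w‖ ∧ ‖s • w‖ ≤ 2 ∧
      ∀ w' : ℂ, ∃ t : ℝ, ‖w' - t • w‖ ≤ |cr (s • w) w'| := by
  have ns : ‖w‖ ≠ 0 := norm_ne_zero_iff.2 hw
  rcases le_total |w.im| |w.re| with hle | hle
  · have hre : w.re ≠ 0 := by
      intro h'
      apply hw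
      rw [h', abs_zero] at hle
      exact Complex.ext h' (abs_nonpos_iff.1 hle)
    have ht : |w.im / w.re| ≤ 1 := by
      rw [abs_div]; exact (div_le_one (abs_pos.2 hre)).2 hle
    have hsw : (w.re)⁻¹ • w = ⟨1, w.im / w.re⟩ := by
      apply Complex.ext <;> simp [hre]; field_simp
    refine ⟨(true, ⌊w.im/w.re/h⌋), ?_, (w.re)⁻¹, ?_, ?_, ?_, ?_⟩
    · simpa [idx] using Finset.mem_Icc.1 (floor_mem h0 ht)
    · rw [hsw]
      refine (norm_le_parts _).trans ?_
      simpa [dir] using floor_near h0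
    · rw [hsw]
      refine le_trans ?_ (Complex.abs_re_le_norm _)
      simp
    · rw [hsw]
      refine (norm_le_parts _).trans ?_
      simp only [abs_one]; linarith
    · intro w'
      refine ⟨w'.re / w.re, ?_⟩
      rw [hsw]
      refine (norm_le_parts _).trans ?_
      simp [cr, hre]
      apply le_of_eq; congr 1; ring
  · have him : w.im ≠ 0 := by
      intro h'
      apply hw
      rw [h', abs_zero] at hle
      exact Complex.ext (abs_nonpos_iff.1 hle) h'
    have ht : |w.re / w.im| ≤ 1 := by
      rw [abs_div]; exact (div_le_one (abs_pos.2 him)).2 hle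
    have hsw : (w.im)⁻¹ • w = ⟨w.re / w.im, 1⟩ := by
      apply Complex.ext <;> simp [him]; field_simp
    refine ⟨(false, ⌊w.re/w.im/h⌋), ?_, (w.im)⁻¹, ?_, ?_, ?_, ?_⟩
    · simpa [idx] using Finset.mem_Icc.1 (floor_mem h0 ht)
    · rw [hsw]
      refine (norm_le_parts _).trans ?_
      simpa [dir] using floor_near h0
    · rw [hsw]
      refine le_trans ?_ (Complex.abs_im_le_norm _)
      simp
    · rw [hsw]
      refine (norm_le_parts _).trans ?_
      simp only [abs_one]; linarith
    · intro w'
      refine ⟨w'.im / w.im, ?_⟩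
      rw [hsw]
      refine (norm_le_parts _).trans ?_
      simp [cr, him]
      apply le_of_eq; rw [abs_sub_comm]; congr 1; ring

/-- tube -/
def tube (e x : ℂ) (τ : ℝ) : Set ℂ := {y | |cr e (y - x)| ≤ τ}

lemma tube_inter_subset {e e' x x' b : ℂ} {τ c : ℝ} (hc : 0 < c) (he : ‖e‖ ≤ 3) (he' : ‖e'‖ ≤ 3)
    (hcr : c ≤ |cr e e'|) (hb : b ∈ tube e x τ) (hb' : b ∈ tube e' x' τ) :
    tube e x τ ∩ tube e' x' τ ⊆ closedBall b (12 * τ / c) := by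
  rintro a ⟨ha, ha'⟩
  simp only [tube, mem_ofPred_eq] at *
  have hτ : 0 ≤ τ := (abs_nonneg _).trans hb
  have d1 : |cr e (a - b)| ≤ 2 * τ := by
    have : cr e (a - b) = cr e (a - x) - cr e (b - x) := by simp [cr]; ring
    rw [this]; refine (abs_sub _ _).trans ?_; linarith
  have d2 : |cr e' (a - b)| ≤ 2 * τ := by
    have : cr e' (a - b) = cr e' (a - x') - cr e' (b - x') := by simp [cr]; ring
    rw [this]; refine (abs_sub _ _).trans ?_; linarith
  have key : (cr e e') • (a - b) = (cr e (a - b)) • e' - (cr e' (a - b)) • e := by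
    apply Complex.ext <;> simp [cr] <;> ring
  have n1 : |cr e e'| * ‖a - b‖ ≤ 12 * τ := by
    rw [← Real.norm_eq_abs, ← norm_smul, key]
    refine (norm_sub_le _ _).trans ?_
    rw [norm_smul, norm_smul, Real.norm_eq_abs, Real.norm_eq_abs]
    have := mul_le_mul d1 he' (norm_nonneg _) (by positivity)
    have := mul_le_mul d2 he (norm_nonneg _) (by positivity)
    linarith
  rw [mem_closedBall, dist_eq_norm, le_div_iff₀ hc]
  nlinarith [norm_nonneg (a - b)]

lemma card_int {s : Finset ℤ} {h u v L d : ℝ} (h0 : 0 < h) (d0 : 0 < d) (hu : d ≤ |u|)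
    (L0 : 0 ≤ L) (hs : ∀ j ∈ s, |v - j * h * u| ≤ L * h) : (s.card : ℝ) ≤ 2 * L / d + 1 := by
  have hu0 : u ≠ 0 := by intro h'; rw [h', abs_zero] at hu; linarith
  set c := v / (h * u)
  set r := L / d
  have r0 : 0 ≤ r := by positivity
  have hsub : s ⊆ Finset.Icc ⌈c - r⌉ ⌊c + r⌋ := by
    intro j hj
    have := hs j hj
    have e : v - j * h * u = (h * u) * (c - j) := by simp only [c]; field_simp
    rw [e, abs_mul, abs_mul, abs_of_pos h0] at this
    have h2 : |u| * |c - j| ≤ L := by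
      by_contra hh; push Not at hh; nlinarith
    have h3 : |c - j| ≤ r := by
      rw [le_div_iff₀ d0]; nlinarith [abs_nonneg (c - j)]
    rw [abs_le] at h3
    rw [Finset.mem_Icc, Int.ceil_le, Int.le_floor]
    constructor <;> linarith
  have h1 := Finset.card_le_card hsub
  rw [Int.card_Icc] at h1
  have h2 : (s.card : ℤ) ≤ max (⌊c + r⌋ + 1 - ⌈c - r⌉) 0 := by omega
  have h3 : (s.card : ℝ) ≤ max ((⌊c + r⌋ : ℝ) + 1 - ⌈c - r⌉) 0 := by exact_mod_cast h2
  refine h3.trans (max_le ?_ ?_)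
  · have := Int.floor_le (c + r)
    have := Int.le_ceil (c - r)
    have : 2 * L / d = 2 * r := by simp only [r]; ring
    linarith
  · positivity

open Classical in
/-- number of directions -/
noncomputable def cnt (h τ : ℝ) (u : ℂ) : ℕ := ((idx h).filter (fun p => |cr (dir h p) u| ≤ τ)).card

lemma cnt_h {h τ : ℝ} (h0 : 0 < h) (h1 : h ≤ 1) (u : ℂ) : (cnt h τ u : ℝ) * h ≤ 10 := by
  have a : cnt h τ u ≤ (idx h).card := Finset.card_filter_le _ _
  have b : (idx h).card = 2 * (⌊1/h⌋ + 1 + 1 - (-(⌊1/h⌋ + 1))).toNat := by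
    simp [idx, Finset.card_product, Int.card_Icc]
  have fl : 0 ≤ ⌊1/h⌋ := Int.floor_nonneg.2 (by positivity)
  have c : (cnt h τ u : ℤ) ≤ 4 * ⌊1/h⌋ + 6 := by omega
  have d : (cnt h τ u : ℝ) ≤ 4 * ⌊1/h⌋ + 6 := by exact_mod_cast c
  have e := Int.floor_le (1/h)
  have f : (1 / h) * h = 1 := by field_simp
  have g : (cnt h τ u : ℝ) ≤ 4 * (1/h) + 6 := by linarith
  nlinarith

lemma fiber_aux {u v : ℝ} {U h L : ℝ} (h0 : 0 < h) (L0 : 0 ≤ L) (hU : U ≤ |u| + |v|)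
    (hU2 : 2 * L * h < U) {s : Finset ℤ} (hb : ∀ j ∈ s, |(j:ℝ) * h| ≤ 2)
    (hs : ∀ j ∈ s, |v - j * h * u| ≤ L * h) : (s.card : ℝ) ≤ 12 * L / U + 1 := by
  have U0 : 0 < U := lt_of_le_of_lt (by positivity) hU2
  rcases s.eq_empty_or_nonempty with rfl | ⟨j, hj⟩
  · simp; positivity
  · have a := hb j hj
    have b := hs j hj
    have c : |v| ≤ L * h + 2 * |u| := by
      have : v = (v - j * h * u) + (j * h) * u := by ring
      rw [this]
      refine (abs_add_le _ _).trans ?_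
      rw [abs_mul (j * h : ℝ)]
      nlinarith [abs_nonneg u]
    have d : U / 6 ≤ |u| := by linarith
    have := card_int h0 (by positivity : 0 < U / 6) d L0 hs
    convert this using 2
    field_simp; ring

lemma cnt_u {h L : ℝ} (h0 : 0 < h) (h1 : h ≤ 1) (L0 : 0 ≤ L) {u : ℂ} (hu : ‖u‖ ≤ 2) :
    (cnt h (L * h) u : ℝ) * ‖u‖ ≤ 24 * L + 10 := by
  classical
  rcases le_or_gt ‖u‖ (2 * L * h) with hl | hl
  · have := cnt_h h0 h1 (τ := L * h) u
    have : (cnt h (L * h) u : ℝ) * ‖u‖ ≤ (cnt h (L * h) u : ℝ) * (2 * L * h) := by gcongr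
    nlinarith
  · have U0 : 0 < ‖u‖ := lt_of_le_of_lt (by positivity) hl
    let s : Bool → Finset ℤ := fun b => (Finset.Icc (-(⌊1/h⌋ + 1)) (⌊1/h⌋ + 1)).filter
      (fun j => |cr (dir h (b, j)) u| ≤ L * h)
    have hsub : (idx h).filter (fun p => |cr (dir h p) u| ≤ L * h) ⊆
        ({true} ×ˢ s true) ∪ ({false} ×ˢ s false) := by
      rintro ⟨b, j⟩ hp
      simp only [idx, Finset.mem_filter, Finset.mem_product, Finset.mem_univ, true_and] at hp
      cases b <;> simp [s] <;> simpa using hp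
    have hc : cnt h (L * h) u ≤ (s true).card + (s false).card := by
      unfold cnt
      refine le_trans (le_of_eq (by congr)) ((Finset.card_le_card hsub).trans ((Finset.card_union_le _ _).trans ?_))
      simp
    have hb : ∀ b, ∀ j ∈ s b, |(j:ℝ) * h| ≤ 2 := by
      intro b j hj
      apply idx_bound h0 h1 (p := (b, j))
      simp only [idx, Finset.mem_product, Finset.mem_univ, true_and]
      exact (Finset.mem_filter.1 hj).1
    have t1 : ((s true).card : ℝ) ≤ 12 * L / ‖u‖ + 1 := by
      refine fiber_aux (u := u.re) (v := u.im) h0 L0 (norm_le_parts u) hl (hb true) ?_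
      intro j hj
      have := (Finset.mem_filter.1 hj).2
      simpa [cr, dir] using this
    have t2 : ((s false).card : ℝ) ≤ 12 * L / ‖u‖ + 1 := by
      refine fiber_aux (u := u.im) (v := u.re) h0 L0 (by rw [add_comm]; exact norm_le_parts u) hl (hb false) ?_
      intro j hj
      have := (Finset.mem_filter.1 hj).2
      rw [abs_sub_comm]
      simpa [cr, dir] using this
    have hc' : (cnt h (L * h) u : ℝ) ≤ (s true).card + (s false).card := by exact_mod_cast hc
    have : (cnt h (L * h) u : ℝ) ≤ 24 * L / ‖u‖ + 2 := by
      have : 24 * L / ‖u‖ = 12 * L / ‖u‖ + 12 * L / ‖u‖ := by ring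
      linarith
    have e : (24 * L / ‖u‖ + 2) * ‖u‖ = 24 * L + 2 * ‖u‖ := by field_simp
    nlinarith

lemma radial_norm {a x : ℂ} (h : x ≠ a) : ‖radialProj a x‖ = 1 := by
  unfold radialProj
  have : ‖x - a‖ ≠ 0 := norm_ne_zero_iff.2 (sub_ne_zero.2 h)
  rw [norm_smul, norm_inv, norm_norm, inv_mul_cancel₀ this]

lemma arc_exists {a p x : ℂ} {δ R : ℝ} (hδ : 0 < δ) (hR : 0 < R) (hx : x ∈ closedBall p δ)
    (hxa : x ≠ a) (hb : ∀ z ∈ closedBall p δ, ‖z - a‖ ≤ R) :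
    ∀ r ∈ Icc 0 (δ / R), ∃ y ∈ closedBall p δ, y ≠ a ∧
      dist (radialProj a y) (radialProj a x) = r := by
  set w := radialProj a x with hw
  have hwn : ‖w‖ = 1 := radial_norm hxa
  have hxw : x - a = ‖x - a‖ • w := by
    have : ‖x - a‖ ≠ 0 := norm_ne_zero_iff.2 (sub_ne_zero.2 hxa)
    rw [hw, radialProj, smul_smul, mul_inv_cancel₀ this, one_smul]
  have hsq : w.re * w.re + w.im * w.im = 1 := by
    have := Complex.normSq_eq_norm_sq w
    rw [hwn, Complex.normSq_apply] at this; linarith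
  have hcI : cr w (Complex.I * w) = 1 := by simp [cr]; linarith
  obtain ⟨σ, hσ, hσ'⟩ : ∃ σ : ℝ, |σ| = 1 ∧ δ ≤ |cr w (p - x) + σ * δ| := by
    rcases le_total 0 (cr w (p - x)) with h | h
    · exact ⟨1, by simp, by rw [abs_of_nonneg] <;> linarith⟩
    · exact ⟨-1, by simp, by rw [abs_of_nonpos] <;> linarith⟩
  set z : ℂ := p + (σ * δ) • (Complex.I * w) with hz
  have hzb : z ∈ closedBall p δ := by
    rw [mem_closedBall, dist_eq_norm, hz, add_sub_cancel_left, norm_smul, norm_mul, norm_mul, hwn, Real.norm_eq_abs, hσ,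
      Real.norm_eq_abs, abs_of_pos hδ]
    simp
  have hη : cr w (z - x) = cr w (p - x) + σ * δ := by
    have : z - x = (p - x) - (-(σ * δ)) • (Complex.I * w) := by rw [hz]; simp; ring
    rw [this, cr_sub_right, cr_smul_right, hcI]; ring
  rw [← hη] at hσ'
  set η := cr w (z - x) with hηd
  have hη0 : η ≠ 0 := by intro h; rw [h, abs_zero] at hσ'; linarith
  let γ : ℝ → ℂ := fun t => x + t • (z - x)
  have hγa : ∀ t, γ t ≠ a := by
    intro t h
    have h1 : cr w (γ t - a) = t * η := by
      have : γ t - a = (x - a) - (-t) • (z - x) := by simp [γ]; ring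
      rw [this, cr_sub_right, cr_smul_right, hxw, cr_smul_right, cr_self]; simp [hηd]
    rw [h, sub_self] at h1
    have h2 : t * η = 0 := by rw [← h1]; simp [cr]
    rcases mul_eq_zero.1 h2 with h3 | h3
    · apply hxa; rw [← h]; simp [γ, h3]
    · exact hη0 h3
  have hγb : ∀ t ∈ Icc (0:ℝ) 1, γ t ∈ closedBall p δ := by
    intro t ht
    exact (convex_closedBall p δ).add_smul_sub_mem hx hzb ht
  have hcont : Continuous (fun t => dist (radialProj a (γ t)) w) := by
    have hg : Continuous γ := by fun_prop
    have : Continuous (fun t => radialProj a (γ t)) := by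
      unfold radialProj
      have hg2 : Continuous (fun t => γ t - a) := by fun_prop
      refine Continuous.smul (Continuous.inv₀ hg2.norm ?_) hg2
      intro t; exact norm_ne_zero_iff.2 (sub_ne_zero.2 (hγa t))
    fun_prop
  have h0 : dist (radialProj a (γ 0)) w = 0 := by simp [γ, hw]
  have hz1 : γ 1 = z := by simp [γ]
  have h1 : δ / R ≤ dist (radialProj a (γ 1)) w := by
    rw [hz1, dist_eq_norm]
    have hza : z ≠ a := hz1 ▸ hγa 1
    have nz : 0 < ‖z - a‖ := norm_pos_iff.2 (sub_ne_zero.2 hza)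
    have e1 := abs_cr_le w (radialProj a z - w)
    rw [hwn, one_mul] at e1
    refine le_trans ?_ e1
    have e2 : cr w (radialProj a z - w) = ‖z - a‖⁻¹ * η := by
      rw [cr_sub_right, cr_self, radialProj, cr_smul_right]
      have : z - a = (z - x) - (-1 : ℝ) • (x - a) := by simp
      rw [sub_zero]; congr 1
      rw [this, cr_sub_right, cr_smul_right, hxw, cr_smul_right, cr_self]; simp [hηd]
    rw [e2, abs_mul, abs_inv, abs_norm, inv_mul_eq_div]
    have := hb z hzb
    gcongr
  intro r hr
  have := intermediate_value_Icc (zero_le_one' ℝ) (hcont.continuousOn (s := Icc 0 1))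
  obtain ⟨t, ht, hrt⟩ := this (show r ∈ Icc _ _ from ⟨by rw [h0]; exact hr.1, hr.2.trans h1⟩)
  exact ⟨γ t, hγb t ht, hγa t, hrt⟩

lemma haus_ball {S : Set ℂ} {s : ℂ} {ρ : ℝ}
    (hS : ∀ r ∈ Icc 0 ρ, ∃ y ∈ S, dist y s = r) :
    ENNReal.ofReal ρ ≤ μH[1] (S ∩ ball s ρ) := by
  have hl : LipschitzWith 1 (fun y : ℂ => dist y s) := LipschitzWith.dist_left s
  have h1 := hl.hausdorffMeasure_image_le (d := 1) zero_le_one (S ∩ ball s ρ)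
  simp only [ENNReal.coe_one, ENNReal.one_rpow, one_mul] at h1
  refine le_trans ?_ h1
  rw [hausdorffMeasure_real]
  have : Ico 0 ρ ⊆ (fun y : ℂ => dist y s) '' (S ∩ ball s ρ) := by
    intro r hr
    obtain ⟨y, hy, hyr⟩ := hS r ⟨hr.1, hr.2.le⟩
    exact ⟨y, ⟨hy, by rw [mem_ball, hyr]; exact hr.2⟩, hyr⟩
  refine le_trans ?_ (measure_mono this)
  simp

lemma haus_circle_lt_top {S : Set ℂ} (hS : ∀ y ∈ S, ‖y‖ = 1) : μH[1] S < ⊤ := by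
  have h1 : S ⊆ circleMap 0 1 '' Ioc 0 (2 * Real.pi) := by
    rw [image_circleMap_Ioc]
    intro y hy; simp [hS y hy]
  have h2 := (lipschitzWith_circleMap 0 1).hausdorffMeasure_image_le (d := 1) zero_le_one (Ioc 0 (2 * Real.pi))
  refine (measure_mono h1).trans_lt (h2.trans_lt ?_)
  rw [hausdorffMeasure_real]
  simp [ENNReal.mul_lt_top]

/-- finite net -/
lemma exists_net {S : Set ℂ} {ρ Λ : ℝ} (hρ : 0 < ρ) (hΛ : 0 ≤ Λ)
    (hS : ∀ s ∈ S, ENNReal.ofReal ρ ≤ μH[1] (S ∩ ball s ρ))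
    (hm : μH[1] S ≤ ENNReal.ofReal Λ) :
    ∃ F : Finset ℂ, (F.card : ℝ) * ρ ≤ Λ ∧ ∀ s ∈ S, ∃ f ∈ F, dist s f < 2 * ρ := by
  classical
  let Q : ℕ → Prop := fun n => ∃ F : Finset ℂ, F.card = n ∧ (↑F : Set ℂ) ⊆ S ∧
    ∀ x ∈ F, ∀ y ∈ F, x ≠ y → 2 * ρ ≤ dist x y
  have hbd : ∀ F : Finset ℂ, (↑F : Set ℂ) ⊆ S →
    (∀ x ∈ F, ∀ y ∈ F, x ≠ y → 2 * ρ ≤ dist x y) → (F.card : ℝ) * ρ ≤ Λ := by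
    intro F hF hsep
    have h1 : ∑ x ∈ F, (μH[1].restrict S) (ball x ρ) = (μH[1].restrict S) (⋃ x ∈ F, ball x ρ) := by
      rw [measure_biUnion_finset]
      · intro x hx y hy hxy
        exact ball_disjoint_ball (by linarith [hsep x hx y hy hxy])
      · intro x _; exact measurableSet_ball
    have h2 : (μH[1].restrict S) (⋃ x ∈ F, ball x ρ) ≤ ENNReal.ofReal Λ := by
      refine (measure_mono (subset_univ _)).trans ?_
      rw [Measure.restrict_apply_univ]; exact hm
    have h3 : ∑ x ∈ F, ENNReal.ofReal ρ ≤ ∑ x ∈ F, (μH[1].restrict S) (ball x ρ) := by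
      apply Finset.sum_le_sum
      intro x hx
      rw [Measure.restrict_apply measurableSet_ball, inter_comm]
      exact hS x (hF hx)
    rw [Finset.sum_const, nsmul_eq_mul] at h3
    have h4 := h3.trans (h1.le.trans h2)
    rw [← ENNReal.ofReal_natCast, ← ENNReal.ofReal_mul (by positivity),
      ENNReal.ofReal_le_ofReal_iff hΛ] at h4
    exact h4
  have hQ : ∀ n, Q n → n ≤ ⌊Λ / ρ⌋₊ := by
    rintro n ⟨F, rfl, hF, hs⟩
    apply Nat.le_floor
    rw [le_div_iff₀ hρ]; exact hbd F hF hs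
  have h0 : Q 0 := ⟨∅, by simp⟩
  obtain ⟨F, hc, hF, hs⟩ := Nat.findGreatest_spec (P := Q) (Nat.zero_le ⌊Λ / ρ⌋₊) h0
  refine ⟨F, hbd F hF hs, ?_⟩
  intro s hsS
  by_contra hcon
  push Not at hcon
  have hsF : s ∉ F := fun h => by have := hcon s h; rw [dist_self] at this; linarith
  have hQ' : Q (Nat.findGreatest Q ⌊Λ / ρ⌋₊ + 1) := by
    refine ⟨insert s F, by rw [Finset.card_insert_of_notMem hsF, hc], ?_, ?_⟩
    · rw [Finset.coe_insert]; exact insert_subset hsS hF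
    · intro x hx y hy hxy
      rcases Finset.mem_insert.1 hx with rfl | hx2
      · rcases Finset.mem_insert.1 hy with rfl | hy
        · exact absurd rfl hxy
        · exact hcon y hy
      · rcases Finset.mem_insert.1 hy with rfl | hy
        · rw [dist_comm]; exact hcon x hx2
        · exact hs x hx2 y hy hxy
  have := Nat.le_findGreatest (hQ _ hQ') hQ'
  omega

/-- bad points seen from `a` carry little mass -/
lemma bad_small {A P : Set ℂ} {a : ℂ} {δ R lam : ℝ} (m : ENNReal) (hδ : 0 < δ) (hR : 0 < R) (hl : 0 < lam)
    (hA : A = ⋃ x ∈ P, closedBall x δ) (hAR : ∀ z ∈ A, ‖z - a‖ ≤ R) (hv : vis a A < lam) :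
    ∃ n : ℕ, (n : ℝ) * (δ / R) ≤ 2 * Real.pi * lam ∧
    volume {x ∈ A \ {a} | volume (A ∩ {y | y ≠ a ∧
      dist (radialProj a y) (radialProj a x) ≤ 4 * (δ / R)}) < m} ≤ n * m := by
  set S := radialProj a '' (A \ {a}) with hSd
  have hS1 : ∀ y ∈ S, ‖y‖ = 1 := by
    rintro _ ⟨x, hx, rfl⟩; exact radial_norm hx.2
  have hfin := haus_circle_lt_top hS1
  have hm : μH[1] S ≤ ENNReal.ofReal (2 * Real.pi * lam) := by
    unfold vis at hv
    rw [div_lt_iff₀ (by positivity)] at hv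
    rw [← ENNReal.ofReal_toReal hfin.ne]
    apply ENNReal.ofReal_le_ofReal
    linarith
  obtain ⟨F, hFc, hF⟩ := exists_net (S := S) (ρ := δ / R) (by positivity) (by positivity) (by
    rintro _ ⟨x, ⟨hxA, hxa⟩, rfl⟩
    apply haus_ball
    intro r hr
    have hxA' := hxA
    rw [hA] at hxA'
    simp only [mem_iUnion] at hxA'
    obtain ⟨p, hp, hxp⟩ := hxA'
    have hsub : closedBall p δ ⊆ A := by rw [hA]; exact subset_biUnion_of_mem (u := fun x => closedBall x δ) hp
    obtain ⟨y, hy, hya, hyr⟩ := arc_exists hδ hR hxp hxa (fun z hz => hAR z (hsub hz)) r hr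
    exact ⟨_, ⟨y, ⟨hsub hy, hya⟩, rfl⟩, hyr⟩) hm
  refine ⟨F.card, hFc, ?_⟩
  set B := {x ∈ A \ {a} | volume (A ∩ {y | y ≠ a ∧
      dist (radialProj a y) (radialProj a x) ≤ 4 * (δ / R)}) < m} with hB
  have hcov : B ⊆ ⋃ f ∈ F, {x ∈ B | dist (radialProj a x) f < 2 * (δ / R)} := by
    intro x hx
    obtain ⟨f, hf, hd⟩ := hF _ ⟨x, hx.1, rfl⟩
    simp only [mem_iUnion]
    exact ⟨f, hf, hx, hd⟩
  refine (measure_mono hcov).trans ((measure_biUnion_finset_le _ _).trans ?_)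
  refine (Finset.sum_le_card_nsmul _ _ m ?_).trans (by rw [nsmul_eq_mul])
  intro f hf
  rcases ({x ∈ B | dist (radialProj a x) f < 2 * (δ / R)}).eq_empty_or_nonempty with he | ⟨x, hx, hxf⟩
  · rw [he]; simp
  · refine le_trans (measure_mono ?_) hx.2.le
    rintro y ⟨hy, hyf⟩
    refine ⟨hy.1.1, hy.1.2, ?_⟩
    have := dist_triangle_right (radialProj a y) (radialProj a x) f
    linarith

lemma tube_closed (e x : ℂ) (τ : ℝ) : MeasurableSet (tube e x τ) := by
  apply IsClosed.measurableSet
  unfold tube cr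
  apply isClosed_le <;> fun_prop

lemma cnt_sum (h τ : ℝ) (x y : ℂ) :
    ∑ p ∈ idx h, (tube (dir h p) x τ).indicator (1 : ℂ → ENNReal) y = (cnt h τ (y - x) : ENNReal) := by
  classical
  unfold cnt
  rw [Finset.card_filter]
  push_cast
  apply Finset.sum_congr rfl
  intro p _
  by_cases hh : |cr (dir h p) (y - x)| ≤ τ <;> simp [indicator, tube, hh]

lemma sq_dist {x y : ℂ} (hx : x ∈ unitSq) (hy : y ∈ unitSq) : ‖y - x‖ ≤ 2 := by
  refine (norm_le_parts _).trans ?_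
  obtain ⟨⟨a1, a2⟩, ⟨a3, a4⟩⟩ := hx
  obtain ⟨⟨b1, b2⟩, ⟨b3, b4⟩⟩ := hy
  have h1 : |(y - x).re| ≤ 1 := by rw [Complex.sub_re, abs_le]; constructor <;> linarith
  have h2 : |(y - x).im| ≤ 1 := by rw [Complex.sub_im, abs_le]; constructor <;> linarith
  linarith

lemma cnt_dyadic {δ ε L : ℝ} (hδ : 0 < δ) (hδ1 : δ ≤ 1) (hε : 0 < ε) (hε1 : ε ≤ 1) (hL : 0 ≤ L)
    {n : ℕ} (hn : 1 / δ ≤ 2 ^ n) {u : ℂ} (hu : ‖u‖ ≤ 2) :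
    ∃ k ≤ n, ‖u‖ ≤ 2 / 2 ^ k ∧ (cnt (ε * δ) (L * (ε * δ)) u : ℝ) ≤ (24 * L + 10) / ε * 2 ^ k := by
  classical
  have h0 : 0 < ε * δ := by positivity
  have h1 : ε * δ ≤ 1 := by nlinarith
  let Q : ℕ → Prop := fun k => ‖u‖ ≤ 2 / 2 ^ k
  have q0 : Q 0 := by simpa [Q] using hu
  have hs : Q (Nat.findGreatest Q n) := Nat.findGreatest_spec (P := Q) (Nat.zero_le n) q0
  have hle : Nat.findGreatest Q n ≤ n := Nat.findGreatest_le n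
  refine ⟨Nat.findGreatest Q n, hle, hs, ?_⟩
  set k := Nat.findGreatest Q n
  rcases hle.eq_or_lt with he | hlt
  · rw [he]
    have a := cnt_h h0 h1 (τ := L * (ε * δ)) u
    have b : (cnt (ε * δ) (L * (ε * δ)) u : ℝ) ≤ 10 / (ε * δ) := by rwa [le_div_iff₀ h0]
    refine b.trans ?_
    calc 10 / (ε * δ) = 10 / ε * (1 / δ) := by field_simp
      _ ≤ (24 * L + 10) / ε * 2 ^ n := by gcongr; linarith
  · have hnq : ¬ Q (k + 1) := by
      intro h
      have : k + 1 ≤ k := Nat.le_findGreatest (P := Q) hlt h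
      omega
    simp only [Q, not_le] at hnq
    have e : (2:ℝ) / 2 ^ (k + 1) = 1 / 2 ^ k := by rw [pow_succ]; field_simp
    rw [e] at hnq
    have a := cnt_u h0 h1 hL hu
    have p : (0:ℝ) < 1 / 2 ^ k := by positivity
    have b : (cnt (ε * δ) (L * (ε * δ)) u : ℝ) * (1 / 2 ^ k) ≤ 24 * L + 10 := by
      refine le_trans ?_ a; gcongr
    rw [mul_one_div, div_le_iff₀ (by positivity)] at b
    refine b.trans ?_
    gcongr
    rw [le_div_iff₀ hε]; nlinarith

lemma energy {A : Set ℂ} {α C δ ε L : ℝ} (hα0 : 0 < α) (hα1 : α ≤ 1) (hC : 0 < C) (hAm : MeasurableSet A)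
    (hfin : volume A ≠ ⊤)
    (hA : A ⊆ unitSq) (hδ : 0 < δ) (hδ1 : δ ≤ 1 / 2) (hε : 0 < ε) (hε1 : ε ≤ 1) (hL : 0 ≤ L)
    (h3 : ∀ (x : ℂ) (r : ℝ), 0 < r →
      (volume (A ∩ closedBall x r)).toReal ≤ C * r ^ α * (volume A).toReal)
    {x : ℂ} (hx : x ∈ unitSq) :
    ∑ p ∈ idx (ε * δ), volume (A ∩ tube (dir (ε * δ) p) x (L * (ε * δ))) ≤
      ENNReal.ofReal ((12 * C * ((24 * L + 10) / ε) / Real.log 2) * |Real.log δ| * δ ^ (α - 1)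
        * (volume A).toReal) := by
  set h := ε * δ
  set M := (volume A).toReal
  set D := (24 * L + 10) / ε with hD
  have D0 : 0 < D := by positivity
  have M0 : 0 ≤ M := ENNReal.toReal_nonneg
  obtain ⟨n, hn1, hn2⟩ := exists_nat_pow_near (x := 1 / δ) (y := (2:ℝ))
    (by rw [le_div_iff₀ hδ]; linarith) (by norm_num)
  have step1 : ∑ p ∈ idx h, volume (A ∩ tube (dir h p) x (L * h)) =
      ∫⁻ y in A, (cnt h (L * h) (y - x) : ENNReal) := by
    simp_rw [← cnt_sum]
    rw [lintegral_finsetSum]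
    · apply Finset.sum_congr rfl
      intro p _
      rw [lintegral_indicator_one (tube_closed _ _ _), Measure.restrict_apply (tube_closed _ _ _), inter_comm]
    · intro p _
      exact measurable_one.indicator (tube_closed _ _ _)
  have step2 : ∫⁻ y in A, (cnt h (L * h) (y - x) : ENNReal) ≤
      ∫⁻ y in A, ∑ k ∈ Finset.range (n + 1 + 1), ENNReal.ofReal (D * 2 ^ k) *
        (closedBall x (2 / 2 ^ k)).indicator (1 : ℂ → ENNReal) y := by
    apply setLIntegral_mono' hAm
    intro y hy
    obtain ⟨k, hk, hk1, hk2⟩ := cnt_dyadic hδ (by linarith) hε hε1 hL hn2.le (sq_dist hx (hA hy))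
    have hmem : y ∈ closedBall x (2 / 2 ^ k) := by rwa [mem_closedBall, dist_eq_norm]
    refine le_trans ?_ (Finset.single_le_sum (fun _ _ => zero_le) (Finset.mem_range.2 (Nat.lt_succ_of_le hk)))
    rw [indicator_of_mem hmem, Pi.one_apply, mul_one, ← ENNReal.ofReal_natCast]
    exact ENNReal.ofReal_le_ofReal hk2
  have step3 : ∫⁻ y in A, ∑ k ∈ Finset.range (n + 1 + 1), ENNReal.ofReal (D * 2 ^ k) *
        (closedBall x (2 / 2 ^ k)).indicator (1 : ℂ → ENNReal) y =
      ∑ k ∈ Finset.range (n + 1 + 1), ENNReal.ofReal (D * 2 ^ k) * volume (A ∩ closedBall x (2 / 2 ^ k)) := by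
    rw [lintegral_finsetSum]
    · apply Finset.sum_congr rfl
      intro k _
      rw [lintegral_const_mul _ (measurable_one.indicator measurableSet_closedBall),
        lintegral_indicator_one measurableSet_closedBall, Measure.restrict_apply measurableSet_closedBall, inter_comm]
    · intro k _
      exact (measurable_one.indicator measurableSet_closedBall).const_mul _
  have hterm : ∀ k ∈ Finset.range (n + 1 + 1), ENNReal.ofReal (D * 2 ^ k) * volume (A ∩ closedBall x (2 / 2 ^ k))
      ≤ ENNReal.ofReal (4 * C * D * δ ^ (α - 1) * M) := by
    intro k hk
    have hk' : k ≤ n + 1 := by have := Finset.mem_range.1 hk; omega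
    have hf : volume (A ∩ closedBall x (2 / 2 ^ k)) ≠ ⊤ := measure_ne_top_of_subset inter_subset_left hfin
    rw [← ENNReal.ofReal_toReal hf, ← ENNReal.ofReal_mul (by positivity)]
    apply ENNReal.ofReal_le_ofReal
    have a := h3 x (2 / 2 ^ k) (by positivity)
    have b : (2 / 2 ^ k : ℝ) ^ α * 2 ^ k ≤ 4 * δ ^ (α - 1) := by
      have e1 : (2 / 2 ^ k : ℝ) ^ α * 2 ^ k = 2 ^ α * ((2:ℝ) ^ k) ^ (1 - α) := by
        rw [Real.div_rpow (by positivity) (by positivity), Real.rpow_sub (by positivity), Real.rpow_one]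
        ring
      have e2 : (2:ℝ) ^ α ≤ 2 := by
        conv_rhs => rw [← Real.rpow_one 2]
        exact Real.rpow_le_rpow_of_exponent_le (by norm_num) hα1
      have e3 : ((2:ℝ) ^ k) ≤ 2 / δ := by
        calc (2:ℝ) ^ k ≤ 2 ^ (n + 1) := pow_le_pow_right₀ (by norm_num) hk'
          _ = 2 * 2 ^ n := by ring
          _ ≤ 2 * (1 / δ) := by gcongr
          _ = 2 / δ := by ring
      have e4 : ((2:ℝ) ^ k) ^ (1 - α) ≤ 2 * δ ^ (α - 1) := by
        calc ((2:ℝ) ^ k) ^ (1 - α) ≤ (2 / δ) ^ (1 - α) := Real.rpow_le_rpow (by positivity) e3 (by linarith)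
          _ = 2 ^ (1 - α) * δ ^ (α - 1) := by
            rw [Real.div_rpow (by norm_num) hδ.le, div_eq_mul_inv, ← Real.rpow_neg hδ.le]; ring_nf
          _ ≤ 2 * δ ^ (α - 1) := by
            gcongr
            conv_rhs => rw [← Real.rpow_one 2]
            exact Real.rpow_le_rpow_of_exponent_le (by norm_num) (by linarith)
      rw [e1]
      calc _ ≤ 2 * (2 * δ ^ (α - 1)) := by gcongr
        _ = _ := by ring
    calc D * 2 ^ k * (volume (A ∩ closedBall x (2 / 2 ^ k))).toReal
        ≤ D * 2 ^ k * (C * (2 / 2 ^ k) ^ α * M) := by gcongr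
      _ = D * C * M * ((2 / 2 ^ k) ^ α * 2 ^ k) := by ring
      _ ≤ D * C * M * (4 * δ ^ (α - 1)) := by gcongr
      _ = _ := by ring
  rw [step1]
  refine step2.trans (step3.le.trans ((Finset.sum_le_card_nsmul _ _ _ hterm).trans ?_))
  rw [Finset.card_range, nsmul_eq_mul, ← ENNReal.ofReal_natCast, ← ENNReal.ofReal_mul (by positivity)]
  apply ENNReal.ofReal_le_ofReal
  have l2 : 0 < Real.log 2 := Real.log_pos (by norm_num)
  have ha : |Real.log δ| = Real.log (1 / δ) := by
    rw [abs_of_nonpos (Real.log_nonpos hδ.le (by linarith)), one_div, Real.log_inv]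
  have hb : Real.log 2 ≤ |Real.log δ| := by
    rw [ha]; apply Real.log_le_log (by norm_num); rw [le_div_iff₀ hδ]; linarith
  have hc : n * Real.log 2 ≤ |Real.log δ| := by
    rw [ha, ← Real.log_pow]; exact Real.log_le_log (by positivity) hn1
  have hd : ((n + 1 + 1 : ℕ) : ℝ) ≤ 3 * |Real.log δ| / Real.log 2 := by
    rw [le_div_iff₀ l2]; push_cast; nlinarith
  calc ((n + 1 + 1 : ℕ) : ℝ) * (4 * C * D * δ ^ (α - 1) * M)
      ≤ (3 * |Real.log δ| / Real.log 2) * (4 * C * D * δ ^ (α - 1) * M) := by gcongr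
    _ = _ := by ring

lemma fubini_ineq {W : Set (ℂ × (ℂ × ℂ))} (hW : MeasurableSet W) (ν : Measure ℂ) [IsFiniteMeasure ν]
    (E : Set ℂ) (b V : ENNReal) (h1 : ∀ a ∈ E, b ≤ (ν.prod ν) (Prod.mk a ⁻¹' W))
    (h2 : ∀ z : ℂ × ℂ, volume ((fun a : ℂ => (a, z)) ⁻¹' W) ≤ V) :
    b * volume E ≤ V * (ν univ * ν univ) := by
  have hm : Measurable (fun a => (ν.prod ν) (Prod.mk a ⁻¹' W)) := measurable_measure_prodMk_left hW
  calc b * volume E ≤ b * volume {a | b ≤ (ν.prod ν) (Prod.mk a ⁻¹' W)} := by gcongr; exact h1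
    _ ≤ ∫⁻ a, (ν.prod ν) (Prod.mk a ⁻¹' W) := mul_meas_ge_le_lintegral hm b
    _ = ((volume : Measure ℂ).prod (ν.prod ν)) W := (Measure.prod_apply hW).symm
    _ = ∫⁻ z, volume ((fun a : ℂ => (a, z)) ⁻¹' W) ∂(ν.prod ν) := Measure.prod_apply_symm hW
    _ ≤ ∫⁻ z, V ∂(ν.prod ν) := lintegral_mono h2
    _ = V * (ν univ * ν univ) := by
      rw [lintegral_const, ← univ_prod_univ, Measure.prod_prod]

lemma prod_lower {ν : Measure ℂ} [IsFiniteMeasure ν] {X : Set (ℂ × ℂ)} (hX : MeasurableSet X)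
    (b : ENNReal) (G : Set ℂ) (hG : b ≤ ν G) (h : ∀ x ∈ G, b ≤ ν (Prod.mk x ⁻¹' X)) :
    b * b ≤ (ν.prod ν) X := by
  rw [Measure.prod_apply hX]
  calc b * b ≤ b * ν {x | b ≤ ν (Prod.mk x ⁻¹' X)} := by gcongr; exact hG.trans (measure_mono h)
    _ ≤ _ := mul_meas_ge_le_lintegral (measurable_measure_prodMk_left hX) b

lemma mass_left {A X B B' : Set ℂ} {a : ℂ} {M : ℝ} (hM : volume A = ENNReal.ofReal M) (hM0 : 0 < M)
    (hB : volume B ≤ ENNReal.ofReal (M / 20)) (hB' : volume B' ≤ ENNReal.ofReal (M / 10))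
    (hsub : ∀ x ∈ A, x ≠ a → x ∉ B → x ∉ B' → x ∈ X) :
    ENNReal.ofReal (M / 2) ≤ volume.restrict A X := by
  have h1 : A ⊆ (X ∩ A) ∪ (B ∪ (B' ∪ {a})) := by
    intro x hx
    by_cases ha : x = a
    · simp [ha]
    by_cases hb : x ∈ B
    · simp [hb]
    by_cases hb' : x ∈ B'
    · simp [hb']
    exact Or.inl ⟨hsub x hx ha hb hb', hx⟩
  have h2 : volume A ≤ volume (X ∩ A) + (ENNReal.ofReal (M / 20) + (ENNReal.ofReal (M / 10) + 0)) := by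
    refine (measure_mono h1).trans ((measure_union_le _ _).trans ?_)
    gcongr
    refine (measure_union_le _ _).trans ?_
    gcongr
    refine (measure_union_le _ _).trans ?_
    gcongr
    simp
  refine le_trans ?_ (Measure.le_restrict_apply A X)
  by_contra hcon
  push Not at hcon
  rw [add_zero, hM, ← ENNReal.ofReal_add (by positivity) (by positivity)] at h2
  have h3 : ENNReal.ofReal M < ENNReal.ofReal (M / 2) + ENNReal.ofReal (M / 20 + M / 10) :=
    h2.trans_lt (ENNReal.add_lt_add_right ENNReal.ofReal_ne_top hcon)
  rw [← ENNReal.ofReal_add (by positivity) (by positivity), ENNReal.ofReal_lt_ofReal_iff (by positivity)] at h3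
  linarith

lemma good_dir {A : Set ℂ} {a x : ℂ} {δ R ε : ℝ} {m : ENNReal} (hδ : 0 < δ) (hδ1 : δ ≤ 1) (hR : 0 < R)
    (hε : 0 < ε) (hε1 : ε ≤ 1) (hAR : ∀ z ∈ A, ‖z - a‖ ≤ R) (hx : x ∈ A) (hxa : x ≠ a)
    (hm : m ≤ volume (A ∩ {y | y ≠ a ∧ dist (radialProj a y) (radialProj a x) ≤ 4 * (δ / R)})) :
    ∃ p ∈ idx (ε * δ), a ∈ tube (dir (ε * δ) p) x ((12 / ε + 2 * R) * (ε * δ)) ∧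
      m ≤ volume (A ∩ tube (dir (ε * δ) p) x ((12 / ε + 2 * R) * (ε * δ))) ∧
      ∃ s : ℝ, ‖dir (ε * δ) p - s • (x - a)‖ ≤ ε * δ ∧ 1 ≤ ‖s • (x - a)‖ ∧ ‖s • (x - a)‖ ≤ 2 ∧
      ∀ w' : ℂ, ∃ t : ℝ, ‖w' - t • (x - a)‖ ≤ |cr (s • (x - a)) w'| := by
  have h0 : 0 < ε * δ := by positivity
  have h1 : ε * δ ≤ 1 := by nlinarith
  obtain ⟨p, hp, s, hs1, hs2, hs3, hs4⟩ := approx_dir h0 (sub_ne_zero.2 hxa)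
  refine ⟨p, hp, ?_, ?_, s, hs1, hs2, hs3, hs4⟩
  all_goals
    set h := ε * δ with hh
    set e := dir h p
    set w := x - a with hw
  · have e1 : cr e (a - x) = - cr (e - s • w) w := by
      rw [cr_sub_left, cr_smul_left, cr_self, show a - x = (0:ℂ) - w by rw [hw]; ring, cr_sub_right]
      simp [cr]
    simp only [tube, mem_ofPred_eq]
    rw [e1, abs_neg]
    refine (abs_cr_le _ _).trans ?_
    have : ‖e - s • w‖ * ‖w‖ ≤ h * R := by gcongr; exact hAR x hx
    have : (0:ℝ) ≤ 12 / ε * h := by positivity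
    nlinarith
  · refine hm.trans (measure_mono ?_)
    rintro y ⟨hyA, hya, hyd⟩
    refine ⟨hyA, ?_⟩
    simp only [tube, mem_ofPred_eq]
    have nx : ‖x - a‖ ≠ 0 := norm_ne_zero_iff.2 (sub_ne_zero.2 hxa)
    have ny : ‖y - a‖ ≠ 0 := norm_ne_zero_iff.2 (sub_ne_zero.2 hya)
    have hyw : y - a = ‖y - a‖ • radialProj a y := by
      rw [radialProj, smul_smul, mul_inv_cancel₀ ny, one_smul]
    have ex : cr e w = cr (e - s • w) w := by
      rw [cr_sub_left, cr_smul_left, cr_self]; ring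
    have ep : cr e (radialProj a x) = cr (e - s • w) (radialProj a x) := by
      rw [radialProj, cr_smul_right, cr_smul_right, ← hw, ex]
    have e1 : cr e (y - x) = ‖y - a‖ * (cr e (radialProj a y - radialProj a x) + cr (e - s • w) (radialProj a x))
        - cr (e - s • w) w := by
      rw [← ep, ← ex, cr_sub_right e (radialProj a y), sub_add_cancel, ← cr_smul_right, ← hyw, ← cr_sub_right, hw]
      congr 1; ring
    have b1 : |cr e (radialProj a y - radialProj a x)| ≤ 3 * (4 * (δ / R)) := by
      refine (abs_cr_le _ _).trans ?_
      rw [← dist_eq_norm]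
      gcongr
      exact dir_norm h0 h1 hp
    have b2 : |cr (e - s • w) (radialProj a x)| ≤ h := by
      refine (abs_cr_le _ _).trans ?_
      rw [radial_norm hxa, mul_one]; exact hs1
    have b3 : |cr (e - s • w) w| ≤ h * R := by
      refine (abs_cr_le _ _).trans ?_
      gcongr; exact hAR x hx
    rw [e1]
    refine (abs_sub _ _).trans ?_
    rw [abs_mul, abs_norm]
    have b4 := (abs_add_le (cr e (radialProj a y - radialProj a x)) (cr (e - s • w) (radialProj a x))).trans
      (add_le_add b1 b2)
    have b5 := mul_le_mul (hAR y hyA) b4 (abs_nonneg _) hR.le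
    have b6 : R * (3 * (4 * (δ / R)) + h) = 12 * δ + R * h := by field_simp; ring
    have b7 : (12 / ε + 2 * R) * h = 12 * δ + 2 * R * h := by rw [hh]; field_simp
    rw [b7]; linarith

lemma transversal {e e' w w' : ℂ} {s s' h R C : ℝ} (hR : 0 < R) (hC : 0 < C)
    (hh : 5 * h ≤ 1 / (2 * C * R))
    (he : ‖e - s • w‖ ≤ h) (he' : ‖e' - s' • w'‖ ≤ h) (h2 : ‖s • w‖ ≤ 2) (h3 : ‖e'‖ ≤ 3)
    (h1 : 1 ≤ ‖s' • w'‖) (hw : ‖w'‖ ≤ R) (hcr : 1 / C ≤ |cr (s • w) w'|) :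
    1 / (2 * C * R) ≤ |cr e e'| := by
  have hh0 : 0 ≤ h := (norm_nonneg _).trans he
  have e1 : cr e e' = s' * cr (s • w) w' + (cr (s • w) (e' - s' • w') + cr (e - s • w) e') := by
    rw [cr_sub_left, cr_sub_right, cr_smul_right]; ring
  have b1 : |cr (s • w) (e' - s' • w')| ≤ 2 * h := (abs_cr_le _ _).trans (by gcongr)
  have b2 : |cr (e - s • w) e'| ≤ h * 3 := (abs_cr_le _ _).trans (by gcongr)
  have b3 : 1 / R ≤ |s'| := by
    rw [norm_smul, Real.norm_eq_abs] at h1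
    rw [div_le_iff₀ hR]
    refine h1.trans (by gcongr)
  have b4 : 1 / R * (1 / C) ≤ |s' * cr (s • w) w'| := by
    rw [abs_mul]; gcongr
  have b5 : 1 / R * (1 / C) = 2 * (1 / (2 * C * R)) := by field_simp
  have b6 := abs_add_le (cr (s • w) (e' - s' • w')) (cr (e - s • w) e')
  have b7 := abs_sub_abs_le_abs_sub (s' * cr (s • w) w') (-(cr (s • w) (e' - s' • w') + cr (e - s • w) e'))
  rw [sub_neg_eq_add, ← e1, abs_neg] at b7
  linarith

lemma P_finite {A P : Set ℂ} {δ : ℝ} (hδ : 0 < δ) (hA : A ⊆ unitSq) (hP : A = ⋃ x ∈ P, closedBall x δ)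
    (hf : ∀ y : ℂ, {x ∈ P | y ∈ closedBall x δ}.Finite) : P.Finite := by
  by_contra hinf
  have hcomp : IsCompact (closedBall (0:ℂ) 2) := isCompact_closedBall 0 2
  have hsub : P ⊆ closedBall (0:ℂ) 2 := by
    intro p hp
    have : p ∈ unitSq := hA (by rw [hP]; exact mem_biUnion hp (mem_closedBall_self hδ.le))
    rw [mem_closedBall, dist_eq_norm]
    exact sq_dist (x := 0) (by simp [unitSq]) this
  obtain ⟨q, _, hq⟩ := Set.Infinite.exists_accPt_of_subset_isCompact hinf hcomp hsub
  have h1 : (closedBall q δ ∩ P).Infinite := by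
    have := (accPt_iff_frequently_nhdsNE.1 hq)
    by_contra hfin
    rw [Set.not_infinite] at hfin
    have hq' : AccPt q (Filter.principal (closedBall q δ ∩ P)) := by
      rw [accPt_iff_frequently_nhdsNE]
      refine (this.and_eventually (mem_nhdsWithin_of_mem_nhds (closedBall_mem_nhds q hδ))).mono ?_
      rintro y ⟨h1, h2⟩; exact ⟨h2, h1⟩
    rw [accPt_iff_frequently_nhdsNE] at hq'
    apply hq'
    have hcl : IsClosed ((closedBall q δ ∩ P) \ {q}) := (hfin.subset sdiff_subset).isClosed
    have : ((closedBall q δ ∩ P) \ {q})ᶜ ∈ nhds q := hcl.isOpen_compl.mem_nhds (by simp)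
    filter_upwards [mem_nhdsWithin_of_mem_nhds this, self_mem_nhdsWithin] with y hy1 hy2 hy3
    exact hy1 ⟨hy3, hy2⟩
  apply h1
  refine (hf q).subset ?_
  rintro x ⟨hx, hxP⟩
  exact ⟨hxP, by rwa [mem_closedBall, dist_comm]⟩

lemma delta_le {p : ℂ} {δ : ℝ} (hδ : 0 < δ) (h : closedBall p δ ⊆ unitSq) : δ ≤ 1 / 2 := by
  have h1 : p + (δ : ℂ) ∈ unitSq := h (by simp [abs_of_pos hδ])
  have h2 : p - (δ : ℂ) ∈ unitSq := h (by simp [abs_of_pos hδ])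
  have a := h1.1.2
  have b := h2.1.1
  simp at a b
  linarith

/-- triples -/
def Wset (A : Set ℂ) (h τ c : ℝ) (m : ENNReal) : Set (ℂ × (ℂ × ℂ)) :=
  ⋃ p ∈ idx h, ⋃ q ∈ idx h, {z | c ≤ |cr (dir h p) (dir h q)| ∧ z.2.1 ∈ A ∧ z.2.2 ∈ A ∧
    z.1 ∈ tube (dir h p) z.2.1 τ ∧ z.1 ∈ tube (dir h q) z.2.2 τ ∧
    m ≤ volume (A ∩ tube (dir h p) z.2.1 τ) ∧ m ≤ volume (A ∩ tube (dir h q) z.2.2 τ)}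

lemma meas_vol_tube {A : Set ℂ} (hA : MeasurableSet A) (e : ℂ) (τ : ℝ) :
    Measurable (fun x => volume (A ∩ tube e x τ)) := by
  have : MeasurableSet {z : ℂ × ℂ | z.2 ∈ A ∧ |cr e (z.2 - z.1)| ≤ τ} := by
    have hcl : IsClosed {z : ℂ × ℂ | |cr e (z.2 - z.1)| ≤ τ} := by
      unfold cr
      apply isClosed_le <;> fun_prop
    exact (measurable_snd hA).inter hcl.measurableSet
  exact measurable_measure_prodMk_left this

lemma Wset_meas {A : Set ℂ} (hA : MeasurableSet A) (h τ c : ℝ) (m : ENNReal) :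
    MeasurableSet (Wset A h τ c m) := by
  unfold Wset
  refine Finset.measurableSet_biUnion _ fun p _ => Finset.measurableSet_biUnion _ fun q _ => ?_
  have m1 : Measurable (fun z : ℂ × (ℂ × ℂ) => z.2.1) := by fun_prop
  have m2 : Measurable (fun z : ℂ × (ℂ × ℂ) => z.2.2) := by fun_prop
  refine MeasurableSet.inter (MeasurableSet.const _) ?_
  refine MeasurableSet.inter (m1 hA) ?_
  refine MeasurableSet.inter (m2 hA) ?_
  refine MeasurableSet.inter ?_ (MeasurableSet.inter ?_ (MeasurableSet.inter ?_ ?_))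
  · apply IsClosed.measurableSet
    simp only [tube, cr]
    apply isClosed_le <;> fun_prop
  · apply IsClosed.measurableSet
    simp only [tube, cr]
    apply isClosed_le <;> fun_prop
  · exact measurableSet_le measurable_const ((meas_vol_tube hA _ _).comp m1)
  · exact measurableSet_le measurable_const ((meas_vol_tube hA _ _).comp m2)

lemma Wset_section {A : Set ℂ} {h τ c N : ℝ} {m : ENNReal} (h0 : 0 < h) (h1 : h ≤ 1) (hc : 0 < c) (hτ : 0 ≤ τ)
    (hN : ∀ x ∈ A, ∀ F ⊆ idx h, (∀ p ∈ F, m ≤ volume (A ∩ tube (dir h p) x τ)) → (F.card : ℝ) ≤ N)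
    (z : ℂ × ℂ) : volume ((fun a : ℂ => (a, z)) ⁻¹' Wset A h τ c m) ≤
      ENNReal.ofReal (N ^ 2 * (Real.pi * (12 * τ / c) ^ 2)) := by
  classical
  obtain ⟨x, y⟩ := z
  by_cases hxy : x ∈ A ∧ y ∈ A
  swap
  · have : (fun a : ℂ => (a, (x, y))) ⁻¹' Wset A h τ c m = ∅ := by
      apply eq_empty_of_forall_notMem
      intro a ha
      simp only [Wset, mem_preimage, mem_iUnion, mem_ofPred_eq] at ha
      obtain ⟨p, _, q, _, h1, h2, h3, _⟩ := ha
      exact hxy ⟨h2, h3⟩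
    rw [this]; simp
  obtain ⟨hx, hy⟩ := hxy
  let F : ℂ → Finset (Bool × ℤ) := fun x => (idx h).filter (fun p => m ≤ volume (A ∩ tube (dir h p) x τ))
  have hF : ∀ x ∈ A, ((F x).card : ℝ) ≤ N := fun x hx =>
    hN x hx (F x) (Finset.filter_subset _ _) (fun p hp => (Finset.mem_filter.1 hp).2)
  let T : (Bool × ℤ) × (Bool × ℤ) → Set ℂ := fun pq =>
    {a | c ≤ |cr (dir h pq.1) (dir h pq.2)| ∧ a ∈ tube (dir h pq.1) x τ ∩ tube (dir h pq.2) y τ}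
  have hsub : (fun a : ℂ => (a, (x, y))) ⁻¹' Wset A h τ c m ⊆ ⋃ pq ∈ F x ×ˢ F y, T pq := by
    intro a ha
    simp only [Wset, mem_preimage, mem_iUnion, mem_ofPred_eq] at ha
    obtain ⟨p, hp, q, hq, g1, g2, g3, g4, g5, g6, g7⟩ := ha
    simp only [mem_iUnion]
    refine ⟨(p, q), Finset.mem_product.2 ⟨Finset.mem_filter.2 ⟨hp, g6⟩, Finset.mem_filter.2 ⟨hq, g7⟩⟩, g1, g4, g5⟩
  have hT : ∀ pq ∈ F x ×ˢ F y, volume (T pq) ≤ ENNReal.ofReal (Real.pi * (12 * τ / c) ^ 2) := by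
    rintro ⟨p, q⟩ hpq
    obtain ⟨hp, hq⟩ := Finset.mem_product.1 hpq
    rcases (T (p, q)).eq_empty_or_nonempty with he | ⟨b, hb1, hb2, hb3⟩
    · rw [he]; simp
    have : T (p, q) ⊆ closedBall b (12 * τ / c) := by
      rintro a ⟨_, ha⟩
      exact tube_inter_subset hc (dir_norm h0 h1 (Finset.mem_filter.1 hp).1)
        (dir_norm h0 h1 (Finset.mem_filter.1 hq).1) hb1 hb2 hb3 ha
    refine (measure_mono this).trans ?_
    rw [Complex.volume_closedBall, mul_comm Real.pi, ENNReal.ofReal_mul (by positivity), ENNReal.ofReal_pow (by positivity)]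
    apply le_of_eq; congr 1
    rw [← NNReal.coe_real_pi, ENNReal.ofReal_coe_nnreal]
  refine (measure_mono hsub).trans ((measure_biUnion_finset_le _ _).trans ((Finset.sum_le_card_nsmul _ _ _ hT).trans ?_))
  rw [nsmul_eq_mul, ← ENNReal.ofReal_natCast, ← ENNReal.ofReal_mul (by positivity)]
  apply ENNReal.ofReal_le_ofReal
  gcongr
  rw [Finset.card_product, Nat.cast_mul, pow_two]
  have := hF x hx
  have := hF y hy
  have : (0:ℝ) ≤ (F x).card := by positivity
  gcongr
  exact this.trans (hF x hx)

/-- Theorem (lower bounds on visibility, part A): the set of vantage points in a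
compact set `U` from which an `(α,C₀,δ)`-set unconcentrated on lines has visibility
less than `λ` has measure at most `C₁ |log δ|^{C₂} δ^{-2+2α} λ²`. -/
theorem stmt1 (α C₀ : ℝ) (hα0 : 0 < α) (hα1 : α ≤ 1) (hC₀ : 0 < C₀)
    (U : Set ℂ) (hU : IsCompact U) :
    ∃ C₁ C₂ : ℝ, 0 < C₁ ∧ 0 < C₂ ∧
      ∀ (δ lam : ℝ) (A : Set ℂ), 0 < δ → δ < 1 → A ⊆ unitSq →
        UnconcSet α C₀ δ A → 0 < lam → lam ≤ 1 →
        (volume {a ∈ U | vis a A < lam}).toReal ≤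
          C₁ * |Real.log δ| ^ C₂ * δ ^ (-2 + 2 * α) * lam ^ 2 := by
  obtain ⟨K, hK⟩ := hU.isBounded.exists_norm_le
  set R : ℝ := max K 0 + 3 with hRd
  have hR : 0 < R := by positivity
  set ε : ℝ := 1 / (10 * C₀ * R + 1) with hεd
  have hε : 0 < ε := by positivity
  have hε1 : ε ≤ 1 := by rw [hεd, div_le_one (by positivity)]; nlinarith [mul_pos hC₀ hR]
  have hε5 : 5 * ε ≤ 1 / (2 * C₀ * R) := by
    rw [hεd, mul_one_div, div_le_div_iff₀ (by positivity) (by positivity)]; linarith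
  set L : ℝ := 12 / ε + 2 * R with hLd
  have hL : 0 < L := by positivity
  set c : ℝ := 1 / (2 * C₀ * R) with hcd
  have hc : 0 < c := by positivity
  have l2 : 0 < Real.log 2 := Real.log_pos (by norm_num)
  set K₀ : ℝ := 12 * C₀ * ((24 * L + 10) / ε) / Real.log 2 with hK₀d
  have hK₀ : 0 < K₀ := by positivity
  refine ⟨4 * Real.pi * (K₀ * (40 * Real.pi * R) * (12 * L * ε / c)) ^ 2, 2, by positivity, by norm_num, ?_⟩
  intro δ lam A hδ hδ1 hA hunc hl hl1
  obtain ⟨⟨P, ⟨p₀, hp₀⟩, hAP, hPf⟩, hlow, hup, hball, hline⟩ := hunc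
  have hPfin : P.Finite := P_finite hδ hA hAP (fun y => (hPf y).1)
  have hAm : MeasurableSet A := by
    rw [hAP]
    exact (hPfin.isClosed_biUnion fun _ _ => isClosed_closedBall).measurableSet
  have hδ2 : δ ≤ 1 / 2 := by
    refine delta_le (p := p₀) hδ (subset_trans ?_ hA)
    rw [hAP]; exact subset_biUnion_of_mem (u := fun x => closedBall x δ) hp₀
  set M := (volume A).toReal with hMd
  have hM0 : 0 < M := lt_of_lt_of_le (by positivity) hlow
  have hfin : volume A ≠ ⊤ := by
    intro h; rw [hMd, h] at hM0; simp at hM0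
  have hM : volume A = ENNReal.ofReal M := (ENNReal.ofReal_toReal hfin).symm
  have hAR : ∀ a ∈ U, ∀ z ∈ A, ‖z - a‖ ≤ R := by
    intro a ha z hz
    have h1 := hK a ha
    have h2 := sq_dist (x := 0) (by simp [unitSq]) (hA hz)
    rw [sub_zero] at h2
    have := norm_sub_le z a
    have := le_max_left K 0
    linarith
  set h := ε * δ with hhd
  have h0 : 0 < h := by positivity
  have h1 : h ≤ 1 := by nlinarith
  set mr : ℝ := M * (δ / R) / (40 * Real.pi * lam) with hmrd
  have hmr : 0 < mr := by positivity
  set m := ENNReal.ofReal mr with hmd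
  set τ := L * h with hτd
  set N : ℝ := K₀ * |Real.log δ| * δ ^ (α - 1) * (40 * Real.pi * R * lam / δ) with hNd
  have hN : ∀ x ∈ A, ∀ F ⊆ idx h, (∀ p ∈ F, m ≤ volume (A ∩ tube (dir h p) x τ)) → (F.card : ℝ) ≤ N := by
    intro x hx F hF hFm
    have e1 := energy hα0 hα1 hC₀ hAm hfin hA hδ hδ2 hε hε1 hL.le hball (hA hx)
    have e2 : (F.card : ENNReal) * m ≤ ENNReal.ofReal (K₀ * |Real.log δ| * δ ^ (α - 1) * M) := by
      rw [← nsmul_eq_mul]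
      refine (Finset.card_nsmul_le_sum F _ m hFm).trans (le_trans ?_ e1)
      exact Finset.sum_le_sum_of_subset hF
    have hpos : 0 ≤ K₀ * |Real.log δ| * δ ^ (α - 1) * M :=
      mul_nonneg (mul_nonneg (mul_nonneg hK₀.le (abs_nonneg _)) (Real.rpow_nonneg hδ.le _)) hM0.le
    rw [hmd, ← ENNReal.ofReal_natCast, ← ENNReal.ofReal_mul (Nat.cast_nonneg _),
      ENNReal.ofReal_le_ofReal_iff hpos] at e2
    rw [← le_div_iff₀ hmr] at e2
    refine e2.trans (le_of_eq ?_)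
    rw [hNd, hmrd]; field_simp
  have hWm := Wset_meas hAm h τ c m
  have : IsFiniteMeasure (volume.restrict A) := ⟨by rw [Measure.restrict_apply_univ]; exact hfin.lt_top⟩
  have hmain := fubini_ineq hWm (volume.restrict A) {a ∈ U | vis a A < lam}
    (ENNReal.ofReal (M / 2) * ENNReal.ofReal (M / 2))
    (ENNReal.ofReal (N ^ 2 * (Real.pi * (12 * τ / c) ^ 2))) (by
      rintro a ⟨haU, hav⟩
      obtain ⟨n, hn1, hn2⟩ := bad_small m hδ hR hl hAP (hAR a haU) hav
      set B := {x ∈ A \ {a} | volume (A ∩ {y | y ≠ a ∧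
        dist (radialProj a y) (radialProj a x) ≤ 4 * (δ / R)}) < m} with hBd
      have hB : volume B ≤ ENNReal.ofReal (M / 20) := by
        refine hn2.trans ?_
        rw [hmd, ← ENNReal.ofReal_natCast, ← ENNReal.ofReal_mul (by positivity)]
        apply ENNReal.ofReal_le_ofReal
        calc (n : ℝ) * mr = (n * (δ / R)) * (M / (40 * Real.pi * lam)) := by rw [hmrd]; ring
          _ ≤ (2 * Real.pi * lam) * (M / (40 * Real.pi * lam)) := by gcongr
          _ = M / 20 := by field_simp; ring
      have hgood : ∀ x ∈ A, x ≠ a → x ∉ B → _ := fun x hx hxa hxB =>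
        good_dir (m := m) hδ hδ1.le hR hε hε1 (hAR a haU) hx hxa (by
          by_contra hcon; exact hxB ⟨⟨hx, hxa⟩, not_le.1 hcon⟩)
      apply prod_lower (measurable_prodMk_left hWm) (ENNReal.ofReal (M / 2))
        {x | x ∈ A ∧ x ≠ a ∧ x ∉ B}
      · exact mass_left (B' := ∅) (a := a) hM hM0 hB (by simp) (fun x h1 h2 h3 _ => ⟨h1, h2, h3⟩)
      · rintro x ⟨hx, hxa, hxB⟩
        obtain ⟨p, hp, hp1, hp2, s, hs1, hs2, hs3, hs4⟩ := hgood x hx hxa hxB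
        set ℓ : Set ℂ := {w : ℂ | ∃ t : ℝ, w = a + t • (x - a)} with hℓ
        have hl1 := hline ℓ ⟨a, x - a, sub_ne_zero.2 hxa, rfl⟩
        refine mass_left (B' := A ∩ cthickening C₀⁻¹ ℓ) (a := a) hM hM0 hB ?_ ?_
        · rw [← ENNReal.ofReal_toReal (measure_ne_top_of_subset inter_subset_left hfin : volume (A ∩ cthickening C₀⁻¹ ℓ) ≠ ⊤)]
          exact ENNReal.ofReal_le_ofReal hl1
        · intro x' hx' hxa' hxB' hxt
          obtain ⟨q, hq, hq1, hq2, s', hs1', hs2', hs3', hs4'⟩ := hgood x' hx' hxa' hxB'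
          have hcr : 1 / C₀ ≤ |cr (s • (x - a)) (x' - a)| := by
            by_contra hcon
            push Not at hcon
            obtain ⟨t, ht⟩ := hs4 (x' - a)
            apply hxt
            refine ⟨hx', mem_cthickening_of_dist_le x' (a + t • (x - a)) _ _ ⟨t, rfl⟩ ?_⟩
            rw [dist_eq_norm, ← sub_sub, inv_eq_one_div]
            linarith
          have htr := transversal (h := h) hR hC₀ (by nlinarith) hs1 hs1' hs3 (dir_norm h0 h1 hq)
            hs2' (hAR a haU x' hx') hcr
          simp only [Wset, mem_preimage, mem_iUnion]
          exact ⟨p, hp, q, hq, htr, hx, hx', hp1, hq1, hp2, hq2⟩)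
    (Wset_section h0 h1 hc (by positivity) hN)
  rw [Measure.restrict_apply_univ, hM, ← ENNReal.ofReal_mul (by positivity), ← ENNReal.ofReal_mul (by positivity),
    ← ENNReal.ofReal_mul (by positivity)] at hmain
  have hEfin : volume {a ∈ U | vis a A < lam} ≠ ⊤ :=
    measure_ne_top_of_subset (fun a ha => ha.1) hU.measure_lt_top.ne
  rw [← ENNReal.ofReal_toReal hEfin, ← ENNReal.ofReal_mul (by positivity),
    ENNReal.ofReal_le_ofReal_iff (by positivity)] at hmain
  set v := (volume {a ∈ U | vis a A < lam}).toReal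
  have hv : v ≤ 4 * (N ^ 2 * (Real.pi * (12 * τ / c) ^ 2)) := by
    have : M * M * v ≤ M * M * (4 * (N ^ 2 * (Real.pi * (12 * τ / c) ^ 2))) := by linarith
    exact le_of_mul_le_mul_left this (by positivity)
  refine hv.trans (le_of_eq ?_)
  have e1 : δ ^ (-2 + 2 * α) = (δ ^ (α - 1)) ^ 2 := by
    rw [← Real.rpow_natCast, ← Real.rpow_mul hδ.le]; congr 1; push_cast; ring
  rw [e1, Real.rpow_two, hNd, hτd, hhd]
  field_simp
end

section
/- Let S, V ⊆ ℝ² be compact sets with dist(V,S) > 0, and let ν be a Radon probability measure supported on V. Assume there are constants β > 0 and C > 0 such that ν(ℓ_{x,y}^ρ) ≤ C ρ^β for all ρ > 0 and all x, y ∈ S with x ≠ y, where ℓ_{x,y} is the line through x and y and ℓ_{x,y}^ρ its ρ-neighborhood. Then for every s < min{β, dim_H S}, one has ν({a ∈ V : dim_H(P_a(S)) < s}) = 0. -/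
open MeasureTheory Metric Set

/-- The line through two points `x` and `y`. -/
noncomputable def lineThrough (x y : ℂ) : Set ℂ := {z : ℂ | ∃ t : ℝ, z = x + t • (y - x)}

namespace Aux
open MeasureTheory.Measure

theorem aux_max {ι κ : Type} [Fintype ι] [Fintype κ] (A : κ → Finset ι) (b : κ → ℝ)
    (hb : ∀ j, 0 < b j) (hcov : ∀ i, ∃ j, i ∈ A j) :
    ∃ w : ι → ℝ, (∀ i, 0 ≤ w i) ∧ (∀ j, ∑ i ∈ A j, w i ≤ b j) ∧
      ∀ i, ∃ j, i ∈ A j ∧ ∑ i ∈ A j, w i = b j := by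
  classical
  let K : Set (ι → ℝ) := {w | (∀ i, 0 ≤ w i) ∧ (∀ j, ∑ i ∈ A j, w i ≤ b j)}
  have hKc : IsClosed K := by
    apply IsClosed.inter
    · show IsClosed {w : ι → ℝ | ∀ i, 0 ≤ w i}
      simp only [ofPred_forall]
      exact isClosed_iInter fun i => isClosed_le continuous_const (continuous_apply i)
    · show IsClosed {w : ι → ℝ | ∀ j, ∑ i ∈ A j, w i ≤ b j}
      simp only [ofPred_forall]
      exact isClosed_iInter fun j => isClosed_le
        (continuous_finsetSum _ fun i _ => continuous_apply i) continuous_const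
  have hKsub : K ⊆ Icc (0 : ι → ℝ) (fun _ => ∑ j, b j) := by
    rintro w ⟨h0, h1⟩
    refine ⟨fun i => h0 i, fun i => ?_⟩
    obtain ⟨j, hj⟩ := hcov i
    calc w i ≤ ∑ i ∈ A j, w i := Finset.single_le_sum (fun i _ => h0 i) hj
      _ ≤ b j := h1 j
      _ ≤ ∑ j, b j := Finset.single_le_sum (fun j _ => (hb j).le) (Finset.mem_univ j)
  have hK : IsCompact K := isCompact_Icc.of_isClosed_subset hKc hKsub
  have hne : K.Nonempty := ⟨0, fun i => le_rfl, fun j => by simpa using (hb j).le⟩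
  obtain ⟨w, hw, hmax⟩ := hK.exists_isMaxOn hne
    (f := fun w => ∑ i, w i) (continuous_finsetSum _ fun i _ => continuous_apply i).continuousOn
  refine ⟨w, hw.1, hw.2, fun i => ?_⟩
  by_contra! hcon
  have hev : ∀ᶠ ε : ℝ in nhdsWithin 0 (Ioi 0), ∀ j, i ∈ A j → ε < b j - ∑ i ∈ A j, w i := by
    rw [Filter.eventually_all]
    intro j
    by_cases hj : i ∈ A j
    · have : 0 < b j - ∑ i ∈ A j, w i := by
        have := lt_of_le_of_ne (hw.2 j) (hcon j hj)
        linarith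
      filter_upwards [nhdsWithin_le_nhds (Iio_mem_nhds this)] with ε hε _ using hε
    · simp [hj]
  obtain ⟨ε, hε, hε0⟩ := (hev.and self_mem_nhdsWithin).exists
  have hε0 : 0 < ε := hε0
  have hsum : ∀ s : Finset ι, ∑ l ∈ s, (w + Pi.single i ε : ι → ℝ) l
      = ∑ l ∈ s, w l + if i ∈ s then ε else 0 := by
    intro s
    simp [Finset.sum_add_distrib, Pi.single_apply]
  have hw' : w + Pi.single i ε ∈ K := by
    refine ⟨fun l => ?_, fun j => ?_⟩
    · have := hw.1 l
      by_cases h : l = i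
      · subst h; simp; linarith
      · simp [h, this]
    · rw [hsum]
      split_ifs with h
      · linarith [hε j h]
      · simpa using hw.2 j
  have := hmax hw'
  simp only [mem_ofPred_eq, hsum, Finset.mem_univ, if_true] at this
  linarith

theorem aux_geom (a x y : ℂ) (R r : ℝ) (hxa : x ≠ a) (hya : y ≠ a) (hxy : x ≠ y)
    (hx : dist a x ≤ R) (hy : dist a y ≤ R)
    (h : dist (radialProj a x) (radialProj a y) ≤ r) :
    a ∈ cthickening (R ^ 2 * r / dist x y) (lineThrough x y) := by
  set u := x - a with hu
  set v := y - a with hv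
  have hu0 : u ≠ 0 := sub_ne_zero.mpr hxa
  have hv0 : v ≠ 0 := sub_ne_zero.mpr hya
  have hyx : y - x ≠ 0 := sub_ne_zero.mpr hxy.symm
  have hr : 0 ≤ r := dist_nonneg.trans h
  set z := (a - x) / (y - x) with hz
  have hd : a - (x + (z.re : ℝ) • (y - x)) = (z.im * Complex.I) * (y - x) := by
    have h1 : a - x = z * (y - x) := by rw [hz]; field_simp
    have h2 := Complex.re_add_im z
    have : a - (x + (z.re : ℝ) • (y - x)) = (a - x) - z.re * (y - x) := by
      rw [Complex.real_smul]; ring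
    rw [this, h1]
    linear_combination (y - x) * (-h2)
  refine mem_cthickening_of_dist_le _ (x + (z.re : ℝ) • (y - x)) _ _ ⟨_, rfl⟩ ?_
  rw [dist_eq_norm, hd, norm_mul, norm_mul, Complex.norm_I, mul_one, Complex.norm_real,
    Real.norm_eq_abs]
  have hdxy : dist x y = ‖y - x‖ := by rw [dist_comm, dist_eq_norm]
  have hn : 0 < ‖y - x‖ := norm_pos_iff.mpr hyx
  rw [hdxy, le_div_iff₀ hn]
  have him : z.im * ‖y - x‖ ^ 2 = (v * (starRingEnd ℂ) u).im := by
    have : z * (‖y - x‖ ^ 2 : ℝ) = (a - x) * (starRingEnd ℂ) (y - x) := by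
      rw [← Complex.normSq_eq_norm_sq, ← Complex.mul_conj, hz]; field_simp
    have h3 := congrArg Complex.im this
    rw [Complex.im_mul_ofReal] at h3
    rw [h3, hu, hv]
    simp only [Complex.mul_im, Complex.conj_re, Complex.conj_im, Complex.sub_re, Complex.sub_im]
    ring
  have him2 : (v * (starRingEnd ℂ) u).im
      = ‖u‖ * ‖v‖ * ((radialProj a y - radialProj a x) * (starRingEnd ℂ) (radialProj a x)).im := by
    have hun : ‖u‖ ≠ 0 := norm_ne_zero_iff.mpr hu0
    have hvn : ‖v‖ ≠ 0 := norm_ne_zero_iff.mpr hv0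
    simp only [radialProj, ← hu, ← hv]
    simp only [Complex.mul_im, Complex.conj_re, Complex.conj_im, Complex.sub_re, Complex.sub_im,
      Complex.smul_re, Complex.smul_im, smul_eq_mul]
    field_simp
    ring
  have hP : ‖radialProj a x‖ = 1 := by
    simp only [radialProj, ← hu, norm_smul, norm_inv, norm_norm]
    exact inv_mul_cancel₀ (norm_ne_zero_iff.mpr hu0)
  have hle : |((radialProj a y - radialProj a x) * (starRingEnd ℂ) (radialProj a x)).im| ≤ r := by
    refine (Complex.abs_im_le_norm _).trans ?_
    rw [norm_mul, RCLike.norm_conj, hP, mul_one, ← dist_eq_norm, dist_comm]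
    exact h
  have huR : ‖u‖ ≤ R := by rw [hu, ← dist_eq_norm, dist_comm]; exact hx
  have hvR : ‖v‖ ≤ R := by rw [hv, ← dist_eq_norm, dist_comm]; exact hy
  calc |z.im| * ‖y - x‖ * ‖y - x‖ = |z.im * ‖y - x‖ ^ 2| := by
        rw [abs_mul, abs_of_nonneg (by positivity : 0 ≤ ‖y - x‖ ^ 2)]; ring
    _ ≤ ‖u‖ * ‖v‖ * r := by
        rw [him, him2, abs_mul, abs_of_nonneg (by positivity : 0 ≤ ‖u‖ * ‖v‖)]
        gcongr
    _ ≤ R * R * r := by gcongr; exact (norm_nonneg _).trans huR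
    _ = R ^ 2 * r := by ring

/-- Cauchy-Schwarz lower bound of the discrete energy -/
theorem aux_cs {ι κ : Type} [Fintype ι] (w : ι → ℝ) (hw : ∀ i, 0 ≤ w i) (p : ι → ℂ)
    (I : Finset κ) (z : κ → ℂ) (k : κ → ℕ) (n : ℕ) (hk : ∀ i ∈ I, k i ≤ n) (s : ℝ)
    (hcov : ∀ l, ∃ i ∈ I, dist (p l) (z i) ≤ (1 / 2) ^ k i) :
    (∑ l, w l) ^ 2 ≤ (∑ i ∈ I, ((1 / 2 : ℝ) ^ k i) ^ s) *
      ∑ l, ∑ m, ∑ j ∈ Finset.range (n + 1), w l * w m * ((1 / 2 : ℝ) ^ j) ^ (-s) *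
        (if dist (p l) (p m) ≤ 2 * (1 / 2) ^ j then 1 else 0) := by
  classical
  choose f hfI hf using hcov
  have hsum : ∑ l, w l = ∑ i ∈ I, ∑ l with f l = i, w l :=
    (Finset.sum_fiberwise_of_maps_to (fun l _ => hfI l) _).symm
  rw [hsum]
  have hpos : ∀ j : ℕ, (0:ℝ) < (1 / 2) ^ j := fun j => by positivity
  have h1 := Finset.sum_sq_le_sum_mul_sum_of_sq_le_mul I
    (r := fun i => ∑ l with f l = i, w l) (f := fun i => ((1 / 2 : ℝ) ^ k i) ^ s)
    (g := fun i => ((1 / 2 : ℝ) ^ k i) ^ (-s) * (∑ l with f l = i, w l) ^ 2)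
    (fun i _ => (Real.rpow_pos_of_pos (hpos _) _).le)
    (fun i _ => mul_nonneg (Real.rpow_pos_of_pos (hpos _) _).le (sq_nonneg _))
    (fun i _ => le_of_eq <| by
      rw [← mul_assoc, ← Real.rpow_add (hpos _)]; simp)
  refine h1.trans ?_
  refine mul_le_mul_of_nonneg_left ?_
    (Finset.sum_nonneg fun i _ => (Real.rpow_pos_of_pos (hpos _) _).le)
  have h2 : ∀ i ∈ I, ((1 / 2 : ℝ) ^ k i) ^ (-s) * (∑ l with f l = i, w l) ^ 2
      = ∑ l with f l = i, ∑ m, w l * w m * (((1 / 2 : ℝ) ^ k (f l)) ^ (-s) *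
        if f m = f l then 1 else 0) := by
    intro i hi
    rw [sq, Finset.sum_mul_sum, Finset.mul_sum]
    refine Finset.sum_congr rfl fun l hl => ?_
    rw [Finset.mem_filter] at hl
    rw [hl.2, Finset.mul_sum, Finset.sum_filter]
    refine Finset.sum_congr rfl fun m _ => ?_
    split_ifs <;> ring
  rw [Finset.sum_congr rfl h2, Finset.sum_fiberwise_of_maps_to (fun l _ => hfI l)]
  refine Finset.sum_le_sum fun l _ => Finset.sum_le_sum fun m _ => ?_
  simp_rw [mul_assoc]
  rw [← Finset.mul_sum, ← Finset.mul_sum]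
  refine mul_le_mul_of_nonneg_left (mul_le_mul_of_nonneg_left ?_ (hw m)) (hw l)
  have hnn : ∀ j ∈ Finset.range (n + 1), 0 ≤ ((1 / 2 : ℝ) ^ j) ^ (-s) *
        (if dist (p l) (p m) ≤ 2 * (1 / 2) ^ j then (1:ℝ) else 0) := by
    intro j _
    refine mul_nonneg (Real.rpow_pos_of_pos (hpos _) _).le ?_
    split_ifs <;> norm_num
  split_ifs with h
  · refine le_trans ?_ (Finset.single_le_sum hnn (a := k (f l))
      (Finset.mem_range.mpr (Nat.lt_succ_of_le (hk _ (hfI l)))))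
    rw [if_pos]
    have a1 := hf l
    have a2 := hf m
    rw [h] at a2
    have := dist_triangle_right (p l) (p m) (z (f l))
    linarith
  · rw [mul_zero]; exact Finset.sum_nonneg hnn

theorem aux_content (S : Set ℂ) (t : ℝ) (ht : 0 < t) (hS : μH[t] S ≠ 0) :
    ∃ c : ℝ, 0 < c ∧ ∀ (ι : Type) (I : Finset ι) (z : ι → ℂ) (r : ι → ℝ), (∀ i ∈ I, 0 ≤ r i) →
      S ⊆ ⋃ i ∈ I, closedBall (z i) (r i) → c ≤ ∑ i ∈ I, r i ^ t := by
  by_contra! hcon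
  apply hS
  have hd : ∀ n : ℕ, (0:ℝ) < 1 / ((n:ℝ) + 1) := fun n => by positivity
  choose ι I z r hr hcov hsum using fun n : ℕ => hcon _ (Real.rpow_pos_of_pos (hd n) t)
  have hrle : ∀ n, ∀ i ∈ I n, r n i ≤ 1 / ((n:ℝ) + 1) := by
    intro n i hi
    have h1 : r n i ^ t ≤ (1 / ((n:ℝ) + 1)) ^ t :=
      (Finset.single_le_sum (f := fun i => r n i ^ t)
        (fun i hi => Real.rpow_nonneg (hr n i hi) _) hi).trans (hsum n).le
    exact (Real.rpow_le_rpow_iff (hr n i hi) (hd n).le ht).mp h1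
  have hdiam : ∀ n, ∀ i, ediam (closedBall (z n i) (r n i)) ≤ ENNReal.ofReal (2 * r n i) := by
    intro n i
    refine ediam_le fun x hx y hy => ?_
    rw [edist_dist]
    apply ENNReal.ofReal_le_ofReal
    have := dist_triangle_right x y (z n i)
    rw [mem_closedBall] at hx hy
    linarith
  have hlim : Filter.Tendsto (fun n : ℕ => 1 / ((n:ℝ) + 1)) Filter.atTop (nhds 0) :=
    tendsto_one_div_add_atTop_nhds_zero_nat
  have key := hausdorffMeasure_le_liminf_sum (β := ℕ) (ι := fun n => (I n : Set (ι n))) t S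
    (l := Filter.atTop)
    (fun n => ENNReal.ofReal (2 * (1 / ((n:ℝ) + 1))))
    (by
      rw [← ENNReal.ofReal_zero]
      refine ENNReal.tendsto_ofReal ?_
      simpa using hlim.const_mul 2)
    (fun n i => closedBall (z n i) (r n i))
    (Filter.Eventually.of_forall fun n i => (hdiam n i).trans (ENNReal.ofReal_le_ofReal (by
      have := hrle n i i.2
      linarith)))
    (Filter.Eventually.of_forall fun n => by
      intro x hx
      have := hcov n hx
      simp only [mem_iUnion] at this ⊢
      obtain ⟨i, hi, hx⟩ := this
      exact ⟨⟨i, hi⟩, hx⟩)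
  refine le_antisymm (key.trans ?_) bot_le
  have hub : ∀ n, ∑ i : (I n : Set (ι n)), ediam (closedBall (z n i) (r n i)) ^ t
      ≤ ENNReal.ofReal (2 ^ t * (1 / ((n:ℝ) + 1)) ^ t) := by
    intro n
    calc ∑ i : (I n : Set (ι n)), ediam (closedBall (z n i) (r n i)) ^ t
        ≤ ∑ i : (I n : Set (ι n)), ENNReal.ofReal (2 ^ t * r n i ^ t) := by
          refine Finset.sum_le_sum fun i _ => ?_
          rw [← Real.mul_rpow (by norm_num) (hr n i i.2), ← ENNReal.ofReal_rpow_of_nonneg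
            (mul_nonneg (by norm_num) (hr n i i.2)) ht.le]
          exact ENNReal.rpow_le_rpow (hdiam n i) ht.le
      _ = ∑ i ∈ I n, ENNReal.ofReal (2 ^ t * r n i ^ t) :=
          Finset.sum_coe_sort (I n) (fun i => ENNReal.ofReal (2 ^ t * r n i ^ t))
      _ = ENNReal.ofReal (∑ i ∈ I n, 2 ^ t * r n i ^ t) :=
          (ENNReal.ofReal_sum_of_nonneg fun i hi => mul_nonneg (by positivity)
            (Real.rpow_nonneg (hr n i hi) _)).symm
      _ ≤ _ := by
          apply ENNReal.ofReal_le_ofReal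
          rw [← Finset.mul_sum]
          exact mul_le_mul_of_nonneg_left (hsum n).le (by positivity)
  have hto : Filter.Tendsto (fun n : ℕ => ENNReal.ofReal (2 ^ t * (1 / ((n:ℝ) + 1)) ^ t))
      Filter.atTop (nhds 0) := by
    rw [← ENNReal.ofReal_zero]
    refine ENNReal.tendsto_ofReal ?_
    have := (hlim.rpow_const (p := t) (Or.inr ht.le)).const_mul (2 ^ t)
    rw [Real.zero_rpow ht.ne', mul_zero] at this
    exact this
  calc
    _ ≤ Filter.liminf (fun n : ℕ => ENNReal.ofReal (2 ^ t * (1 / ((n:ℝ) + 1)) ^ t))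
        Filter.atTop := Filter.liminf_le_liminf (Filter.Eventually.of_forall hub)
    _ = 0 := hto.liminf_eq

theorem aux_cover (K : Set ℂ) (hK : IsCompact K) (s : ℝ) (hs : 0 < s) (h0 : μH[s] K = 0)
    (ε : ℝ) (hε : 0 < ε) :
    ∃ (I : Finset ℕ) (z : ℕ → ℂ) (k : ℕ → ℕ), (∀ x ∈ K, ∃ i ∈ I, dist x (z i) ≤ (1 / 2) ^ k i) ∧
      ∑ i ∈ I, ((1 / 2 : ℝ) ^ k i) ^ s ≤ ε := by
  set ε' : ℝ := ε / (2 * 4 ^ s) with hε'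
  have h4 : (0:ℝ) < 4 ^ s := by positivity
  have hε'0 : 0 < ε' := by positivity
  rw [hausdorffMeasure_apply] at h0
  have h1 : (⨅ (t : ℕ → Set ℂ) (_ : K ⊆ ⋃ n, t n) (_ : ∀ n, ediam (t n) ≤ 2⁻¹),
          ∑' n, ⨆ _ : (t n).Nonempty, ediam (t n) ^ s) < ENNReal.ofReal ε' := by
    refine lt_of_le_of_lt ?_ (ENNReal.ofReal_pos.mpr hε'0)
    rw [← h0]
    exact le_iSup₂_of_le (2⁻¹ : ENNReal) (by norm_num) le_rfl
  simp only [iInf_lt_iff] at h1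
  obtain ⟨t, htK, htd, hts⟩ := h1
  obtain ⟨η, hη0, hηs⟩ := ENNReal.exists_pos_sum_of_countable
    (ENNReal.ofReal_pos.mpr hε'0).ne' ℕ
  have hfin : ∀ n, ediam (t n) ≠ ⊤ := fun n => ne_top_of_le_ne_top (by norm_num) (htd n)
  -- diameters
  set d : ℕ → ℝ := fun n => (ediam (t n)).toReal with hdd
  have hd0 : ∀ n, 0 ≤ d n := fun n => ENNReal.toReal_nonneg
  have hd12 : ∀ n, d n ≤ 1 / 2 := fun n => by
    have := ENNReal.toReal_mono (by norm_num) (htd n)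
    simpa using this
  set y : ℕ → ℝ := fun n => min 1 ((η n : ℝ) ^ (1 / s)) with hyd
  have hy0 : ∀ n, 0 < y n := fun n => lt_min one_pos (Real.rpow_pos_of_pos (hη0 n) _)
  have hys : ∀ n, y n ^ s ≤ η n := fun n => by
    calc y n ^ s ≤ ((η n : ℝ) ^ (1 / s)) ^ s :=
          Real.rpow_le_rpow (hy0 n).le (min_le_right _ _) hs.le
      _ = η n := by
        rw [← Real.rpow_mul (η n).coe_nonneg, one_div_mul_cancel hs.ne', Real.rpow_one]
  have hk : ∀ n, ∃ k : ℕ, (1 / 2 : ℝ) ^ (k + 1) < max (2 * d n) (y n) ∧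
      max (2 * d n) (y n) ≤ (1 / 2) ^ k := fun n =>
    exists_nat_pow_near_of_lt_one (lt_max_of_lt_right (hy0 n))
      (max_le (by linarith [hd12 n]) (min_le_left _ _)) (by norm_num) (by norm_num)
  choose k hk1 hk2 using hk
  have hdlt : ∀ n, d n < (1 / 2) ^ k n := fun n => by
    refine lt_of_lt_of_le ?_ (hk2 n)
    rcases (hd0 n).eq_or_lt with h | h
    · rw [← h]; exact lt_max_of_lt_right (hy0 n)
    · exact lt_max_of_lt_left (by linarith)
  -- centres
  set T : Set ℕ := {n | (t n).Nonempty} with hT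
  have hz : ∀ n, ∃ z : ℂ, n ∈ T → z ∈ t n := fun n => by
    by_cases h : n ∈ T
    · exact ⟨h.some, fun _ => h.some_mem⟩
    · exact ⟨0, fun h' => absurd h' h⟩
  choose z hz using hz
  obtain ⟨I, hIT, hIf, hI⟩ := hK.elim_finite_subcover_image (b := T)
    (c := fun n => ball (z n) ((1 / 2) ^ k n))
    (fun n _ => isOpen_ball) (by
      intro x hx
      obtain ⟨n, hn⟩ := mem_iUnion.mp (htK hx)
      have hnT : n ∈ T := ⟨x, hn⟩
      refine mem_iUnion₂.mpr ⟨n, hnT, ?_⟩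
      rw [mem_ball]
      refine lt_of_le_of_lt ?_ (hdlt n)
      rw [dist_edist]
      exact ENNReal.toReal_mono (hfin n) (edist_le_ediam_of_mem hn (hz n hnT)))
  refine ⟨hIf.toFinset, z, k, fun x hx => ?_, ?_⟩
  · obtain ⟨n, hn, hx⟩ := mem_iUnion₂.mp (hI hx)
    exact ⟨n, hIf.mem_toFinset.mpr hn, (mem_ball.mp hx).le⟩
  have hterm : ∀ n, ((1 / 2 : ℝ) ^ k n) ^ s ≤ 4 ^ s * (d n ^ s + η n) := fun n => by
    have e1 : (1 / 2 : ℝ) ^ k n ≤ 2 * max (2 * d n) (y n) := by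
      have := hk1 n
      rw [pow_succ] at this
      linarith
    have e2 : max (2 * d n) (y n) ≤ 2 * max (d n) (y n) := by
      refine max_le ?_ ?_
      · linarith [le_max_left (d n) (y n)]
      · linarith [le_max_right (d n) (y n), hy0 n]
    have e3 : max (d n) (y n) ^ s ≤ d n ^ s + η n := by
      rcases le_total (d n) (y n) with h | h
      · rw [max_eq_right h]
        linarith [hys n, Real.rpow_nonneg (hd0 n) s]
      · rw [max_eq_left h]
        linarith [(η n).coe_nonneg]
    calc ((1 / 2 : ℝ) ^ k n) ^ s ≤ (4 * max (d n) (y n)) ^ s :=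
          Real.rpow_le_rpow (by positivity) (by linarith) hs.le
      _ = 4 ^ s * max (d n) (y n) ^ s :=
          Real.mul_rpow (by norm_num) (le_max_of_le_left (hd0 n))
      _ ≤ _ := by gcongr
  have hsd : ∑ n ∈ hIf.toFinset, d n ^ s ≤ ε' := by
    rw [← ENNReal.ofReal_le_ofReal_iff hε'0.le,
      ENNReal.ofReal_sum_of_nonneg fun n _ => Real.rpow_nonneg (hd0 n) s]
    refine le_trans ?_ ((ENNReal.sum_le_tsum hIf.toFinset).trans hts.le)
    refine Finset.sum_le_sum fun n hn => ?_
    have hnT : (t n).Nonempty := hIT (hIf.mem_toFinset.mp hn)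
    refine le_iSup_of_le hnT ?_
    rw [← ENNReal.ofReal_rpow_of_nonneg (hd0 n) hs.le, ENNReal.ofReal_toReal (hfin n)]
  have hse : ∑ n ∈ hIf.toFinset, (η n : ℝ) ≤ ε' := by
    rw [← ENNReal.ofReal_le_ofReal_iff hε'0.le,
      ENNReal.ofReal_sum_of_nonneg fun n _ => (η n).coe_nonneg]
    refine le_trans ?_ ((ENNReal.sum_le_tsum hIf.toFinset).trans hηs.le)
    simp
  calc ∑ i ∈ hIf.toFinset, ((1 / 2 : ℝ) ^ k i) ^ s
      ≤ ∑ n ∈ hIf.toFinset, 4 ^ s * (d n ^ s + η n) := Finset.sum_le_sum fun n _ => hterm n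
    _ = 4 ^ s * (∑ n ∈ hIf.toFinset, d n ^ s + ∑ n ∈ hIf.toFinset, (η n : ℝ)) := by
        rw [← Finset.mul_sum, Finset.sum_add_distrib]
    _ ≤ 4 ^ s * (ε' + ε') := by gcongr
    _ = ε := by rw [hε']; field_simp; norm_num

theorem aux_frostman (S : Set ℂ) (hS : IsCompact S) (t D c : ℝ) (hD : 0 < D)
    (hc : ∀ (ι : Type) (I : Finset ι) (z : ι → ℂ) (r : ι → ℝ), (∀ i ∈ I, 0 ≤ r i) →
      S ⊆ ⋃ i ∈ I, closedBall (z i) (r i) → c ≤ ∑ i ∈ I, r i ^ t) (n : ℕ) :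
    ∃ F : Finset ℂ, (∀ x ∈ F, x ∈ S) ∧ ∃ w : F → ℝ, (∀ i, 0 ≤ w i) ∧
      (∀ x : F, ∀ k ≤ n, (∑ y ∈ Finset.univ.filter (fun y : F => dist (y : ℂ) x ≤ D * (1 / 2) ^ k), w y)
        ≤ ((1 / 2 : ℝ) ^ k) ^ t) ∧
      c ≤ (6 * D) ^ t * ∑ x, w x := by
  classical
  have hDn : 0 < D * (1 / 2) ^ n := by positivity
  obtain ⟨F', hF'S, hF'f, hcov⟩ := hS.finite_cover_balls hDn
  set F := hF'f.toFinset with hF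
  obtain ⟨w, hw0, hw1, hw2⟩ := aux_max (ι := F) (κ := F × Fin (n + 1))
    (fun j => Finset.univ.filter fun y : F => dist (y : ℂ) j.1 ≤ D * (1 / 2) ^ (j.2 : ℕ))
    (fun j => ((1 / 2 : ℝ) ^ (j.2 : ℕ)) ^ t) (fun j => by positivity)
    (fun i => ⟨(i, 0), by simp [hD.le]⟩)
  refine ⟨F, fun x hx => hF'S (hF'f.mem_toFinset.mp hx), w, hw0, fun x k hk => ?_, ?_⟩
  · exact hw1 (x, ⟨k, Nat.lt_succ_of_le hk⟩)
  choose j hj1 hj2 using hw2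
  simp only [Finset.mem_filter, Finset.mem_univ, true_and] at hj1
  set r : F → ℝ := fun i => D * (1 / 2) ^ ((j i).2 : ℕ) with hr
  have hr0 : ∀ i, 0 < r i := fun i => by positivity
  obtain ⟨u, -, hudisj, hucov⟩ := Vitali.exists_disjoint_subfamily_covering_enlargement_closedBall
    (univ : Set F) (fun i => ((j i).1 : ℂ)) r D (fun i _ => by
      have : (1 / 2 : ℝ) ^ ((j i).2 : ℕ) ≤ 1 := pow_le_one₀ (by norm_num) (by norm_num)
      rw [hr]
      exact mul_le_of_le_one_right hD.le this) 5 (by norm_num)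
  have hcS : S ⊆ ⋃ i ∈ u.toFinset, closedBall ((j i).1 : ℂ) (6 * r i) := by
    intro x hx
    obtain ⟨p, hp, hxp⟩ := mem_iUnion₂.mp (hcov hx)
    obtain ⟨b, hb, hsub⟩ := hucov ⟨p, hF'f.mem_toFinset.mpr hp⟩ (mem_univ _)
    have hpb := hsub (mem_closedBall.mpr (hj1 ⟨p, hF'f.mem_toFinset.mpr hp⟩))
    refine mem_iUnion₂.mpr ⟨b, by simpa using hb, ?_⟩
    rw [mem_closedBall] at hpb ⊢
    rw [mem_ball] at hxp
    have hle : D * (1 / 2) ^ n ≤ r b := by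
      refine mul_le_mul_of_nonneg_left ?_ hD.le
      exact pow_le_pow_of_le_one (by norm_num) (by norm_num) (Nat.le_of_lt_succ (j b).2.2)
    have := dist_triangle x p ((j b).1 : ℂ)
    simp only at hpb
    linarith
  have h1 := hc F u.toFinset (fun i => ((j i).1 : ℂ)) (fun i => 6 * r i)
    (fun i _ => by linarith [hr0 i]) hcS
  refine h1.trans ?_
  have h2 : ∀ i, (6 * r i) ^ t = (6 * D) ^ t * ∑ y ∈ Finset.univ.filter
      (fun y : F => dist (y : ℂ) (j i).1 ≤ D * (1 / 2) ^ ((j i).2 : ℕ)), w y := by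
    intro i
    rw [hj2, ← Real.mul_rpow (by positivity) (by positivity), hr]
    simp only
    ring_nf
  simp_rw [h2]
  rw [← Finset.mul_sum, ← Finset.sum_biUnion]
  · exact mul_le_mul_of_nonneg_left
      (Finset.sum_le_sum_of_subset_of_nonneg (Finset.subset_univ _) fun i _ _ => hw0 i)
      (by positivity)
  · intro a ha b hb hab
    have := hudisj (by simpa using ha) (by simpa using hb) hab
    rw [Function.onFun, Finset.disjoint_left]
    intro y hy1 hy2
    simp only [Finset.mem_filter, Finset.mem_univ, true_and] at hy1 hy2
    exact Set.disjoint_left.mp this (mem_closedBall.mpr hy1) (mem_closedBall.mpr hy2)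

theorem aux_kernel (S V : Set ℂ) 
    (ν : Measure ℂ) [IsProbabilityMeasure ν] (hνV : ν Vᶜ = 0)
    (hne : ∀ a ∈ V, ∀ x ∈ S, x ≠ a)
    (β C t D R : ℝ) (hC : 0 < C) (htβ : t ≤ β) (hD : 0 < D) (hR : 0 < R)
    (hSD : ∀ x ∈ S, ∀ y ∈ S, dist x y ≤ D) (hVR : ∀ a ∈ V, ∀ x ∈ S, dist a x ≤ R)
    (hline : ∀ ρ : ℝ, 0 < ρ → ∀ x ∈ S, ∀ y ∈ S, x ≠ y →
      ν (cthickening ρ (lineThrough x y)) ≤ ENNReal.ofReal (C * ρ ^ β)) :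
    ∃ B : ℝ, 0 < B ∧ ∀ x ∈ S, ∀ y ∈ S, ∀ k : ℕ,
      ν {a | dist (radialProj a x) (radialProj a y) ≤ 2 * (1 / 2) ^ k} ≤
        ENNReal.ofReal (B * ∑ j ∈ Finset.range (k + 1), ((1 / 2 : ℝ) ^ (k - j)) ^ t *
          (if dist y x ≤ D * (1 / 2) ^ j then 1 else 0)) := by
  classical
  set G : ℝ := C * (4 * R ^ 2 / D) ^ β with hG
  have hG0 : 0 < G := by positivity
  refine ⟨1 + G, by positivity, fun x hx y hy k => ?_⟩
  set j := Nat.findGreatest (fun j => dist y x ≤ D * (1 / 2) ^ j) k with hj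
  have hjk : j ≤ k := Nat.findGreatest_le k
  have hjP : dist y x ≤ D * (1 / 2) ^ j :=
    Nat.findGreatest_spec (P := fun j => dist y x ≤ D * (1 / 2) ^ j) (Nat.zero_le k)
      (by simpa using hSD y hy x hx)
  have hsum : ((1 / 2 : ℝ) ^ (k - j)) ^ t ≤ ∑ j ∈ Finset.range (k + 1),
      ((1 / 2 : ℝ) ^ (k - j)) ^ t * (if dist y x ≤ D * (1 / 2) ^ j then 1 else 0) := by
    refine le_trans ?_ (Finset.single_le_sum (f := fun j => ((1 / 2 : ℝ) ^ (k - j)) ^ t *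
      (if dist y x ≤ D * (1 / 2) ^ j then 1 else 0)) ?_ (Finset.mem_range.mpr
        (Nat.lt_succ_of_le hjk)))
    · simp only [if_pos hjP, mul_one, le_refl]
    · intro i _
      refine mul_nonneg (by positivity) ?_
      split_ifs <;> norm_num
  refine le_trans ?_ (ENNReal.ofReal_le_ofReal
    (mul_le_mul_of_nonneg_left hsum (by positivity)))
  rcases hjk.eq_or_lt with hjk' | hlt
  · refine prob_le_one.trans ?_
    rw [hjk', Nat.sub_self]
    simp only [pow_zero, Real.one_rpow, mul_one]
    rw [← ENNReal.ofReal_one]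
    exact ENNReal.ofReal_le_ofReal (by linarith)
  have hnot : D * (1 / 2) ^ (j + 1) < dist y x :=
    not_le.mp (Nat.findGreatest_is_greatest (P := fun j => dist y x ≤ D * (1 / 2) ^ j)
      (Nat.lt_succ_self j) hlt)
  have hd0 : 0 < dist y x := lt_trans (by positivity) hnot
  have hxy : x ≠ y := by
    rintro rfl
    simp at hd0
  set ρ : ℝ := 4 * R ^ 2 / D * (1 / 2) ^ (k - j) with hρ
  have hρ0 : 0 < ρ := by positivity
  have hsub : {a | dist (radialProj a x) (radialProj a y) ≤ 2 * (1 / 2) ^ k}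
      ⊆ cthickening ρ (lineThrough x y) ∪ Vᶜ := by
    intro a ha
    by_cases haV : a ∈ V
    · left
      refine cthickening_mono ?_ _ (aux_geom a x y R (2 * (1 / 2) ^ k) (hne a haV x hx)
        (hne a haV y hy) hxy (hVR a haV x hx) (hVR a haV y hy) ha)
      rw [dist_comm x y, div_le_iff₀ hd0]
      have e1 : (1 / 2 : ℝ) ^ k = (1 / 2) ^ (k - j) * (1 / 2) ^ j := by
        rw [← pow_add, Nat.sub_add_cancel hjk]
      calc R ^ 2 * (2 * (1 / 2) ^ k) = ρ * (D * (1 / 2) ^ (j + 1)) := by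
            rw [hρ, e1, pow_succ (1 / 2 : ℝ) j]; field_simp; ring
        _ ≤ ρ * dist y x := by gcongr
    · right; exact haV
  calc ν {a | dist (radialProj a x) (radialProj a y) ≤ 2 * (1 / 2) ^ k}
      ≤ ν (cthickening ρ (lineThrough x y)) + ν Vᶜ := (measure_mono hsub).trans (measure_union_le _ _)
    _ ≤ ENNReal.ofReal (C * ρ ^ β) := by rw [hνV, add_zero]; exact hline ρ hρ0 x hx y hy hxy
    _ ≤ _ := by
      apply ENNReal.ofReal_le_ofReal
      rw [hρ, Real.mul_rpow (by positivity) (by positivity), ← mul_assoc, ← hG]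
      have e2 : ((1 / 2 : ℝ) ^ (k - j)) ^ β ≤ ((1 / 2 : ℝ) ^ (k - j)) ^ t :=
        Real.rpow_le_rpow_of_exponent_ge (by positivity)
          (pow_le_one₀ (by norm_num) (by norm_num)) htβ
      have e3 : 0 ≤ ((1 / 2 : ℝ) ^ (k - j)) ^ t := by positivity
      nlinarith

theorem aux_lint {ι : Type} (ν : Measure ℂ) (I : Finset ι) (f : ι → ℂ → ℝ) (B : ι → ℝ)
    (h : ∀ i ∈ I, Measurable (f i) ∧ (∀ a, 0 ≤ f i a) ∧ 0 ≤ B i ∧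
      ∫⁻ a, ENNReal.ofReal (f i a) ∂ν ≤ ENNReal.ofReal (B i)) :
    Measurable (fun a => ∑ i ∈ I, f i a) ∧ (∀ a, 0 ≤ ∑ i ∈ I, f i a) ∧ 0 ≤ ∑ i ∈ I, B i ∧
      ∫⁻ a, ENNReal.ofReal (∑ i ∈ I, f i a) ∂ν ≤ ENNReal.ofReal (∑ i ∈ I, B i) := by
  refine ⟨Finset.measurable_fun_sum _ fun i hi => (h i hi).1,
    fun a => Finset.sum_nonneg fun i hi => (h i hi).2.1 a,
    Finset.sum_nonneg fun i hi => (h i hi).2.2.1, ?_⟩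
  rw [ENNReal.ofReal_sum_of_nonneg fun i hi => (h i hi).2.2.1]
  calc ∫⁻ a, ENNReal.ofReal (∑ i ∈ I, f i a) ∂ν
      = ∫⁻ a, ∑ i ∈ I, ENNReal.ofReal (f i a) ∂ν := by
        refine lintegral_congr fun a => ?_
        rw [ENNReal.ofReal_sum_of_nonneg fun i hi => (h i hi).2.1 a]
    _ = ∑ i ∈ I, ∫⁻ a, ENNReal.ofReal (f i a) ∂ν :=
        lintegral_finsetSum' _ fun i hi => (h i hi).1.ennreal_ofReal.aemeasurable
    _ ≤ _ := Finset.sum_le_sum fun i hi => (h i hi).2.2.2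

theorem aux_term (ν : Measure ℂ) (x y : ℂ) (r c B : ℝ) (hc : 0 ≤ c) (hB : 0 ≤ B)
    (h : ν {a | dist (radialProj a x) (radialProj a y) ≤ r} ≤ ENNReal.ofReal B) :
    Measurable (fun a => c * (if dist (radialProj a x) (radialProj a y) ≤ r then (1:ℝ) else 0)) ∧
    (∀ a, 0 ≤ c * (if dist (radialProj a x) (radialProj a y) ≤ r then (1:ℝ) else 0)) ∧
    0 ≤ c * B ∧
    ∫⁻ a, ENNReal.ofReal (c * (if dist (radialProj a x) (radialProj a y) ≤ r then (1:ℝ) else 0)) ∂ν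
      ≤ ENNReal.ofReal (c * B) := by
  have hm : MeasurableSet {a | dist (radialProj a x) (radialProj a y) ≤ r} := by
    refine measurableSet_le ?_ measurable_const
    unfold radialProj
    fun_prop
  refine ⟨(Measurable.ite hm measurable_const measurable_const).const_mul c, fun a => ?_,
    mul_nonneg hc hB, ?_⟩
  · refine mul_nonneg hc ?_
    split_ifs <;> norm_num
  · have : ∀ a, ENNReal.ofReal (c * (if dist (radialProj a x) (radialProj a y) ≤ r
        then (1:ℝ) else 0)) = ENNReal.ofReal c *
        ({a | dist (radialProj a x) (radialProj a y) ≤ r}.indicator 1 a) := by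
      intro a
      rw [ENNReal.ofReal_mul hc]
      congr 1
      by_cases ha : dist (radialProj a x) (radialProj a y) ≤ r
      · simp [ha]
      · simp [ha]
    simp_rw [this]
    rw [lintegral_const_mul _ (measurable_one.indicator hm), lintegral_indicator_one hm,
      ENNReal.ofReal_mul hc]
    gcongr

theorem aux_energy (S : Set ℂ) (ν : Measure ℂ) (D B t s : ℝ) (hB : 0 < B) (hst : s < t)
    (hSD : ∀ x ∈ S, ∀ y ∈ S, dist x y ≤ D)
    (hker : ∀ x ∈ S, ∀ y ∈ S, ∀ k : ℕ,
      ν {a | dist (radialProj a x) (radialProj a y) ≤ 2 * (1 / 2) ^ k} ≤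
        ENNReal.ofReal (B * ∑ j ∈ Finset.range (k + 1), ((1 / 2 : ℝ) ^ (k - j)) ^ t *
          (if dist y x ≤ D * (1 / 2) ^ j then 1 else 0))) :
    ∃ M : ℝ, ∀ (n : ℕ) (F : Finset ℂ) (w : F → ℝ), (∀ x ∈ F, x ∈ S) → (∀ i, 0 ≤ w i) →
      (∀ x : F, ∀ k ≤ n, (∑ y ∈ Finset.univ.filter (fun y : F => dist (y : ℂ) x ≤ D * (1 / 2) ^ k), w y)
        ≤ ((1 / 2 : ℝ) ^ k) ^ t) →
      Measurable (fun a => ∑ l, ∑ m, ∑ j ∈ Finset.range (n + 1),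
        w l * w m * ((1 / 2 : ℝ) ^ j) ^ (-s) *
        (if dist (radialProj a l) (radialProj a m) ≤ 2 * (1 / 2) ^ j then 1 else 0)) ∧
      ∫⁻ a, ENNReal.ofReal (∑ l, ∑ m, ∑ j ∈ Finset.range (n + 1),
        w l * w m * ((1 / 2 : ℝ) ^ j) ^ (-s) *
        (if dist (radialProj a l) (radialProj a m) ≤ 2 * (1 / 2) ^ j then 1 else 0)) ∂ν
        ≤ ENNReal.ofReal M := by
  classical
  set q : ℝ := (1 / 2) ^ (t - s) with hq
  have hq0 : 0 < q := by positivity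
  have hq1 : q < 1 := Real.rpow_lt_one (by norm_num) (by norm_num) (by linarith)
  have hsummable : Summable (fun j : ℕ => ((j:ℝ) + 1) * q ^ j) := by
    have h1 := summable_pow_mul_geometric_of_norm_lt_one 1 (r := q)
      (by rwa [Real.norm_of_nonneg hq0.le])
    have h2 := summable_geometric_of_lt_one hq0.le hq1
    refine (h1.add h2).congr fun j => ?_
    ring
  refine ⟨B * ∑' j : ℕ, ((j:ℝ) + 1) * q ^ j, fun n F w hFS hw0 hw1 => ?_⟩
  set κ : ℕ → F → F → ℝ := fun k x y => B * ∑ j ∈ Finset.range (k + 1),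
    ((1 / 2 : ℝ) ^ (k - j)) ^ t * (if dist (y:ℂ) x ≤ D * (1 / 2) ^ j then 1 else 0) with hκ
  have hκ0 : ∀ k x y, 0 ≤ κ k x y := fun k x y => by
    refine mul_nonneg hB.le (Finset.sum_nonneg fun j _ => mul_nonneg (by positivity) ?_)
    split_ifs <;> norm_num
  have hmain := aux_lint ν Finset.univ _ _ fun (l : F) _ => aux_lint ν Finset.univ _ _
    fun (m : F) _ => aux_lint ν (Finset.range (n + 1)) _ _ fun j _ =>
      aux_term ν l m (2 * (1 / 2) ^ j) (w l * w m * ((1 / 2 : ℝ) ^ j) ^ (-s)) (κ j l m)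
        (mul_nonneg (mul_nonneg (hw0 l) (hw0 m)) (by positivity)) (hκ0 j l m)
        (hker l (hFS l l.2) m (hFS m m.2) j)
  refine ⟨hmain.1, hmain.2.2.2.trans (ENNReal.ofReal_le_ofReal ?_)⟩
  -- the inner sum over `m`
  have hin : ∀ l : F, ∀ k ≤ n, ∑ m, w m * κ k l m ≤ B * (((k:ℝ) + 1) * ((1 / 2 : ℝ) ^ k) ^ t) := by
    intro l k hk
    calc ∑ m, w m * κ k l m = B * ∑ j ∈ Finset.range (k + 1), ((1 / 2 : ℝ) ^ (k - j)) ^ t *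
          ∑ m ∈ Finset.univ.filter (fun m : F => dist (m : ℂ) l ≤ D * (1 / 2) ^ j), w m := by
          simp_rw [hκ, Finset.mul_sum]
          rw [Finset.sum_comm]
          refine Finset.sum_congr rfl fun j _ => ?_
          rw [Finset.sum_filter]
          refine Finset.sum_congr rfl fun m _ => ?_
          split_ifs <;> ring
      _ ≤ B * ∑ j ∈ Finset.range (k + 1), ((1 / 2 : ℝ) ^ k) ^ t := by
          refine mul_le_mul_of_nonneg_left (Finset.sum_le_sum fun j hj => ?_) hB.le
          have hjk : j ≤ k := Nat.le_of_lt_succ (Finset.mem_range.mp hj)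
          calc ((1 / 2 : ℝ) ^ (k - j)) ^ t * ∑ m ∈ Finset.univ.filter (fun m : F => dist (m : ℂ) l ≤ D * (1 / 2) ^ j), w m
              ≤ ((1 / 2 : ℝ) ^ (k - j)) ^ t * ((1 / 2 : ℝ) ^ j) ^ t :=
                mul_le_mul_of_nonneg_left (hw1 l j (hjk.trans hk)) (by positivity)
            _ = ((1 / 2 : ℝ) ^ k) ^ t := by
                rw [← Real.mul_rpow (by positivity) (by positivity), ← pow_add,
                  Nat.sub_add_cancel hjk]
      _ = _ := by simp
  have hpow : ∀ j : ℕ, ((1 / 2 : ℝ) ^ j) ^ (-s) * ((1 / 2 : ℝ) ^ j) ^ t = q ^ j := fun j => by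
    rw [← Real.rpow_add (by positivity), hq, ← Real.rpow_natCast, ← Real.rpow_natCast,
      ← Real.rpow_mul (by norm_num), ← Real.rpow_mul (by norm_num)]
    ring_nf
  have hl : ∀ l : F, ∑ m, ∑ j ∈ Finset.range (n + 1),
      w l * w m * ((1 / 2 : ℝ) ^ j) ^ (-s) * κ j l m ≤
      w l * (B * ∑' j : ℕ, ((j:ℝ) + 1) * q ^ j) := by
    intro l
    calc ∑ m, ∑ j ∈ Finset.range (n + 1), w l * w m * ((1 / 2 : ℝ) ^ j) ^ (-s) * κ j l m
        = w l * ∑ j ∈ Finset.range (n + 1), ((1 / 2 : ℝ) ^ j) ^ (-s) * ∑ m, w m * κ j l m := by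
          rw [Finset.sum_comm, Finset.mul_sum]
          refine Finset.sum_congr rfl fun j _ => ?_
          rw [Finset.mul_sum, Finset.mul_sum]
          refine Finset.sum_congr rfl fun m _ => ?_
          ring
      _ ≤ w l * ∑ j ∈ Finset.range (n + 1), B * (((j:ℝ) + 1) * q ^ j) := by
          refine mul_le_mul_of_nonneg_left (Finset.sum_le_sum fun j hj => ?_) (hw0 l)
          calc _ ≤ ((1 / 2 : ℝ) ^ j) ^ (-s) * (B * (((j:ℝ) + 1) * ((1 / 2 : ℝ) ^ j) ^ t)) :=
                mul_le_mul_of_nonneg_left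
                  (hin l j (Nat.le_of_lt_succ (Finset.mem_range.mp hj))) (by positivity)
            _ = _ := by rw [← hpow]; ring
      _ ≤ _ := by
          rw [← Finset.mul_sum]
          refine mul_le_mul_of_nonneg_left (mul_le_mul_of_nonneg_left ?_ hB.le) (hw0 l)
          exact hsummable.sum_le_tsum _ fun j _ => by positivity
  refine (Finset.sum_le_sum fun l _ => hl l).trans ?_
  rw [← Finset.sum_mul]
  refine mul_le_of_le_one_left (mul_nonneg hB.le (tsum_nonneg fun j => by positivity)) ?_
  rcases isEmpty_or_nonempty F with he | ⟨⟨x0⟩⟩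
  · simp
  · have := hw1 x0 0 (Nat.zero_le n)
    rw [Finset.filter_true_of_mem] at this
    · simpa using this
    · intro y _
      simpa using hSD y (hFS y y.2) x0 (hFS x0 x0.2)

end Aux

open MeasureTheory.Measure Aux

/-- Kaufman-type estimate for radial projections: if the measure `ν` on the vantage
set `V` is unconcentrated near lines through pairs of points of `S`, then for
`s < min {β, dim_H S}` the set of vantage points from which the radial projection of
`S` has dimension `< s` is `ν`-null. -/
theorem stmt4 (S V : Set ℂ) (hS : IsCompact S) (hV : IsCompact V)
    (hdist : ∃ ε : ℝ, 0 < ε ∧ ∀ x ∈ V, ∀ y ∈ S, ε ≤ dist x y)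
    (ν : Measure ℂ) [IsProbabilityMeasure ν] (hνV : ν Vᶜ = 0)
    (β C : ℝ) (hβ : 0 < β) (hC : 0 < C)
    (hline : ∀ ρ : ℝ, 0 < ρ → ∀ x ∈ S, ∀ y ∈ S, x ≠ y →
      ν (cthickening ρ (lineThrough x y)) ≤ ENNReal.ofReal (C * ρ ^ β))
    (s : ℝ) (hs : ENNReal.ofReal s < min (ENNReal.ofReal β) (dimH S)) :
    ν {a ∈ V | dimH (radialProj a '' S) < ENNReal.ofReal s} = 0 := by
  rcases le_or_gt s 0 with hs0 | hs0
  · have : {a ∈ V | dimH (radialProj a '' S) < ENNReal.ofReal s} = ∅ := by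
      ext a
      simp [ENNReal.ofReal_of_nonpos hs0]
    rw [this, measure_empty]
  obtain ⟨t, hst, htm⟩ := ENNReal.lt_iff_exists_nnreal_btwn.mp hs
  obtain ⟨htβ, htS⟩ := lt_min_iff.mp htm
  have hst' : s < t := by
    rw [← ENNReal.ofReal_coe_nnreal] at hst
    exact (ENNReal.ofReal_lt_ofReal_iff_of_nonneg hs0.le).mp hst
  have htβ' : (t : ℝ) ≤ β := by
    rw [← ENNReal.ofReal_coe_nnreal] at htβ
    exact ((ENNReal.ofReal_lt_ofReal_iff hβ).mp htβ).le
  have ht0 : (0:ℝ) < t := hs0.trans hst'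
  have hHt : μH[(t:ℝ)] S ≠ 0 := by
    rw [hausdorffMeasure_of_lt_dimH htS]; exact ENNReal.top_ne_zero
  obtain ⟨c, hc0, hc⟩ := aux_content S t ht0 hHt
  obtain ⟨ε, hε, hdist⟩ := hdist
  have hne : ∀ a ∈ V, ∀ x ∈ S, x ≠ a := by
    rintro a ha x hx rfl
    have := hdist x ha x hx
    rw [dist_self] at this
    linarith
  obtain ⟨R, hR0, hR⟩ : ∃ R : ℝ, 0 < R ∧ ∀ x ∈ S ∪ V, ∀ y ∈ S ∪ V, dist x y ≤ R := by
    obtain ⟨R, hR⟩ := Metric.isBounded_iff.mp (hS.union hV).isBounded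
    exact ⟨max R 1, by positivity, fun x hx y hy => (hR hx hy).trans (le_max_left _ _)⟩
  have hSD : ∀ x ∈ S, ∀ y ∈ S, dist x y ≤ R := fun x hx y hy => hR x (.inl hx) y (.inl hy)
  obtain ⟨B, hB, hker⟩ := aux_kernel S V ν hνV hne β C t R R hC htβ' hR0 hR0 hSD
    (fun a ha x hx => hR a (.inr ha) x (.inl hx)) hline
  obtain ⟨M, hM⟩ := aux_energy S ν R B t s hB hst' hSD hker
  choose F hFS w hw0 hw1 hwc using aux_frostman S hS t R c hR0 hc
  set E : ℕ → ℂ → ℝ := fun n a => ∑ l, ∑ m, ∑ j ∈ Finset.range (n + 1),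
        w n l * w n m * ((1 / 2 : ℝ) ^ j) ^ (-s) *
        (if dist (radialProj a l) (radialProj a m) ≤ 2 * (1 / 2) ^ j then 1 else 0) with hE
  have hEm : ∀ n, Measurable (fun a => ENNReal.ofReal (E n a)) := fun n =>
    (hM n (F n) (w n) (hFS n) (hw0 n) (hw1 n)).1.ennreal_ofReal
  have hEi : ∀ n, ∫⁻ a, ENNReal.ofReal (E n a) ∂ν ≤ ENNReal.ofReal M := fun n =>
    (hM n (F n) (w n) (hFS n) (hw0 n) (hw1 n)).2
  have hfatou : ∫⁻ a, Filter.liminf (fun n => ENNReal.ofReal (E n a)) Filter.atTop ∂ν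
      ≤ ENNReal.ofReal M := by
    refine (lintegral_liminf_le hEm).trans ?_
    refine (Filter.liminf_le_liminf (Filter.Eventually.of_forall hEi)).trans ?_
    simp
  have hae := ae_lt_top (Measurable.liminf hEm)
    (ne_top_of_le_ne_top ENNReal.ofReal_ne_top hfatou)
  refine measure_mono_null ?_ hae
  rintro a ⟨haV, ha⟩ hlt
  have hlt : Filter.liminf (fun n => ENNReal.ofReal (E n a)) Filter.atTop < ⊤ := hlt
  -- lower bound for the energies
  have hH0 : μH[s] (radialProj a '' S) = 0 := by
    have := hausdorffMeasure_of_dimH_lt (d := s.toNNReal) ha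
    rwa [Real.coe_toNNReal s hs0.le] at this
  have hKc : IsCompact (radialProj a '' S) := by
    refine hS.image_of_continuousOn ?_
    have e1 : ContinuousOn (fun x : ℂ => x - a) S := by fun_prop
    exact (e1.norm.inv₀ fun x hx =>
      norm_ne_zero_iff.mpr (sub_ne_zero.mpr (hne a haV x hx))).smul e1
  set c' : ℝ := c / (6 * R) ^ (t:ℝ) with hc'
  have hc'0 : 0 < c' := by positivity
  have hc'w : ∀ n, c' ≤ ∑ x, w n x := fun n => by
    rw [hc', div_le_iff₀ (by positivity), mul_comm]
    exact hwc n
  obtain ⟨L, hL0, hL⟩ : ∃ L : ℝ, 0 < L ∧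
      Filter.liminf (fun n => ENNReal.ofReal (E n a)) Filter.atTop < ENNReal.ofReal L := by
    obtain ⟨L, hL1, hL2⟩ := ENNReal.lt_iff_exists_nnreal_btwn.mp hlt
    refine ⟨L, ?_, by rwa [ENNReal.ofReal_coe_nnreal]⟩
    have h0 : (0 : ENNReal) < L := lt_of_le_of_lt (zero_le) hL1
    exact_mod_cast h0
  obtain ⟨I, z, k, hcov, hsum⟩ := aux_cover _ hKc s hs0 hH0 (c' ^ 2 / L) (by positivity)
  refine absurd hL (not_lt.mpr ?_)
  refine Filter.le_liminf_of_le (by isBoundedDefault) ?_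
  filter_upwards [Filter.eventually_ge_atTop (I.sup k)] with n hn
  apply ENNReal.ofReal_le_ofReal
  have h1 := aux_cs (w n) (hw0 n) (fun x => radialProj a x) I z k n
    (fun i hi => (Finset.le_sup hi).trans hn) s
    (fun l => hcov _ ⟨l, hFS n l l.2, rfl⟩)
  have h2 : c' ^ 2 ≤ (∑ x, w n x) ^ 2 := by
    have := hc'w n
    gcongr
  have hE0 : 0 ≤ E n a := by
    refine Finset.sum_nonneg fun l _ => Finset.sum_nonneg fun m _ => Finset.sum_nonneg fun j _ => ?_
    refine mul_nonneg (mul_nonneg (mul_nonneg (hw0 n l) (hw0 n m)) (by positivity)) ?_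
    split_ifs <;> norm_num
  have h3 : c' ^ 2 ≤ c' ^ 2 / L * E n a :=
    (h2.trans h1).trans (mul_le_mul_of_nonneg_right hsum hE0)
  have h4 : c' ^ 2 / L * E n a = c' ^ 2 * (E n a / L) := by ring
  rw [h4] at h3
  have h5 : 1 ≤ E n a / L := le_of_mul_le_mul_left (by simpa using h3) (by positivity : 0 < c' ^ 2)
  rwa [one_le_div hL0] at h5
end

section
/- Fix R > 0. Let T′ be the closed right triangle with corners (0,0), (0,R), (R,0), let I_V be the line segment from (−R,−R) to (−R,2R) and I_H the segment from (−R,−R) to (2R,−R). Let S ⊆ T′ be compact and let μ be a Radon probability measure supported on S. Then there exists a constant C > 0 depending only on R such that: (i) ∫_{I_V ∪ I_H} |P_a(S)|^{−1} da ≤ C · I₁(μ), and (ii) I₁(μ)^{−1} ≤ C · ∫_{I_V ∪ I_H} |P_a(S)| da, where the integrals over I_V ∪ I_H are with respect to arc-length measure. -/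
open MeasureTheory Metric Set
open scoped ENNReal

/-- The closed right triangle with corners `(0,0)`, `(0,R)`, `(R,0)`. -/
noncomputable def Tprime (R : ℝ) : Set ℂ :=
  convexHull ℝ ({⟨0, 0⟩, ⟨0, R⟩, ⟨R, 0⟩} : Set ℂ)

/-- The vertical segment from `(-R,-R)` to `(-R,2R)`. -/
noncomputable def IV (R : ℝ) : Set ℂ := segment ℝ (⟨-R, -R⟩ : ℂ) (⟨-R, 2 * R⟩ : ℂ)

/-- The horizontal segment from `(-R,-R)` to `(2R,-R)`. -/
noncomputable def IH (R : ℝ) : Set ℂ := segment ℝ (⟨-R, -R⟩ : ℂ) (⟨2 * R, -R⟩ : ℂ)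

/-- The 1-energy `I₁(μ) = ∬ |x-y|⁻¹ dμ(x) dμ(y)`. -/
noncomputable def energy1 (μ : Measure ℂ) : ℝ≥0∞ := ∫⁻ x, ∫⁻ y, (edist x y)⁻¹ ∂μ ∂μ

open Filter Topology

lemma cs_aux {X : Type*} [MeasurableSpace X] (μ : Measure X) [IsProbabilityMeasure μ]
    (s : X → ℝ) (hs : Measurable s) (K : Set ℝ) (hK : ∀ᵐ x ∂μ, s x ∈ K) (δ : ℝ) (hδ : 0 < δ) :
    (volume (cthickening δ K))⁻¹ ≤
      (ENNReal.ofReal (2 * δ))⁻¹ * (μ.prod μ) {z : X × X | |s z.1 - s z.2| ≤ 2 * δ} := by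
  set K' := cthickening δ K with hK'
  set D := ENNReal.ofReal (2 * δ) with hD
  have hD0 : D ≠ 0 := by simp [hD, hδ]
  have hDt : D ≠ ⊤ := ENNReal.ofReal_ne_top
  set g : ℝ → ℝ≥0∞ := fun r => μ {x | |s x - r| ≤ δ} with hg
  have hE : MeasurableSet {z : ℝ × X | |s z.2 - z.1| ≤ δ} :=
    measurableSet_le (by fun_prop) measurable_const
  have hgm : Measurable g := measurable_measure_prodMk_left hE
  have hball : ∀ c : ℝ, volume {r : ℝ | |c - r| ≤ δ} = D := by
    intro c
    have : {r : ℝ | |c - r| ≤ δ} = closedBall c δ := by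
      ext r; simp [mem_closedBall, Real.dist_eq, abs_sub_comm]
    rw [this, Real.volume_closedBall]
  have hint : ∫⁻ r, g r = D := by
    have h1 := Measure.prod_apply (μ := (volume : Measure ℝ)) (ν := μ) hE
    have h2 := Measure.prod_apply_symm (μ := (volume : Measure ℝ)) (ν := μ) hE
    have : ∫⁻ r, g r = ∫⁻ x, D ∂μ := by
      rw [← lintegral_congr (fun x => hball (s x))]
      exact h1.symm.trans h2
    simpa using this
  have hF : MeasurableSet {z : ℝ × (X × X) | |s z.2.1 - z.1| ≤ δ ∧ |s z.2.2 - z.1| ≤ δ} :=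
    MeasurableSet.inter
      (s₁ := {z : ℝ × (X × X) | |s z.2.1 - z.1| ≤ δ}) (s₂ := {z : ℝ × (X × X) | |s z.2.2 - z.1| ≤ δ})
      (measurableSet_le (by fun_prop) measurable_const)
      (measurableSet_le (by fun_prop) measurable_const)
  set P := (μ.prod μ) {z : X × X | |s z.1 - s z.2| ≤ 2 * δ} with hP
  have hPm : MeasurableSet {z : X × X | |s z.1 - s z.2| ≤ 2 * δ} :=
    measurableSet_le (by fun_prop) measurable_const
  have hsq : ∫⁻ r, g r ^ 2 ≤ D * P := by
    have h1 := Measure.prod_apply (μ := (volume : Measure ℝ)) (ν := μ.prod μ) hF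
    have h2 := Measure.prod_apply_symm (μ := (volume : Measure ℝ)) (ν := μ.prod μ) hF
    have e1 : ∀ r, g r ^ 2 = (μ.prod μ) (Prod.mk r ⁻¹' {z : ℝ × (X × X) | |s z.2.1 - z.1| ≤ δ ∧ |s z.2.2 - z.1| ≤ δ}) := by
      intro r
      rw [sq, hg, ← Measure.prod_prod]
      rfl
    rw [lintegral_congr e1, ← h1, h2, hP, ← lintegral_indicator_const hPm]
    apply lintegral_mono
    intro z
    dsimp only
    by_cases hz : |s z.1 - s z.2| ≤ 2 * δ
    · rw [indicator_of_mem (by exact hz), ← hball (s z.1)]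
      exact measure_mono (fun r hr => hr.1)
    · have : ((fun x => (x, z)) ⁻¹' {z : ℝ × (X × X) | |s z.2.1 - z.1| ≤ δ ∧ |s z.2.2 - z.1| ≤ δ}) = ∅ := by
        ext r
        simp only [mem_preimage, mem_ofPred_eq, mem_empty_iff_false, iff_false]
        rintro ⟨ha, hb⟩
        apply hz
        rw [abs_le] at *
        constructor <;> linarith
      rw [this]; simp
  have hsupp : ∀ r, g r = K'.indicator 1 r * g r := by
    intro r
    by_cases hr : r ∈ K'
    · simp [hr]
    · have : g r = 0 := by
        rw [hg]
        refine measure_mono_null (t := {x | ¬ s x ∈ K}) ?_ hK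
        intro x hx hxK
        exact hr (mem_cthickening_of_dist_le r (s x) δ K hxK (by
          rw [Real.dist_eq, abs_sub_comm]; exact hx))
      simp [this]
  have hK'm : MeasurableSet K' := isClosed_cthickening.measurableSet
  have hCS : D ^ 2 ≤ volume K' * (D * P) := by
    have h := ENNReal.lintegral_mul_le_Lp_mul_Lq (volume : Measure ℝ) (p := 2) (q := 2)
      Real.HolderConjugate.two_two (f := K'.indicator 1) (g := g)
      ((measurable_one.indicator hK'm).aemeasurable) hgm.aemeasurable
    have h0 : ∫⁻ r, (K'.indicator (1 : ℝ → ℝ≥0∞) * g) r = D := by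
      rw [← hint]; exact lintegral_congr (fun r => (hsupp r).symm)
    have h3 : ∫⁻ r, (K'.indicator (1 : ℝ → ℝ≥0∞) r) ^ (2:ℝ) = volume K' := by
      rw [← lintegral_indicator_one hK'm]
      apply lintegral_congr
      intro r
      by_cases hr : r ∈ K' <;> simp [hr]
    rw [h0, h3] at h
    have h4 : ∫⁻ r, g r ^ (2:ℝ) ≤ D * P := by simpa using hsq
    have h5 : D ^ (2:ℝ) ≤ (volume K') * ∫⁻ r, g r ^ (2:ℝ) := by
      have := ENNReal.rpow_le_rpow h (z := 2) (by norm_num)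
      rwa [ENNReal.mul_rpow_of_nonneg _ _ (by norm_num), ← ENNReal.rpow_mul, ← ENNReal.rpow_mul,
        one_div, inv_mul_cancel₀ (by norm_num), ENNReal.rpow_one, ENNReal.rpow_one] at this
    have h6 := h5.trans (mul_le_mul_right h4 _)
    simpa using h6
  have h7 : D ≤ volume K' * P := by
    have : D * D ≤ D * (volume K' * P) := by
      calc D * D = D ^ 2 := (sq D).symm
        _ ≤ _ := hCS
        _ = _ := by ring
    exact (ENNReal.mul_le_mul_iff_right hD0 hDt).1 this
  rw [mul_comm, ← div_eq_mul_inv, ENNReal.le_div_iff_mul_le (Or.inl hD0) (Or.inl hDt), mul_comm, ← div_eq_mul_inv]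
  exact ENNReal.div_le_of_le_mul' h7

lemma cs_lim {X : Type*} [MeasurableSpace X] (μ : Measure X) [IsProbabilityMeasure μ]
    (s : X → ℝ) (hs : Measurable s) (K : Set ℝ) (hKc : IsCompact K) (hK : ∀ᵐ x ∂μ, s x ∈ K) :
    (volume K)⁻¹ ≤ liminf (fun n : ℕ => (ENNReal.ofReal (1 / ((n:ℝ) + 1)))⁻¹ *
      (μ.prod μ) {z : X × X | |s z.1 - s z.2| ≤ 1 / ((n:ℝ) + 1)}) atTop := by
  have h0 : Tendsto (fun n : ℕ => (1 / ((n:ℝ) + 1)) / 2) atTop (𝓝 0) := by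
    simpa using (tendsto_one_div_add_atTop_nhds_zero_nat (𝕜 := ℝ)).div_const 2
  have h1 := (tendsto_measure_cthickening_of_isCompact (μ := volume) hKc).comp h0
  have h2 := (tendsto_inv_iff.2 h1)
  rw [← h2.liminf_eq]
  refine liminf_le_liminf (Eventually.of_forall fun n => ?_)
  have hp : (0:ℝ) < 1 / ((n:ℝ) + 1) / 2 := by positivity
  have := cs_aux μ s hs K hK _ hp
  rwa [mul_div_cancel₀ _ (two_ne_zero)] at this

lemma geom_aux (R : ℝ) (hR : 0 < R) (x1 x2 y1 y2 d ε : ℝ) (hd : 0 < d) (hε : 0 < ε)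
    (hx1 : 0 ≤ x1) (hx1' : x1 ≤ R) (hx2 : 0 ≤ x2) (hx2' : x2 ≤ R)
    (hy1 : 0 ≤ y1) (hy1' : y1 ≤ R) (hy2 : 0 ≤ y2) (hy2' : y2 ≤ R)
    (hdd : d ≤ |x1 - y1| + |x2 - y2|) :
    volume ({t : ℝ | |(x2 - t) / (x1 + R) - (y2 - t) / (y1 + R)| ≤ ε} ∩ Icc (-R) (2 * R)) ≤
      ENNReal.ofReal (40 * R ^ 2 * ε / d) := by
  have hu : 0 < x1 + R := by linarith
  have hv : 0 < y1 + R := by linarith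
  have key : ∀ t, |(x2 - t) / (x1 + R) - (y2 - t) / (y1 + R)| ≤ ε →
      |(x2 - y2) * (y1 + R) + (y2 - t) * (y1 - x1)| ≤ 4 * R ^ 2 * ε := by
    intro t ht
    have e : (x2 - t) / (x1 + R) - (y2 - t) / (y1 + R) =
        ((x2 - y2) * (y1 + R) + (y2 - t) * (y1 - x1)) / ((x1 + R) * (y1 + R)) := by
      field_simp; ring
    rw [e, abs_div, abs_of_pos (mul_pos hu hv), div_le_iff₀ (mul_pos hu hv)] at ht
    refine ht.trans ?_
    have : (x1 + R) * (y1 + R) ≤ 4 * R ^ 2 := by nlinarith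
    nlinarith
  by_cases hc : 4 * |x1 - y1| ≤ |x2 - y2|
  · have hdd2 : d ≤ 5 / 4 * |x2 - y2| := by linarith
    by_cases hem : ({t : ℝ | |(x2 - t) / (x1 + R) - (y2 - t) / (y1 + R)| ≤ ε} ∩ Icc (-R) (2 * R)).Nonempty
    · obtain ⟨t, ht, ht1, ht2⟩ := hem
      have k := key t ht
      have h1 : |(x2 - y2) * (y1 + R)| ≤ |(x2 - y2) * (y1 + R) + (y2 - t) * (y1 - x1)| + |(y2 - t) * (y1 - x1)| := by
        have := abs_sub ((x2 - y2) * (y1 + R) + (y2 - t) * (y1 - x1)) ((y2 - t) * (y1 - x1))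
        rwa [add_sub_cancel_right] at this
      rw [abs_mul, abs_mul (y2 - t), abs_of_pos hv, abs_sub_comm y1 x1] at h1
      have h2 : |y2 - t| ≤ 2 * R := by rw [abs_le]; constructor <;> linarith
      have h3 : |y2 - t| * |x1 - y1| ≤ 2 * R * (|x2 - y2| / 4) :=
        mul_le_mul h2 (by linarith) (abs_nonneg _) (by linarith)
      have h4 : |x2 - y2| * R ≤ |x2 - y2| * (y1 + R) :=
        mul_le_mul_of_nonneg_left (by linarith) (abs_nonneg _)
      have h5 : |x2 - y2| * R ≤ 8 * R * ε * R := by nlinarith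
      have h6 : |x2 - y2| ≤ 8 * R * ε := le_of_mul_le_mul_right h5 hR
      refine (measure_mono inter_subset_right).trans ?_
      rw [Real.volume_Icc]
      apply ENNReal.ofReal_le_ofReal
      rw [le_div_iff₀ hd]
      nlinarith [mul_pos hR hε]
    · rw [not_nonempty_iff_eq_empty.1 hem]; simp
  · push Not at hc
    have hdd2 : d ≤ 5 * |x1 - y1| := by linarith
    have hpos : 0 < |x1 - y1| := by linarith
    have hne : y1 - x1 ≠ 0 := by
      intro h; rw [abs_sub_comm, h] at hpos; simp at hpos
    set c := y2 + (x2 - y2) * (y1 + R) / (y1 - x1) with hcdef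
    refine (measure_mono (t := closedBall c (4 * R ^ 2 * ε / |x1 - y1|)) ?_).trans ?_
    · rintro t ⟨ht, -⟩
      have k := key t ht
      have e : (x2 - y2) * (y1 + R) + (y2 - t) * (y1 - x1) = (c - t) * (y1 - x1) := by
        rw [hcdef]; field_simp; ring
      rw [e, abs_mul, abs_sub_comm y1] at k
      rw [mem_closedBall, Real.dist_eq, abs_sub_comm, le_div_iff₀ hpos]
      exact k
    · rw [Real.volume_closedBall]
      apply ENNReal.ofReal_le_ofReal
      rw [mul_div_assoc', div_le_div_iff₀ hpos hd]
      have : 0 ≤ R ^ 2 * ε := by positivity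
      nlinarith

lemma core_aux (R : ℝ) (hR : 0 < R) (p q : ℂ →L[ℝ] ℝ) (hpq : ∀ z, ‖z‖ ≤ |p z| + |q z|)
    (S : Set ℂ) (μ : Measure ℂ) (hSc : IsCompact S) [IsProbabilityMeasure μ] (hμ : μ Sᶜ = 0)
    (hS : ∀ x ∈ S, 0 ≤ p x ∧ p x ≤ R ∧ 0 ≤ q x ∧ q x ≤ R) :
    ∃ g : ℝ → ℝ≥0∞, Measurable g ∧
      ∫⁻ t in Icc (-R) (2 * R), g t ≤ ENNReal.ofReal (40 * R ^ 2) * energy1 μ ∧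
      ∀ t, (volume ((fun x => (q x - t) / (p x + R)) '' S))⁻¹ ≤ g t := by
  have hae : ∀ᵐ x ∂μ, x ∈ S := hμ
  set A : ℕ → Set (ℝ × (ℂ × ℂ)) := fun n =>
    {z | |(q z.2.1 - z.1) / (p z.2.1 + R) - (q z.2.2 - z.1) / (p z.2.2 + R)| ≤ 1 / ((n:ℝ) + 1)} with hA
  have hAm : ∀ n, MeasurableSet (A n) := by
    intro n
    refine measurableSet_le ?_ measurable_const
    have hp := p.continuous.measurable
    have hq := q.continuous.measurable
    fun_prop
  set G : ℕ → ℝ → ℝ≥0∞ := fun n t => (ENNReal.ofReal (1 / ((n:ℝ) + 1)))⁻¹ *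
      (μ.prod μ) (Prod.mk t ⁻¹' A n) with hG
  have hGm : ∀ n, Measurable (G n) := fun n =>
    (measurable_measure_prodMk_left (hAm n)).const_mul _
  refine ⟨fun t => liminf (fun n => G n t) atTop, Measurable.liminf hGm, ?_, ?_⟩
  · refine (lintegral_liminf_le hGm).trans ?_
    have hb : ∀ n, ∫⁻ t in Icc (-R) (2 * R), G n t ≤ ENNReal.ofReal (40 * R ^ 2) * energy1 μ := by
      intro n
      have hε : (0:ℝ) < 1 / ((n:ℝ) + 1) := by positivity
      set ε : ℝ := 1 / ((n:ℝ) + 1) with hεd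
      have e0 : ENNReal.ofReal ε ≠ 0 := by simpa using hε
      have hen : energy1 μ = ∫⁻ z, (edist z.1 z.2)⁻¹ ∂(μ.prod μ) := by
        rw [energy1, lintegral_prod]
        exact (measurable_edist.inv).aemeasurable
      have h1 : ∫⁻ t in Icc (-R) (2 * R), (μ.prod μ) (Prod.mk t ⁻¹' A n) =
          ∫⁻ z, (volume.restrict (Icc (-R) (2 * R))) ((fun t => (t, z)) ⁻¹' A n) ∂(μ.prod μ) := by
        rw [← Measure.prod_apply (hAm n), Measure.prod_apply_symm (hAm n)]
      have hae2 : ∀ᵐ z ∂(μ.prod μ), z.1 ∈ S ∧ z.2 ∈ S :=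
        (Measure.quasiMeasurePreserving_fst.ae hae).and (Measure.quasiMeasurePreserving_snd.ae hae)
      have h2 : ∫⁻ z, (volume.restrict (Icc (-R) (2 * R))) ((fun t => (t, z)) ⁻¹' A n) ∂(μ.prod μ) ≤
          ∫⁻ z, ENNReal.ofReal ε * (ENNReal.ofReal (40 * R ^ 2) * (edist z.1 z.2)⁻¹) ∂(μ.prod μ) := by
        apply lintegral_mono_ae
        filter_upwards [hae2] with z hz
        obtain ⟨hz1, hz2⟩ := hz
        by_cases hne : z.1 = z.2
        · rw [hne]
          have e1 : ENNReal.ofReal (40 * R ^ 2) ≠ 0 := by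
            simp only [ne_eq, ENNReal.ofReal_eq_zero, not_le]; positivity
          simp only [edist_self, ENNReal.inv_zero]
          rw [ENNReal.mul_top e1, ENNReal.mul_top e0]
          exact le_top
        · have hd : 0 < dist z.1 z.2 := dist_pos.2 hne
          rw [Measure.restrict_apply' measurableSet_Icc]
          obtain ⟨a1, a2, a3, a4⟩ := hS _ hz1
          obtain ⟨b1, b2, b3, b4⟩ := hS _ hz2
          refine (geom_aux R hR (p z.1) (q z.1) (p z.2) (q z.2) (dist z.1 z.2) ε hd hε
            a1 a2 a3 a4 b1 b2 b3 b4 ?_).trans ?_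
          · have := hpq (z.1 - z.2)
            rwa [map_sub, map_sub, ← dist_eq_norm] at this
          · rw [edist_dist, ← ENNReal.ofReal_inv_of_pos hd, ← ENNReal.ofReal_mul (by positivity),
              ← ENNReal.ofReal_mul hε.le]
            apply ENNReal.ofReal_le_ofReal
            apply le_of_eq
            field_simp
      rw [hG]
      dsimp only
      rw [lintegral_const_mul _ (measurable_measure_prodMk_left (hAm n)), h1, hen]
      refine (mul_le_mul_right h2 _).trans ?_
      rw [lintegral_const_mul _ (by fun_prop), lintegral_const_mul _ (by fun_prop), ← mul_assoc,
        ENNReal.inv_mul_cancel e0 ENNReal.ofReal_ne_top, one_mul]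
    exact liminf_le_of_le (by isBoundedDefault) (fun b hb' => by
      obtain ⟨n, hn⟩ := hb'.exists
      exact hn.trans (hb n))
  · intro t
    refine cs_lim μ (fun x => (q x - t) / (p x + R)) ?_ _ ?_ ?_
    · have hp := p.continuous.measurable
      have hq := q.continuous.measurable
      fun_prop
    · apply hSc.image_of_continuousOn
      apply ContinuousOn.div (by fun_prop) (by fun_prop)
      intro x hx
      have := (hS x hx).1
      positivity
    · filter_upwards [hae] with x hx using mem_image_of_mem _ hx

lemma lip_aux (R : ℝ) (hR : 0 < R) (p q : ℂ →L[ℝ] ℝ) (hpq : ∀ z, ‖z‖ ≤ |p z| + |q z|)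
    (hp : ∀ z, |p z| ≤ ‖z‖) (hq : ∀ z, |q z| ≤ ‖z‖)
    (S : Set ℂ) (hS : ∀ x ∈ S, 0 ≤ p x ∧ p x ≤ R ∧ 0 ≤ q x ∧ q x ≤ R)
    (a : ℂ) (t : ℝ) (ha1 : p a = -R) (ha2 : q a = t) (ht : t ∈ Icc (-R) (2 * R)) :
    volume ((fun x => (q x - t) / (p x + R)) '' S) ≤ 32 * μH[1] (radialProj a '' S) := by
  have hpos : ∀ x ∈ S, 0 < ‖x - a‖ ∧ ‖x - a‖ ≤ 4 * R ∧ R ≤ p x + R := by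
    intro x hx
    obtain ⟨a1, a2, a3, a4⟩ := hS x hx
    have h1 := hpq (x - a)
    have h2 := hp (x - a)
    rw [map_sub, map_sub, ha1, ha2] at h1
    rw [map_sub, ha1] at h2
    obtain ⟨t1, t2⟩ := ht
    have e1 : |p x - -R| = p x + R := by rw [sub_neg_eq_add]; exact abs_of_nonneg (by linarith)
    have e2 : |q x - t| ≤ 2 * R := by rw [abs_le]; constructor <;> linarith
    rw [e1] at h1 h2
    exact ⟨by linarith, by linarith, by linarith⟩
  have hprop : ∀ z ∈ radialProj a '' S, 1 / 4 ≤ p z ∧ ‖z‖ ≤ 1 := by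
    rintro _ ⟨x, hx, rfl⟩
    obtain ⟨h1, h2, h3⟩ := hpos x hx
    constructor
    · rw [radialProj, map_smul, map_sub, ha1, smul_eq_mul, sub_neg_eq_add, inv_mul_eq_div,
        div_le_div_iff₀ (by norm_num) h1]
      linarith
    · rw [radialProj, norm_smul, norm_inv, norm_norm, inv_mul_cancel₀ h1.ne']
  have himg : (fun x => (q x - t) / (p x + R)) '' S =
      (fun z => q z / p z) '' (radialProj a '' S) := by
    rw [image_image]
    apply image_congr
    intro x hx
    obtain ⟨h1, h2, h3⟩ := hpos x hx
    rw [radialProj, map_smul, map_smul, map_sub, map_sub, ha1, ha2, smul_eq_mul, smul_eq_mul,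
      sub_neg_eq_add, mul_div_mul_left _ _ (inv_ne_zero h1.ne')]
  have hL : LipschitzOnWith 32 (fun z => q z / p z) (radialProj a '' S) := by
    apply LipschitzOnWith.of_dist_le_mul
    intro z hz w hw
    obtain ⟨z1, z2⟩ := hprop z hz
    obtain ⟨w1, w2⟩ := hprop w hw
    have hz0 : 0 < p z := by linarith
    have hw0 : 0 < p w := by linarith
    rw [Real.dist_eq, dist_eq_norm, div_sub_div _ _ hz0.ne' hw0.ne', abs_div,
      abs_of_pos (mul_pos hz0 hw0), div_le_iff₀ (mul_pos hz0 hw0)]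
    have e : q z * p w - p z * q w = p z * q (z - w) - q z * p (z - w) := by
      rw [map_sub, map_sub]; ring
    have b1 : |p z * q (z - w)| ≤ 1 * ‖z - w‖ := by
      rw [abs_mul]
      exact mul_le_mul ((hp z).trans z2) (hq _) (abs_nonneg _) zero_le_one
    have b2 : |q z * p (z - w)| ≤ 1 * ‖z - w‖ := by
      rw [abs_mul]
      exact mul_le_mul ((hq z).trans z2) (hp _) (abs_nonneg _) zero_le_one
    have b3 : (1:ℝ) / 16 ≤ p z * p w := by nlinarith
    have b4 := abs_sub (p z * q (z - w)) (q z * p (z - w))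
    rw [e]
    have : ‖z - w‖ * (1 / 16) ≤ ‖z - w‖ * (p z * p w) :=
      mul_le_mul_of_nonneg_left b3 (norm_nonneg _)
    have e32 : ((32 : NNReal) : ℝ) = 32 := rfl
    rw [e32]
    linarith
  rw [himg, ← hausdorffMeasure_real]
  simpa using hL.hausdorffMeasure_image_le zero_le_one

lemma side_aux (R : ℝ) (hR : 0 < R) (p q : ℂ →L[ℝ] ℝ) (hpq : ∀ z, ‖z‖ ≤ |p z| + |q z|)
    (hp : ∀ z, |p z| ≤ ‖z‖) (hq : ∀ z, |q z| ≤ ‖z‖)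
    (S : Set ℂ) (μ : Measure ℂ) (hSc : IsCompact S) [IsProbabilityMeasure μ] (hμ : μ Sᶜ = 0)
    (hS : ∀ x ∈ S, 0 ≤ p x ∧ p x ≤ R ∧ 0 ≤ q x ∧ q x ≤ R)
    (φ : ℝ → ℂ) (hφ : Isometry φ) (hφp : ∀ t, p (φ t) = -R) (hφq : ∀ t, q (φ t) = t) :
    (∫⁻ a in φ '' Icc (-R) (2 * R), (μH[1] (radialProj a '' S))⁻¹ ∂μH[1]) ≤
            ENNReal.ofReal (1280 * R ^ 2) * energy1 μ ∧
        (energy1 μ)⁻¹ ≤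
            ENNReal.ofReal 640 * ∫⁻ a in φ '' Icc (-R) (2 * R), μH[1] (radialProj a '' S) ∂μH[1] := by
  obtain ⟨g, hgm, hgi, hg⟩ := core_aux R hR p q hpq S μ hSc hμ hS
  have hemb : MeasurableEmbedding φ := hφ.isClosedEmbedding.measurableEmbedding
  have hJ : (μH[1] : Measure ℂ).restrict (φ '' Icc (-R) (2 * R)) =
      Measure.map φ (volume.restrict (Icc (-R) (2 * R))) := by
    rw [← Measure.restrict_restrict_of_subset (image_subset_range φ _),
      ← hφ.map_hausdorffMeasure (Or.inl zero_le_one), hausdorffMeasure_real, hemb.restrict_map,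
      preimage_image_eq _ hφ.injective]
  rw [hJ, hemb.lintegral_map, hemb.lintegral_map]
  set h : ℝ → ℝ≥0∞ := fun t => 32 * g t with hh
  have hhm : Measurable h := hgm.const_mul _
  set I := energy1 μ with hI
  have hhi : ∫⁻ t in Icc (-R) (2 * R), h t ≤ ENNReal.ofReal (1280 * R ^ 2) * I := by
    rw [hh, lintegral_const_mul _ hgm]
    refine (mul_le_mul_right hgi _).trans ?_
    rw [← mul_assoc]
    apply le_of_eq
    congr 1
    have : (32 : ℝ≥0∞) = ENNReal.ofReal 32 := by simp
    rw [this, ← ENNReal.ofReal_mul (by norm_num)]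
    congr 1; ring
  have hfh : ∀ t ∈ Icc (-R) (2 * R), (μH[1] (radialProj (φ t) '' S))⁻¹ ≤ h t := by
    intro t ht
    have h1 := lip_aux R hR p q hpq hp hq S hS (φ t) t (hφp t) (hφq t) ht
    have h2 := hg t
    have h3 := (ENNReal.inv_le_inv.2 h1).trans h2
    rw [ENNReal.mul_inv (Or.inl (by norm_num)) (Or.inl (by norm_num)), mul_comm,
      ← div_eq_mul_inv] at h3
    rw [hh]
    have := (ENNReal.div_le_iff (by norm_num) (by norm_num)).1 h3
    rwa [mul_comm] at this
  refine ⟨(setLIntegral_mono hhm hfh).trans hhi, ?_⟩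
  by_cases hIt : I = ⊤
  · simp [hIt]
  have hI0 : I ≠ 0 := by
    intro h0
    rw [hI, energy1, lintegral_eq_zero_iff (by
      exact Measurable.lintegral_prod_right' (f := fun z : ℂ × ℂ => (edist z.1 z.2)⁻¹) (by fun_prop))] at h0
    obtain ⟨x, hx⟩ := h0.exists
    dsimp at hx
    rw [lintegral_eq_zero_iff (by fun_prop)] at hx
    obtain ⟨y, hy⟩ := hx.exists
    dsimp at hy
    exact edist_ne_top x y (ENNReal.inv_eq_zero.1 hy)
  set lam := ENNReal.ofReal (1280 * R) * I with hlam
  have hl0 : lam ≠ 0 := mul_ne_zero (by simpa using hR) hI0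
  have hlt : lam ≠ ⊤ := ENNReal.mul_ne_top ENNReal.ofReal_ne_top hIt
  set ν := (volume : Measure ℝ).restrict (Icc (-R) (2 * R)) with hν
  have hνu : ν univ = ENNReal.ofReal (3 * R) := by
    rw [hν, Measure.restrict_apply_univ, Real.volume_Icc]; congr 1; ring
  have hM1 : ν {t | lam ≤ h t} ≤ ENNReal.ofReal R := by
    have := (mul_meas_ge_le_lintegral (μ := ν) hhm lam).trans hhi
    have e : ENNReal.ofReal (1280 * R ^ 2) * I = lam * ENNReal.ofReal R := by
      rw [hlam, mul_right_comm, ← ENNReal.ofReal_mul (by positivity)]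
      congr 2; ring
    rw [e] at this
    exact (ENNReal.mul_le_mul_iff_right hl0 hlt).1 this
  have hM2 : ENNReal.ofReal (2 * R) ≤ ν {t | lam⁻¹ ≤ (h t)⁻¹} := by
    have h1 : ν univ ≤ ν {t | lam ≤ h t} + ν {t | lam⁻¹ ≤ (h t)⁻¹} := by
      refine (measure_mono ?_).trans (measure_union_le _ _)
      intro t _
      rcases le_total lam (h t) with h | h
      · exact Or.inl h
      · exact Or.inr (ENNReal.inv_le_inv.2 h)
    rw [hνu] at h1
    have h2 := h1.trans (add_le_add_left hM1 _)
    have e : ENNReal.ofReal (3 * R) = ENNReal.ofReal R + ENNReal.ofReal (2 * R) := by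
      rw [← ENNReal.ofReal_add (by positivity) (by positivity)]; congr 1; ring
    rw [e] at h2
    exact (ENNReal.add_le_add_iff_left ENNReal.ofReal_ne_top).1 h2
  have hM3 := mul_meas_ge_le_lintegral (μ := ν) hhm.inv lam⁻¹
  have hM4 : ∫⁻ t, (h t)⁻¹ ∂ν ≤ ∫⁻ t, μH[1] (radialProj (φ t) '' S) ∂ν := by
    apply lintegral_mono_ae
    filter_upwards [ae_restrict_mem measurableSet_Icc] with t ht
    have := ENNReal.inv_le_inv.2 (hfh t ht)
    rwa [inv_inv] at this
  have hM5 : lam⁻¹ * ENNReal.ofReal (2 * R) ≤ ∫⁻ t, μH[1] (radialProj (φ t) '' S) ∂ν :=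
    (mul_le_mul_right hM2 _).trans (hM3.trans hM4)
  refine le_trans (le_of_eq ?_) (mul_le_mul_right hM5 _)
  rw [hlam, ENNReal.mul_inv (Or.inr hIt) (Or.inr hI0), ← ENNReal.ofReal_inv_of_pos (by positivity),
    mul_right_comm, ← mul_assoc, ← ENNReal.ofReal_mul (by positivity),
    ← ENNReal.ofReal_mul (by positivity)]
  have : (640:ℝ) * ((1280 * R)⁻¹ * (2 * R)) = 1 := by field_simp; norm_num
  rw [this]; simp

lemma tprime_aux (R : ℝ) (hR : 0 < R) (x : ℂ) (hx : x ∈ Tprime R) :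
    (0 ≤ x.re ∧ x.re ≤ R) ∧ (0 ≤ x.im ∧ x.im ≤ R) := by
  have h : Tprime R ⊆ (Icc 0 R) ×ℂ (Icc 0 R) := by
    apply convexHull_min
    · intro z hz
      simp only [mem_insert_iff, mem_singleton_iff] at hz
      rcases hz with rfl | rfl | rfl <;> simp [Complex.mem_reProdIm, hR.le]
    · exact ((convex_Icc (0:ℝ) R).linear_preimage Complex.reLm).inter
        ((convex_Icc (0:ℝ) R).linear_preimage Complex.imLm)
  exact h hx

lemma IV_aux (R : ℝ) (hR : 0 < R) : IV R = (fun t : ℝ => (⟨-R, t⟩ : ℂ)) '' Icc (-R) (2 * R) := by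
  rw [← segment_eq_Icc (by linarith), IV, segment_eq_image, segment_eq_image, image_image]
  apply image_congr
  intro t _
  apply Complex.ext <;> simp
  ring

lemma IH_aux (R : ℝ) (hR : 0 < R) : IH R = (fun t : ℝ => (⟨t, -R⟩ : ℂ)) '' Icc (-R) (2 * R) := by
  rw [← segment_eq_Icc (by linarith), IH, segment_eq_image, segment_eq_image, image_image]
  apply image_congr
  intro t _
  apply Complex.ext <;> simp
  ring

/-- Energy bounds for radial projections from `I_V ∪ I_H`:
(i) `∫_{I_V ∪ I_H} |P_a(S)|⁻¹ da ≲ I₁(μ)` and (ii) `I₁(μ)⁻¹ ≲ ∫_{I_V ∪ I_H} |P_a(S)| da`. -/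
theorem stmt6 (R : ℝ) (hR : 0 < R) :
    ∃ C : ℝ, 0 < C ∧
      ∀ (S : Set ℂ) (μ : Measure ℂ), IsCompact S → S ⊆ Tprime R →
        IsProbabilityMeasure μ → μ Sᶜ = 0 →
        (∫⁻ a in (IV R ∪ IH R), (μH[1] (radialProj a '' S))⁻¹ ∂μH[1]) ≤
            ENNReal.ofReal C * energy1 μ ∧
        (energy1 μ)⁻¹ ≤
            ENNReal.ofReal C * ∫⁻ a in (IV R ∪ IH R), μH[1] (radialProj a '' S) ∂μH[1] := by
  refine ⟨2560 * R ^ 2 + 640, by positivity, ?_⟩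
  intro S μ hSc hST hprob hμ
  have hV := side_aux R hR Complex.reCLM Complex.imCLM (fun z => Complex.norm_le_abs_re_add_abs_im z)
    (fun z => Complex.abs_re_le_norm z) (fun z => Complex.abs_im_le_norm z) S μ hSc hμ
    (fun x hx => by
      obtain ⟨⟨h1, h2⟩, h3, h4⟩ := tprime_aux R hR x (hST hx)
      exact ⟨h1, h2, h3, h4⟩)
    (fun t : ℝ => (⟨-R, t⟩ : ℂ)) (Isometry.of_dist_eq fun s t => by
      exact Complex.dist_of_re_eq rfl) (fun t => rfl) (fun t => rfl)
  have hH := side_aux R hR Complex.imCLM Complex.reCLM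
    (fun z => (Complex.norm_le_abs_re_add_abs_im z).trans_eq (add_comm _ _))
    (fun z => Complex.abs_im_le_norm z) (fun z => Complex.abs_re_le_norm z) S μ hSc hμ
    (fun x hx => by
      obtain ⟨⟨h1, h2⟩, h3, h4⟩ := tprime_aux R hR x (hST hx)
      exact ⟨h3, h4, h1, h2⟩)
    (fun t : ℝ => (⟨t, -R⟩ : ℂ)) (Isometry.of_dist_eq fun s t => by
      exact Complex.dist_of_im_eq rfl) (fun t => rfl) (fun t => rfl)
  rw [← IV_aux R hR] at hV
  rw [← IH_aux R hR] at hH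
  constructor
  · refine (lintegral_union_le _ _ _).trans ((add_le_add hV.1 hH.1).trans ?_)
    rw [← add_mul, ← ENNReal.ofReal_add (by positivity) (by positivity)]
    refine mul_le_mul_left (ENNReal.ofReal_le_ofReal (by linarith)) _
  · refine hV.2.trans (mul_le_mul' (ENNReal.ofReal_le_ofReal ?_) (lintegral_mono_set subset_union_left))
    nlinarith
end
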